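/- arXiv:1507.02476 — 3 statements merged into one kernel-verified Lean document; each statement's English description precedes it below -/
import Mathlib

section
/- There exists a field K, finitely generated over ℂ and of transcendence degree 3 over ℂ, such that K admits a ℂ-algebra embedding into the rational function field ℂ(t₁,t₂,t₃) (i.e. K is unirational over ℂ), but K is not purely transcendental over ℂ. (Negative answer to the Lüroth problem in dimension 3.) -/
open MvPolynomial

/-- The rational function field `ℂ(t₁,…,tₘ)`, realized as the field of fractions of the
polynomial ring over `ℂ` in `m` variables. -/
abbrev CRatFunc (m : ℕ) : Type := FractionRing (MvPolynomial (Fin m) ℂ)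

/-- A `ℂ`-algebra `K` is purely transcendental over `ℂ` if it is isomorphic as a `ℂ`-algebra
to `ℂ(t₁,…,tₘ)` for some `m ≥ 0`. -/
def IsPurelyTranscendental (K : Type*) [CommRing K] [Algebra ℂ K] : Prop :=
  ∃ m : ℕ, Nonempty (K ≃ₐ[ℂ] CRatFunc m)

/-- A `ℂ`-algebra `K` is unirational over `ℂ` if it admits a `ℂ`-algebra embedding into
`ℂ(t₁,…,tₘ)` for some `m`. -/
def IsUnirational (K : Type*) [CommRing K] [Algebra ℂ K] : Prop :=
  ∃ (m : ℕ) (f : K →ₐ[ℂ] CRatFunc m), Function.Injective f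

/-- A field `K` over `ℂ` is stably rational over `ℂ` if `K(u₁,…,uₙ)` is purely transcendental
over `ℂ` for some `n ≥ 0`. -/
def IsStablyRational (K : Type*) [Field K] [Algebra ℂ K] : Prop :=
  ∃ n : ℕ, IsPurelyTranscendental (FractionRing (MvPolynomial (Fin n) K))

/-- Dehomogenization at `X₀ = 1`: the image of `F ∈ ℂ[X₀,…,Xₙ]` under `X₀ ↦ 1`,
`X_{i+1} ↦ xᵢ`. -/
noncomputable def dehom {n : ℕ} (F : MvPolynomial (Fin (n + 1)) ℂ) : MvPolynomial (Fin n) ℂ :=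
  aeval (Fin.cases 1 X) F

/-! ### Symbols `(a,b)` and their ramification -/

section Symbols

/-- `a` has even valuation. -/
def EvV {K Γ : Type} [Field K] [LinearOrderedCommGroupWithZero Γ] (v : Valuation K Γ) (a : K) :
    Prop := ∃ z, v a = v z ^ 2

/-- `a` is a square up to a principal unit. -/
def SqV {K Γ : Type} [Field K] [LinearOrderedCommGroupWithZero Γ] (v : Valuation K Γ) (a : K) :
    Prop := ∃ z, v (a - z ^ 2) < v a

/-- the symbol `(a,b)` is unramified at `v`. -/
def UrV {K Γ : Type} [Field K] [LinearOrderedCommGroupWithZero Γ] (v : Valuation K Γ) (a b : K) :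
    Prop := (EvV v a ∧ EvV v b) ∨ SqV v a ∨ SqV v b ∨ SqV v (-(a * b))

variable {K Γ : Type} [Field K] [LinearOrderedCommGroupWithZero Γ] (v : Valuation K Γ)

lemma sub_lt_imp_eq {a z : K} (h : v (a - z) < v a) : v a = v z := by
  have := Valuation.map_sub_eq_of_lt_right v (x := a - z) (y := a) h
  rw [← this]
  simp [Valuation.map_neg]

lemma SqV.ev {a : K} (h : SqV v a) : EvV v a := by
  obtain ⟨z, hz⟩ := h
  exact ⟨z, by rw [← map_pow]; exact sub_lt_imp_eq v hz⟩

lemma SqV.mul {a b : K} (ha : SqV v a) (hb : SqV v b) : SqV v (a * b) := by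
  obtain ⟨z, hz⟩ := ha
  obtain ⟨w, hw⟩ := hb
  have e1 := sub_lt_imp_eq v hz
  have e2 := sub_lt_imp_eq v hw
  have ha0 : 0 < v a := lt_of_le_of_lt zero_le hz
  have hb0 : 0 < v b := lt_of_le_of_lt zero_le hw
  refine ⟨z * w, ?_⟩
  have : a * b - (z * w) ^ 2 = a * (b - w ^ 2) + w ^ 2 * (a - z ^ 2) := by ring
  rw [this]
  refine Valuation.map_add_lt v ?_ ?_
  · rw [map_mul, map_mul]; exact mul_lt_mul_of_pos_left hw ha0
  · rw [map_mul, map_mul, ← e2, mul_comm]; exact mul_lt_mul_of_pos_right hz hb0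

lemma SqV.sq {a : K} (h : a ≠ 0) : SqV v (a ^ 2) := ⟨a, by simp [zero_lt_iff, h]⟩

lemma EvV.mul {a b : K} (ha : EvV v a) (hb : EvV v b) : EvV v (a * b) := by
  obtain ⟨z, hz⟩ := ha
  obtain ⟨w, hw⟩ := hb
  exact ⟨z * w, by simp [hz, hw, mul_pow]⟩

lemma EvV.neg {a : K} (ha : EvV v a) : EvV v (-a) := by
  obtain ⟨z, hz⟩ := ha
  exact ⟨z, by rw [Valuation.map_neg, hz]⟩

lemma SqV.of_mul_sq {a b c : K} (hc : c ≠ 0) (h : SqV v a) (e : a = b * c ^ 2) : SqV v b := by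
  have := SqV.mul v h (SqV.sq v (inv_ne_zero hc))
  rwa [e, mul_assoc, ← mul_pow, mul_inv_cancel₀ hc, one_pow, mul_one] at this

lemma EvV.of_mul_sq {a b c : K} (hc : c ≠ 0) (h : EvV v a) (e : a = b * c ^ 2) : EvV v b := by
  have := EvV.mul v h (SqV.ev v (SqV.sq v (inv_ne_zero hc)))
  rwa [e, mul_assoc, ← mul_pow, mul_inv_cancel₀ hc, one_pow, mul_one] at this

lemma UrV.symm {a b : K} (h : UrV v a b) : UrV v b a := by
  unfold UrV at *
  rw [mul_comm b a]
  tauto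

lemma norm_cases {b c d N : K} (hN : N = c ^ 2 - b * d ^ 2) (hN0 : N ≠ 0) (hb : b ≠ 0) :
    SqV v N ∨ SqV v (-(b * N)) ∨ (EvV v b ∧ EvV v N) ∨ SqV v b := by
  have hvb : 0 < v b := by simpa [zero_lt_iff] using hb
  rcases lt_trichotomy (v (c ^ 2)) (v (b * d ^ 2)) with h | h | h
  · right; left
    refine ⟨b * d, ?_⟩
    have e1 : v N = v (b * d ^ 2) := by rw [hN]; exact Valuation.map_sub_eq_of_lt_right v h
    have : -(b * N) - (b * d) ^ 2 = - (b * c ^ 2) := by rw [hN]; ring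
    rw [this, Valuation.map_neg, Valuation.map_neg, map_mul, map_mul v b N, e1]
    exact mul_lt_mul_of_pos_left h hvb
  · right; right
    have hd : d ≠ 0 := by
      rintro rfl
      have : c = 0 := by simpa using h
      apply hN0; rw [hN, this]; ring
    have hvd : 0 < v d := by simpa [zero_lt_iff] using hd
    have hle : v N ≤ v (c ^ 2) := by
      rw [hN]
      refine (Valuation.map_sub v _ _).trans ?_
      rw [← h, max_self]
    rcases hle.eq_or_lt with h1 | h1
    · left
      refine ⟨⟨c / d, ?_⟩, ⟨c, by rw [h1, map_pow]⟩⟩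
      rw [map_div₀, div_pow, ← map_pow, h, map_mul, map_pow]
      field_simp
    · right
      refine ⟨c / d, ?_⟩
      have e : b - (c / d) ^ 2 = -N / d ^ 2 := by rw [hN]; field_simp; ring
      rw [e, map_div₀, Valuation.map_neg, div_lt_iff₀ (by simpa [zero_lt_iff] using hd), ← map_mul,
        ← h]
      exact h1
  · left
    refine ⟨c, ?_⟩
    have e1 : v N = v (c ^ 2) := by rw [hN]; exact Valuation.map_sub_eq_of_lt_left v h
    rw [e1, hN]
    have : c ^ 2 - b * d ^ 2 - c ^ 2 = -(b * d ^ 2) := by ring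
    rwa [this, Valuation.map_neg]

lemma UrV.norm {a a' b c d : K} (ha : a ≠ 0) (ha' : a' ≠ 0) (hb : b ≠ 0)
    (hN : a * a' = c ^ 2 - b * d ^ 2) (h : UrV v a b) : UrV v a' b := by
  have hN0 : a * a' ≠ 0 := mul_ne_zero ha ha'
  have key := norm_cases v hN hN0 hb
  by_cases hSb : SqV v b
  · exact Or.inr (Or.inr (Or.inl hSb))
  have E' : EvV v a → EvV v (a * a') → EvV v a' := fun h1 h2 =>
    EvV.of_mul_sq v ha (EvV.mul v h1 h2) (by ring)
  have Eab : EvV v b → SqV v (-(a * b)) → EvV v a := fun h1 h2 => by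
    have := (EvV.mul v h1 (SqV.ev v h2)).neg
    exact EvV.of_mul_sq v hb this (by ring)
  rcases key with h1 | h1 | ⟨h1, h2⟩ | h1
  · rcases h with ⟨h3, h4⟩ | h3 | h3 | h3
    · exact Or.inl ⟨E' h3 (SqV.ev v h1), h4⟩
    · exact Or.inr (Or.inl (SqV.of_mul_sq v ha (SqV.mul v h3 h1) (by ring)))
    · exact absurd h3 hSb
    · exact Or.inr (Or.inr (Or.inr (SqV.of_mul_sq v ha (SqV.mul v h3 h1) (by ring))))
  · rcases h with ⟨h3, h4⟩ | h3 | h3 | h3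
    · refine Or.inl ⟨E' h3 ?_, h4⟩
      have := (EvV.mul v h4 (SqV.ev v h1)).neg
      exact EvV.of_mul_sq v hb this (by ring)
    · exact Or.inr (Or.inr (Or.inr (SqV.of_mul_sq v ha (SqV.mul v h3 h1) (by ring))))
    · exact absurd h3 hSb
    · exact Or.inr (Or.inl (SqV.of_mul_sq v (mul_ne_zero ha hb) (SqV.mul v h3 h1) (by ring)))
  · rcases h with ⟨h3, h4⟩ | h3 | h3 | h3
    · exact Or.inl ⟨E' h3 h2, h1⟩
    · exact Or.inl ⟨E' (SqV.ev v h3) h2, h1⟩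
    · exact absurd h3 hSb
    · exact Or.inl ⟨E' (Eab h1 h3) h2, h1⟩
  · exact absurd h1 hSb

/-- The symbol `(a,b)` is unramified everywhere. -/
def UrAll {K : Type} [Field K] (a b : K) : Prop :=
  ∀ (Γ : Type) [LinearOrderedCommGroupWithZero Γ] (v : Valuation K Γ), UrV v a b

/-- The symbol `(a,b)` is split. -/
def SplitSym {K : Type} [Field K] (a b : K) : Prop := ∃ c d : K, a = c ^ 2 - b * d ^ 2

/-- Every everywhere unramified symbol over `K` splits. -/
def GoodField (K : Type) [Field K] : Prop :=
  ∀ a b : K, a ≠ 0 → b ≠ 0 → UrAll a b → SplitSym a b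

lemma SplitSym.symm {a b : K} (h2 : (2 : K) ≠ 0) (ha : a ≠ 0)
    (h : SplitSym a b) : SplitSym b a := by
  obtain ⟨c, d, h⟩ := h
  by_cases hd : d = 0
  · subst hd
    have hc : c ≠ 0 := by rintro rfl; apply ha; rw [h]; ring
    refine ⟨(b + 1) / 2, (b - 1) / (2 * c), ?_⟩
    rw [h]; field_simp; ring
  · refine ⟨c / d, 1 / d, ?_⟩
    rw [h]; field_simp; ring

lemma SplitSym.norm {a a' b c d : K} (ha' : a' ≠ 0)
    (hN : a * a' = c ^ 2 - b * d ^ 2) (h : SplitSym a' b) : SplitSym a b := by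
  obtain ⟨e, f, h⟩ := h
  refine ⟨(c * e - b * d * f) / a', (c * f - d * e) / a', ?_⟩
  have h1 : a = (c ^ 2 - b * d ^ 2) * a' / a' ^ 2 := by rw [← hN]; field_simp
  rw [h1]
  field_simp
  rw [h]; ring

lemma UrAll.symm {a b : K} (h : UrAll a b) : UrAll b a := fun Γ _ v => (h Γ v).symm

lemma UrAll.norm {a a' b c d : K} (ha : a ≠ 0) (ha' : a' ≠ 0) (hb : b ≠ 0)
    (hN : a * a' = c ^ 2 - b * d ^ 2) (h : UrAll a b) : UrAll a' b :=
  fun Γ _ v => UrV.norm v ha ha' hb hN (h Γ v)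

lemma UrV.comap_equiv {L : Type} [Field L] (e : K ≃+* L) (v : Valuation L Γ) {a b : K}
    (h : UrV (v.comap (e : K →+* L)) a b) : UrV v (e a) (e b) := by
  have hE : ∀ a, EvV (v.comap (e : K →+* L)) a → EvV v (e a) := by
    rintro a ⟨z, hz⟩; exact ⟨e z, by simpa using hz⟩
  have hS : ∀ a, SqV (v.comap (e : K →+* L)) a → SqV v (e a) := by
    rintro a ⟨z, hz⟩; exact ⟨e z, by simpa using hz⟩
  rcases h with ⟨h3, h4⟩ | h3 | h3 | h3
  · exact Or.inl ⟨hE _ h3, hE _ h4⟩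
  · exact Or.inr (Or.inl (hS _ h3))
  · exact Or.inr (Or.inr (Or.inl (hS _ h3)))
  · exact Or.inr (Or.inr (Or.inr (by simpa using hS _ h3)))

lemma GoodField.equiv {L : Type} [Field L] (e : K ≃+* L) (h : GoodField K) : GoodField L := by
  intro a b ha hb hu
  have := h (e.symm a) (e.symm b) (by simpa using ha) (by simpa using hb) (fun Γ _ v =>
    UrV.comap_equiv e.symm v (hu Γ (v.comap (e.symm : L →+* K))))
  obtain ⟨c, d, hcd⟩ := this
  refine ⟨e c, e d, ?_⟩
  have := congrArg e hcd
  simpa using this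

end Symbols

section PadicStep

open Polynomial IsDedekindDomain

variable {F : Type} [Field F]

lemma padic_step (p a b : F[X]) (hp : Prime p) (ha : p ∣ a) (hsq : ¬ p * p ∣ a)
    (h : UrAll (algebraMap F[X] (RatFunc F) a) (algebraMap F[X] (RatFunc F) b)) :
    ∃ c, p ∣ c ^ 2 - b := by
  by_cases hpb : p ∣ b
  · exact ⟨0, by simpa using hpb⟩
  obtain ⟨a1, rfl⟩ := ha
  have ha1 : ¬ p ∣ a1 := fun h => hsq (mul_dvd_mul_left p h)
  let P : HeightOneSpectrum F[X] :=
    ⟨Ideal.span {p}, (Ideal.span_singleton_prime hp.ne_zero).2 hp, by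
      simpa using hp.ne_zero⟩
  let v := P.valuation (RatFunc F)
  have hlt : ∀ q : F[X], v (algebraMap F[X] (RatFunc F) q) < 1 ↔ p ∣ q := by
    intro q
    rw [HeightOneSpectrum.valuation_lt_one_iff_mem]
    exact Ideal.mem_span_singleton
  have hle : ∀ q : F[X], v (algebraMap F[X] (RatFunc F) q) ≤ 1 :=
    fun q => HeightOneSpectrum.valuation_le_one P q
  have heq : ∀ q : F[X], ¬ p ∣ q → v (algebraMap F[X] (RatFunc F) q) = 1 := by
    intro q hq
    exact le_antisymm (hle q) (not_lt.1 fun h => hq ((hlt q).1 h))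
  have hvp : v (algebraMap F[X] (RatFunc F) p) = WithZero.exp (-1 : ℤ) := by
    rw [HeightOneSpectrum.valuation_of_algebraMap]
    exact HeightOneSpectrum.intValuation_singleton P hp.ne_zero rfl
  have hva : v (algebraMap F[X] (RatFunc F) (p * a1)) = WithZero.exp (-1 : ℤ) := by
    rw [map_mul, map_mul, hvp, heq a1 ha1, mul_one]
  have hnE : ∀ x : RatFunc F, v x = WithZero.exp (-1 : ℤ) → ¬ EvV v x := by
    rintro x hx ⟨z, hz⟩
    rw [hx] at hz
    have hz0 : v z ≠ 0 := by
      intro h0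
      rw [h0] at hz
      simp at hz
    obtain ⟨n, hn⟩ : ∃ n : ℤ, v z = WithZero.exp n := ⟨WithZero.log (v z), by
      rw [WithZero.exp_log hz0]⟩
    rw [hn, ← WithZero.exp_nsmul] at hz
    have := WithZero.exp_injective hz
    simp at this
    omega
  have hur := h _ v
  have hvb := heq b hpb
  rcases hur with ⟨h1, -⟩ | h1 | h1 | h1
  · exact absurd h1 (hnE _ hva)
  · exact absurd (SqV.ev v h1) (hnE _ hva)
  · obtain ⟨z, hz⟩ := h1
    have e1 := sub_lt_imp_eq v hz
    rw [hvb, map_pow] at e1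
    have hz1 : v z = 1 := by
      exact (pow_eq_one_iff.1 e1.symm).resolve_right (by norm_num)
    set f := z.num
    set g := z.denom
    have hg0 : algebraMap F[X] (RatFunc F) g ≠ 0 :=
      RatFunc.algebraMap_ne_zero (RatFunc.denom_ne_zero z)
    have hzfg : z = algebraMap F[X] (RatFunc F) f / algebraMap F[X] (RatFunc F) g :=
      (RatFunc.num_div_denom z).symm
    have hvfg : v (algebraMap F[X] (RatFunc F) f) = v (algebraMap F[X] (RatFunc F) g) := by
      rw [hzfg, map_div₀] at hz1
      exact (div_eq_one_iff_eq (by simpa using hg0)).1 hz1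
    have hcop : IsCoprime f g := RatFunc.isCoprime_num_denom z
    have hpg : ¬ p ∣ g := by
      intro hpg
      have hpf : p ∣ f := by
        rw [← hlt, hvfg, hlt]; exact hpg
      exact hp.not_isUnit (hcop.isUnit_of_dvd' hpf hpg)
    have hvg := heq g hpg
    have hdvd : p ∣ b * g ^ 2 - f ^ 2 := by
      rw [← hlt]
      have : algebraMap F[X] (RatFunc F) (b * g ^ 2 - f ^ 2) =
        (algebraMap F[X] (RatFunc F) b - z ^ 2) * (algebraMap F[X] (RatFunc F) g) ^ 2 := by
        rw [hzfg]
        simp only [map_sub, map_mul, map_pow]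
        field_simp
      rw [this, map_mul, map_pow, hvg, one_pow, mul_one, ← hvb]
      exact hz
    have hcop2 : IsCoprime p g := (hp.irreducible.coprime_iff_not_dvd).2 hpg
    obtain ⟨s, t, hst⟩ := hcop2
    refine ⟨f * t, ?_⟩
    have : (f * t) ^ 2 - b = -(b * g ^ 2 - f ^ 2) * t ^ 2 + p * (b * (-s) * (1 + t * g)) := by
      linear_combination b * (1 + t * g) * hst
    rw [this]
    exact dvd_add ((dvd_neg.2 hdvd).mul_right _) (dvd_mul_right _ _)
  · refine absurd (SqV.ev v h1) (hnE _ ?_)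
    rw [Valuation.map_neg, map_mul, hva, hvb, mul_one]

lemma crt_square (b a : F[X]) (ha0 : a ≠ 0) (hsf : Squarefree a)
    (h : ∀ p, Prime p → p ∣ a → ∃ c, p ∣ c ^ 2 - b) : ∃ c, a ∣ c ^ 2 - b := by
  induction a using WfDvdMonoid.induction_on_irreducible with
  | zero => exact absurd rfl ha0
  | unit u hu => exact ⟨0, hu.dvd⟩
  | mul a i ha hi ih =>
    obtain ⟨c2, hc2⟩ := ih ha (hsf.of_mul_right) (fun p hp hpa => h p hp (hpa.mul_left i))
    obtain ⟨c1, hc1⟩ := h i hi.prime (dvd_mul_right i a)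
    have hcop : IsCoprime i a := by
      refine (hi.coprime_iff_not_dvd).2 fun hia => ?_
      exact hi.not_isUnit (hsf i (mul_dvd_mul_left i hia))
    have hcop' := hcop
    obtain ⟨s, t, hst⟩ := hcop
    refine ⟨c1 * t * a + c2 * s * i, hcop'.mul_dvd ?_ ?_⟩
    · obtain ⟨q, hq⟩ := hc1
      have : (c1 * t * a + c2 * s * i) - c1 = i * ((c2 - c1) * s) := by
        linear_combination c1 * hst
      refine ⟨q + (c2 - c1) * s * ((c1 * t * a + c2 * s * i) + c1), ?_⟩
      linear_combination hq + ((c1 * t * a + c2 * s * i) + c1) * this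
    · obtain ⟨q, hq⟩ := hc2
      have : (c1 * t * a + c2 * s * i) - c2 = a * ((c1 - c2) * t) := by
        linear_combination c2 * hst
      refine ⟨q + (c1 - c2) * t * ((c1 * t * a + c2 * s * i) + c2), ?_⟩
      linear_combination hq + ((c1 * t * a + c2 * s * i) + c2) * this

/-- Legendre descent. -/
lemma legendre (h2 : (2 : F) ≠ 0)
    (hconst : ∀ a b : F, a ≠ 0 → b ≠ 0 →
      UrAll (algebraMap F[X] (RatFunc F) (C a)) (algebraMap F[X] (RatFunc F) (C b)) →
      SplitSym (algebraMap F[X] (RatFunc F) (C a)) (algebraMap F[X] (RatFunc F) (C b)))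
    (n : ℕ) : ∀ a b : F[X], a ≠ 0 → b ≠ 0 → a.natDegree + b.natDegree ≤ n →
      UrAll (algebraMap F[X] (RatFunc F) a) (algebraMap F[X] (RatFunc F) b) →
      SplitSym (algebraMap F[X] (RatFunc F) a) (algebraMap F[X] (RatFunc F) b) := by
  have h2' : (2 : RatFunc F) ≠ 0 := by
    have : (2 : RatFunc F) = algebraMap F[X] (RatFunc F) (C 2) := by simp [map_ofNat RatFunc.C 2]
    rw [this]
    exact RatFunc.algebraMap_ne_zero (by simpa using h2)
  have inj := RatFunc.algebraMap_injective F
  have hne : ∀ {q : F[X]}, q ≠ 0 → algebraMap F[X] (RatFunc F) q ≠ 0 :=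
    fun hq => RatFunc.algebraMap_ne_zero hq
  induction n using Nat.strong_induction_on with
  | _ n ih =>
    have main : ∀ a b : F[X], a ≠ 0 → b ≠ 0 → b.natDegree ≤ a.natDegree →
        a.natDegree + b.natDegree ≤ n →
        UrAll (algebraMap F[X] (RatFunc F) a) (algebraMap F[X] (RatFunc F) b) →
        SplitSym (algebraMap F[X] (RatFunc F) a) (algebraMap F[X] (RatFunc F) b) := by
      intro a b ha hb hba hn hu
      rcases Nat.eq_zero_or_pos a.natDegree with h0 | hpos
      · obtain ⟨a0, rfl⟩ := natDegree_eq_zero.1 h0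
        obtain ⟨b0, rfl⟩ := natDegree_eq_zero.1 (Nat.le_zero.1 (h0 ▸ hba))
        exact hconst a0 b0 (by simpa using ha) (by simpa using hb) hu
      -- the common reduction
      have red : ∀ a' c d : F[X], a' ≠ 0 → a'.natDegree < a.natDegree →
          a * a' = c ^ 2 - b * d ^ 2 →
          SplitSym (algebraMap F[X] (RatFunc F) a) (algebraMap F[X] (RatFunc F) b) := by
        intro a' c d ha' hdeg hN
        have hN' := congrArg (algebraMap F[X] (RatFunc F)) hN
        simp only [map_mul, map_sub, map_pow] at hN'
        exact SplitSym.norm (hne ha') hN' (ih (a'.natDegree + b.natDegree) (by omega) a' b ha' hb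
          le_rfl (UrAll.norm (hne ha) (hne ha') (hne hb) hN' hu))
      by_cases hsf : Squarefree a
      · obtain ⟨c0, hc0⟩ := crt_square b a ha hsf (fun p hp hpa =>
          padic_step p a b hp hpa (fun hpp => hp.not_isUnit (hsf p hpp)) hu)
        obtain ⟨a', ha'⟩ : a ∣ (c0 % a) ^ 2 - b := by
          have : (c0 % a) ^ 2 - b = (c0 ^ 2 - b) - a * ((c0 / a) * (c0 + c0 % a)) := by
            have := EuclideanDomain.div_add_mod c0 a
            linear_combination (c0 + c0 % a) * this
          rw [this]
          exact dvd_sub hc0 (dvd_mul_right _ _)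
        set c := c0 % a
        have hc : c.natDegree < a.natDegree := natDegree_mod_lt c0 hpos.ne'
        by_cases h0 : a' = 0
        · have hbc : b = c ^ 2 := by
            rw [h0, mul_zero] at ha'
            exact (sub_eq_zero.1 ha').symm
          refine SplitSym.symm h2' (hne hb) ⟨algebraMap F[X] (RatFunc F) c, 0, ?_⟩
          rw [hbc]; simp
        · refine red a' c 1 h0 ?_ (by rw [← ha']; ring)
          have h1 := congrArg natDegree ha'
          rw [natDegree_mul ha h0] at h1
          have h3 : (c ^ 2 - b).natDegree ≤ max (2 * c.natDegree) b.natDegree := by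
            refine (natDegree_sub_le _ _).trans ?_
            rw [natDegree_pow]
          have := le_max_iff.1 (h1 ▸ h3)
          omega
      · simp only [Squarefree, not_forall] at hsf
        obtain ⟨q, ⟨a1, ha1⟩, hq⟩ := hsf
        have hq0 : q ≠ 0 := by rintro rfl; apply ha; rw [ha1]; ring
        have ha10 : a1 ≠ 0 := by rintro rfl; apply ha; rw [ha1]; ring
        refine red a1 (q * a1) 0 ha10 ?_ (by rw [ha1]; ring)
        rw [ha1, natDegree_mul (mul_ne_zero hq0 hq0) ha10, natDegree_mul hq0 hq0]
        have : 0 < q.natDegree := by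
          rw [Nat.pos_iff_ne_zero]
          intro h0
          apply hq
          obtain ⟨x, rfl⟩ := natDegree_eq_zero.1 h0
          exact isUnit_C.2 (IsUnit.mk0 x (by simpa using hq0))
        omega
    intro a b ha hb hn hu
    rcases le_total b.natDegree a.natDegree with h | h
    · exact main a b ha hb h hn hu
    · exact SplitSym.symm h2' (hne hb) (main b a hb ha h (by omega) hu.symm)

end PadicStep

section DegLex

open Polynomial

variable {F Γ : Type} [Field F] [LinearOrderedCommGroupWithZero Γ]

open Classical in
/-- value of a polynomial for the degree-lexicographic extension of `v`. -/
noncomputable def dlVal (v : Valuation F Γ) (f : F[X]) : WithZero (Multiplicative ℤ ×ₗ Γˣ) :=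
  if h : f = 0 then 0 else
    ((toLex (Multiplicative.ofAdd (f.natDegree : ℤ), Units.mk0 (v f.leadingCoeff)
      (by simpa using h)) : Multiplicative ℤ ×ₗ Γˣ) : WithZero (Multiplicative ℤ ×ₗ Γˣ))

lemma dlVal_zero (v : Valuation F Γ) : dlVal v 0 = 0 := by simp [dlVal]

lemma dlVal_le (v : Valuation F Γ) {f g : F[X]} (hg : g ≠ 0) :
    dlVal v f ≤ dlVal v g ↔ f = 0 ∨ f.natDegree < g.natDegree ∨
      (f.natDegree = g.natDegree ∧ v f.leadingCoeff ≤ v g.leadingCoeff) := by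
  by_cases hf : f = 0
  · subst hf; simp [dlVal_zero]
  · simp only [dlVal, hf, hg, dif_neg, not_false_eq_true, WithZero.coe_le_coe, Prod.Lex.le_iff]
    simp [← Units.val_le_val]

lemma dlVal_add_le (v : Valuation F Γ) {f g : F[X]} (h : dlVal v f ≤ dlVal v g) :
    dlVal v (f + g) ≤ dlVal v g := by
  by_cases hg : g = 0
  · subst hg
    by_cases hf : f = 0
    · simp [hf]
    · simpa using h
  rw [dlVal_le v hg] at h ⊢
  rcases h with rfl | h | ⟨h1, h2⟩
  · simp
  · right; right
    have hd : f.degree < g.degree := degree_lt_degree h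
    exact ⟨natDegree_add_eq_right_of_natDegree_lt h, by rw [leadingCoeff_add_of_degree_lt hd]⟩
  · by_cases h0 : f + g = 0
    · exact Or.inl h0
    right
    have hle : (f + g).natDegree ≤ g.natDegree := by
      refine (natDegree_add_le _ _).trans ?_
      simp [h1]
    rcases hle.lt_or_eq with h3 | h3
    · exact Or.inl h3
    · refine Or.inr ⟨h3, ?_⟩
      have : (f + g).leadingCoeff = f.leadingCoeff + g.leadingCoeff := by
        rw [leadingCoeff, h3, Polynomial.coeff_add, leadingCoeff, leadingCoeff, h1]
      rw [this]
      exact Valuation.map_add_le v h2 le_rfl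

lemma dlVal_mul (v : Valuation F Γ) (f g : F[X]) : dlVal v (f * g) = dlVal v f * dlVal v g := by
  by_cases hf : f = 0
  · simp [hf, dlVal_zero]
  by_cases hg : g = 0
  · simp [hg, dlVal_zero]
  simp only [dlVal, hf, hg, mul_ne_zero hf hg, dif_neg, not_false_eq_true, ← WithZero.coe_mul]
  congr 1
  rw [← toLex_mul, Prod.mk_mul_mk]
  congr 2
  · rw [natDegree_mul hf hg]; push_cast; rfl
  · ext; simp

/-- the degree-lexicographic extension of `v`, on polynomials. -/
noncomputable def dlValuation (v : Valuation F Γ) :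
    Valuation F[X] (WithZero (Multiplicative ℤ ×ₗ Γˣ)) where
  toFun := dlVal v
  map_zero' := dlVal_zero v
  map_one' := by
    have h := dlVal_mul v 1 1
    have h0 : dlVal v (1 : F[X]) ≠ 0 := by simp [dlVal]
    rw [mul_one] at h
    exact (mul_eq_left₀ h0).1 h.symm
  map_mul' := dlVal_mul v
  map_add_le_max' f g := by
    rcases le_total (dlVal v f) (dlVal v g) with h | h
    · exact (dlVal_add_le v h).trans (le_max_right _ _)
    · rw [add_comm]; exact (dlVal_add_le v h).trans (le_max_left _ _)

lemma dlVal_ne_zero (v : Valuation F Γ) {f : F[X]} (hf : f ≠ 0) : dlVal v f ≠ 0 := by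
  simp [dlVal, hf]

/-- the degree-lexicographic extension of `v`. -/
noncomputable def dlRat (v : Valuation F Γ) :
    Valuation (RatFunc F) (WithZero (Multiplicative ℤ ×ₗ Γˣ)) :=
  (dlValuation v).extendToLocalization (S := nonZeroDivisors F[X]) (by
    intro f hf
    have : f ≠ 0 := nonZeroDivisors.ne_zero hf
    simp only [Ideal.mem_primeCompl_iff, Valuation.mem_supp_iff]
    exact dlVal_ne_zero v this) (RatFunc F)

lemma dlRat_apply (v : Valuation F Γ) (f : F[X]) :
    dlRat v (algebraMap F[X] (RatFunc F) f) = dlVal v f :=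
  Valuation.extendToLocalization_apply_map_apply _ _ _ f

lemma dl_ev (v : Valuation F Γ) (a : F) (ha : a ≠ 0)
    (h : EvV (dlRat v) (algebraMap F[X] (RatFunc F) (Polynomial.C a))) : EvV v a := by
  obtain ⟨z, hz⟩ := h
  have hz0 : z ≠ 0 := by
    rintro rfl
    simp [ha] at hz
  have hf := RatFunc.num_ne_zero hz0
  have hg := RatFunc.denom_ne_zero z
  have hga := RatFunc.algebraMap_ne_zero hg
  have e : dlVal v (Polynomial.C a * z.denom ^ 2) = dlVal v (z.num ^ 2) := by
    rw [← dlRat_apply, ← dlRat_apply]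
    simp only [map_mul, map_pow]
    have e := (div_eq_iff hga).1 (RatFunc.num_div_denom z)
    rw [hz, e, map_mul, mul_pow]
  have hg' : Polynomial.C a * z.denom ^ 2 ≠ 0 := by simp [ha, hg]
  have hf' : z.num ^ 2 ≠ 0 := by simp [hf]
  have h1 := (dlVal_le v hf').1 e.le
  have h2 := (dlVal_le v hg').1 e.ge
  have hv : v (Polynomial.C a * z.denom ^ 2).leadingCoeff = v (z.num ^ 2).leadingCoeff := by
    rcases h1 with h1 | h1 | ⟨h1, h1'⟩
    · exact absurd h1 hg'
    · rcases h2 with h2 | h2 | ⟨h2, h2'⟩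
      · exact absurd h2 hf'
      · omega
      · omega
    · rcases h2 with h2 | h2 | ⟨h2, h2'⟩
      · exact absurd h2 hf'
      · omega
      · exact le_antisymm h1' h2'
  rw [leadingCoeff_mul, leadingCoeff_pow, leadingCoeff_pow, leadingCoeff_C, map_mul, map_pow,
    map_pow] at hv
  refine ⟨z.num.leadingCoeff / z.denom.leadingCoeff, ?_⟩
  have : v z.denom.leadingCoeff ≠ 0 := by simpa using hg
  rw [map_div₀, div_pow, ← hv]
  field_simp

lemma dl_sq (v : Valuation F Γ) (a : F) (ha : a ≠ 0)
    (h : SqV (dlRat v) (algebraMap F[X] (RatFunc F) (Polynomial.C a))) : SqV v a := by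
  obtain ⟨z, hz⟩ := h
  have hg := RatFunc.denom_ne_zero z
  have hga := RatFunc.algebraMap_ne_zero hg
  have hg' : Polynomial.C a * z.denom ^ 2 ≠ 0 := by simp [ha, hg]
  have hlt : dlVal v (Polynomial.C a * z.denom ^ 2 - z.num ^ 2) < dlVal v (Polynomial.C a * z.denom ^ 2) := by
    rw [← dlRat_apply, ← dlRat_apply]
    have e : algebraMap F[X] (RatFunc F) (Polynomial.C a * z.denom ^ 2 - z.num ^ 2) =
        (algebraMap F[X] (RatFunc F) (Polynomial.C a) - z ^ 2) *
          (algebraMap F[X] (RatFunc F) z.denom) ^ 2 := by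
      have e := (div_eq_iff hga).1 (RatFunc.num_div_denom z)
      simp only [map_sub, map_mul, map_pow]
      rw [e]
      ring
    rw [e, map_mul (algebraMap _ _), map_mul, map_mul, map_pow (algebraMap _ _)]
    refine mul_lt_mul_of_pos_right hz ?_
    simpa [zero_lt_iff] using hg
  have heq : dlVal v (Polynomial.C a * z.denom ^ 2) = dlVal v (z.num ^ 2) := by
    have := sub_lt_imp_eq (dlRat v) (a := algebraMap F[X] (RatFunc F) (Polynomial.C a * z.denom ^ 2))
      (z := algebraMap F[X] (RatFunc F) (z.num ^ 2))
      (by rw [← map_sub, dlRat_apply, dlRat_apply]; exact hlt)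
    rwa [dlRat_apply, dlRat_apply] at this
  have hf' : z.num ^ 2 ≠ 0 := by
    intro h0
    rw [h0, dlVal_zero] at heq
    exact dlVal_ne_zero v hg' heq
  have h1 := (dlVal_le v hf').1 heq.le
  have h2 := (dlVal_le v hg').1 heq.ge
  have hdeg : (Polynomial.C a * z.denom ^ 2).natDegree = (z.num ^ 2).natDegree := by
    rcases h1 with h1 | h1 | ⟨h1, h1'⟩
    · exact absurd h1 hg'
    · rcases h2 with h2 | h2 | ⟨h2, h2'⟩
      · exact absurd h2 hf'
      · omega
      · omega
    · exact h1
  have hlg : z.denom.leadingCoeff ≠ 0 := by simpa using hg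
  -- the main inequality
  have key : v (a * z.denom.leadingCoeff ^ 2 - z.num.leadingCoeff ^ 2) <
      v (a * z.denom.leadingCoeff ^ 2) := by
    by_cases h0 : a * z.denom.leadingCoeff ^ 2 - z.num.leadingCoeff ^ 2 = 0
    · rw [h0, map_zero, zero_lt_iff]
      simp [ha, hg]
    · have hc : (Polynomial.C a * z.denom ^ 2 - z.num ^ 2).coeff (Polynomial.C a * z.denom ^ 2).natDegree =
          a * z.denom.leadingCoeff ^ 2 - z.num.leadingCoeff ^ 2 := by
        rw [Polynomial.coeff_sub, coeff_natDegree, hdeg, coeff_natDegree]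
        simp
      have hd0 : Polynomial.C a * z.denom ^ 2 - z.num ^ 2 ≠ 0 := by
        intro h
        rw [h] at hc
        exact h0 (by rw [← hc, Polynomial.coeff_zero])
      have hle : (Polynomial.C a * z.denom ^ 2 - z.num ^ 2).natDegree = (Polynomial.C a * z.denom ^ 2).natDegree := by
        apply le_antisymm
        · refine (natDegree_sub_le _ _).trans ?_
          rw [← hdeg, max_self]
        · exact le_natDegree_of_ne_zero (by rw [hc]; exact h0)
      have hnl := mt (dlVal_le v hd0).2 (not_le.2 hlt)
      push Not at hnl
      have := hnl.2.2 hle.symm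
      rw [leadingCoeff_mul, leadingCoeff_pow, leadingCoeff_C] at this
      rw [leadingCoeff, hle, hc] at this
      exact this
  refine ⟨z.num.leadingCoeff / z.denom.leadingCoeff, ?_⟩
  have e : a - (z.num.leadingCoeff / z.denom.leadingCoeff) ^ 2 =
    (a * z.denom.leadingCoeff ^ 2 - z.num.leadingCoeff ^ 2) / z.denom.leadingCoeff ^ 2 := by
    field_simp
  rw [e, map_div₀, div_lt_iff₀ (by simpa [zero_lt_iff] using hg), ← map_mul]
  exact key

theorem GoodField.ratFunc (h2 : (2 : F) ≠ 0) (h : GoodField F) : GoodField (RatFunc F) := by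
  have hconst : ∀ a b : F, a ≠ 0 → b ≠ 0 →
      UrAll (algebraMap F[X] (RatFunc F) (Polynomial.C a)) (algebraMap F[X] (RatFunc F) (Polynomial.C b)) →
      SplitSym (algebraMap F[X] (RatFunc F) (Polynomial.C a)) (algebraMap F[X] (RatFunc F) (Polynomial.C b)) := by
    intro a b ha hb hu
    obtain ⟨c, d, hcd⟩ := h a b ha hb (by
      intro Γ _ v
      rcases hu _ (dlRat v) with ⟨h3, h4⟩ | h3 | h3 | h3
      · exact Or.inl ⟨dl_ev v _ ha h3, dl_ev v _ hb h4⟩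
      · exact Or.inr (Or.inl (dl_sq v _ ha h3))
      · exact Or.inr (Or.inr (Or.inl (dl_sq v _ hb h3)))
      · refine Or.inr (Or.inr (Or.inr (dl_sq v _ (by simp [ha, hb]) ?_)))
        rw [← map_mul, ← map_neg, ← Polynomial.C_mul, ← Polynomial.C_neg] at h3
        exact h3)
    refine ⟨algebraMap F[X] (RatFunc F) (Polynomial.C c), algebraMap F[X] (RatFunc F) (Polynomial.C d), ?_⟩
    rw [hcd]
    simp only [map_sub, map_mul, map_pow]
  have h2' : (2 : RatFunc F) ≠ 0 := by
    have : (2 : RatFunc F) = algebraMap F[X] (RatFunc F) (Polynomial.C 2) := by simp [map_ofNat RatFunc.C 2]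
    rw [this]
    exact RatFunc.algebraMap_ne_zero (by simpa using h2)
  intro a b ha hb hu
  -- clear denominators
  have clr : ∀ a : RatFunc F, a ≠ 0 → ∃ A : F[X], A ≠ 0 ∧ ∃ c : RatFunc F,
      a * algebraMap F[X] (RatFunc F) A = c ^ 2 := by
    intro a ha
    refine ⟨a.num * a.denom, mul_ne_zero (RatFunc.num_ne_zero ha) (RatFunc.denom_ne_zero a),
      algebraMap F[X] (RatFunc F) a.num, ?_⟩
    have hga := RatFunc.algebraMap_ne_zero (RatFunc.denom_ne_zero a)
    have e := (div_eq_iff hga).1 (RatFunc.num_div_denom a)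
    rw [map_mul, sq]
    nth_rewrite 3 [e]
    ring
  obtain ⟨A, hA0, c, hA⟩ := clr a ha
  obtain ⟨B, hB0, d, hB⟩ := clr b hb
  have hA1 := RatFunc.algebraMap_ne_zero hA0
  have hB1 := RatFunc.algebraMap_ne_zero hB0
  have hu1 : UrAll (algebraMap F[X] (RatFunc F) A) b :=
    UrAll.norm (d := 0) ha hA1 hb (by rw [hA]; ring) hu
  have hu2 : UrAll (algebraMap F[X] (RatFunc F) B) (algebraMap F[X] (RatFunc F) A) :=
    UrAll.norm (d := 0) hb hB1 hA1 (by rw [hB]; ring) hu1.symm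
  have hs := legendre h2 hconst _ B A hB0 hA0 le_rfl hu2
  have hs1 : SplitSym b (algebraMap F[X] (RatFunc F) A) :=
    SplitSym.norm (d := 0) hB1 (by rw [hB]; ring) hs
  exact SplitSym.norm (d := 0) hA1 (by rw [hA]; ring) (SplitSym.symm h2' hb hs1)

lemma goodField_complex : GoodField ℂ := by
  intro a b _ _ _
  obtain ⟨c, hc⟩ := IsAlgClosed.exists_pow_nat_eq a (n := 2) (by norm_num)
  exact ⟨c, 0, by rw [hc]; ring⟩

end DegLex

section Example

variable {K Γ : Type} [Field K] [LinearOrderedCommGroupWithZero Γ] (v : Valuation K Γ)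

lemma UrV.scale {a b a' b' e f : K} (ha : a ≠ 0) (hb : b ≠ 0) (he : e ≠ 0) (hf : f ≠ 0)
    (h1 : a' = a * e ^ 2) (h2 : b' = b * f ^ 2) (h : UrV v a b) : UrV v a' b' := by
  have ha' : a' ≠ 0 := by rw [h1]; exact mul_ne_zero ha (pow_ne_zero 2 he)
  have hb' : b' ≠ 0 := by rw [h2]; exact mul_ne_zero hb (pow_ne_zero 2 hf)
  have s1 : UrV v a' b := UrV.norm v (c := a * e) (d := 0) ha ha' hb (by rw [h1]; ring) h
  exact (UrV.norm v (c := b * f) (d := 0) hb hb' ha' (by rw [h2]; ring) s1.symm).symm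

lemma core_ur {x y i η : K} (hi : i ^ 2 = -1) (hη : η ^ 2 = i) (hx : v x ≤ 1) (hy : v y ≤ 1) :
    UrV v (x ^ 2 + y ^ 2) x ∨ UrV v (1 + x ^ 2 * y ^ 2) x := by
  rcases hx.lt_or_eq with hx | hx
  · right; right; left
    have hlt : v (x ^ 2 * y ^ 2) < 1 := by
      rw [map_mul, map_pow, map_pow]
      exact mul_lt_one_of_lt_of_le (pow_lt_one₀ zero_le hx (by norm_num))
        (pow_le_one₀ zero_le hy)
    have h1 : v (1 + x ^ 2 * y ^ 2) = 1 := by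
      rw [Valuation.map_add_eq_of_lt_left v (by rwa [map_one]), map_one]
    refine ⟨1, ?_⟩
    rw [h1]
    simpa using hlt
  · have hEx : EvV v x := ⟨1, by simp [hx]⟩
    have hle1 : v (x ^ 2 + y ^ 2) ≤ 1 := by
      refine Valuation.map_add_le v ?_ ?_
      · rw [map_pow, hx, one_pow]
      · rw [map_pow]; exact pow_le_one₀ zero_le hy
    have hle2 : v (1 + x ^ 2 * y ^ 2) ≤ 1 := by
      refine Valuation.map_add_le v (by simp) ?_
      rw [map_mul, map_pow, hx, one_pow, one_mul, map_pow]; exact pow_le_one₀ zero_le hy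
    rcases hle1.lt_or_eq with h1 | h1
    · rcases hle2.lt_or_eq with h2 | h2
      · left; right; right; left
        have h4 : v ((x - 1) * (x + 1) * ((x - i) * (x + i))) < 1 := by
          have : (x - 1) * (x + 1) * ((x - i) * (x + i)) =
              x ^ 2 * (x ^ 2 + y ^ 2) - (1 + x ^ 2 * y ^ 2) := by
            linear_combination (1 - x ^ 2) * hi
          rw [this]
          refine Valuation.map_sub_lt v ?_ h2
          rw [map_mul, map_pow, hx, one_pow, one_mul]; exact h1
        have hS : ∀ z : K, v (x - z ^ 2) < 1 → SqV v x := fun z hz => ⟨z, by rwa [hx]⟩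
        by_contra hn
        have n1 : 1 ≤ v (x - 1) := not_lt.1 fun h => hn (hS 1 (by simpa using h))
        have n2 : 1 ≤ v (x + 1) := not_lt.1 fun h => hn (hS i (by rw [hi]; simpa using h))
        have n3 : 1 ≤ v (x - i) := not_lt.1 fun h => hn (hS η (by rw [hη]; exact h))
        have n4 : 1 ≤ v (x + i) := not_lt.1 fun h => hn (hS (i * η) (by
          have : x - (i * η) ^ 2 = x + i := by rw [mul_pow, hi, hη]; ring
          rw [this]; exact h))
        rw [map_mul, map_mul, map_mul] at h4
        exact absurd h4 (not_lt.2 (one_le_mul (one_le_mul n1 n2) (one_le_mul n3 n4)))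
      · right; left
        exact ⟨⟨1, by simp [h2]⟩, hEx⟩
    · left; left
      exact ⟨⟨1, by simp [h1]⟩, hEx⟩

lemma example_urV {x y u w i η : K} (hi : i ^ 2 = -1) (hη : η ^ 2 = i) (hx0 : x ≠ 0) (hy0 : y ≠ 0)
    (hg1 : x ^ 2 + y ^ 2 ≠ 0) (hg2 : 1 + x ^ 2 * y ^ 2 ≠ 0)
    (he : u ^ 2 - x * w ^ 2 = (x ^ 2 + y ^ 2) * (1 + x ^ 2 * y ^ 2)) :
    UrV v (x ^ 2 + y ^ 2) x := by
  have key : UrV v (x ^ 2 + y ^ 2) x ∨ UrV v (1 + x ^ 2 * y ^ 2) x := by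
    have hinv : ∀ z : K, z ≠ 0 → 1 ≤ v z → v z⁻¹ ≤ 1 := by
      intro z hz h
      rw [map_inv₀]
      exact inv_le_one_of_one_le₀ h
    have hxi := inv_ne_zero hx0
    have hyi := inv_ne_zero hy0
    have hxy := mul_ne_zero hx0 hy0
    rcases le_total (v x) 1 with hx | hx <;> rcases le_total (v y) 1 with hy | hy
    · exact core_ur v hi hη hx hy
    · rcases core_ur v hi hη hx (hinv y hy0 hy) with h | h
      · right
        have e : 1 + x ^ 2 * y ^ 2 = (x ^ 2 + y⁻¹ ^ 2) * y ^ 2 := by field_simp; ring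
        exact UrV.scale v (left_ne_zero_of_mul (e ▸ hg2)) hx0 hy0 one_ne_zero e (by ring) h
      · left
        have e : x ^ 2 + y ^ 2 = (1 + x ^ 2 * y⁻¹ ^ 2) * y ^ 2 := by field_simp; ring
        exact UrV.scale v (left_ne_zero_of_mul (e ▸ hg1)) hx0 hy0 one_ne_zero e (by ring) h
    · rcases core_ur v hi hη (hinv x hx0 hx) hy with h | h
      · right
        have e : 1 + x ^ 2 * y ^ 2 = (x⁻¹ ^ 2 + y ^ 2) * x ^ 2 := by field_simp
        exact UrV.scale v (left_ne_zero_of_mul (e ▸ hg2)) hxi hx0 hx0 e (by field_simp) h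
      · left
        have e : x ^ 2 + y ^ 2 = (1 + x⁻¹ ^ 2 * y ^ 2) * x ^ 2 := by field_simp
        exact UrV.scale v (left_ne_zero_of_mul (e ▸ hg1)) hxi hx0 hx0 e (by field_simp) h
    · rcases core_ur v hi hη (hinv x hx0 hx) (hinv y hy0 hy) with h | h
      · left
        have e : x ^ 2 + y ^ 2 = (x⁻¹ ^ 2 + y⁻¹ ^ 2) * (x * y) ^ 2 := by field_simp; ring
        exact UrV.scale v (left_ne_zero_of_mul (e ▸ hg1)) hxi hxy hx0 e (by field_simp) h
      · right
        have e : 1 + x ^ 2 * y ^ 2 = (1 + x⁻¹ ^ 2 * y⁻¹ ^ 2) * (x * y) ^ 2 := by field_simp; ring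
        exact UrV.scale v (left_ne_zero_of_mul (e ▸ hg2)) hxi hxy hx0 e (by field_simp) h
  rcases key with h | h
  · exact h
  · exact UrV.norm v hg2 hg1 hx0 (by rw [he]; ring) h

end Example

section Iso

noncomputable def cratHom0 (m : ℕ) : MvPolynomial (Fin (m + 1)) ℂ →ₐ[ℂ] RatFunc (CRatFunc m) :=
  ((IsScalarTower.toAlgHom ℂ (Polynomial (CRatFunc m)) (RatFunc (CRatFunc m))).comp
    (Polynomial.mapAlgHom (IsScalarTower.toAlgHom ℂ (MvPolynomial (Fin m) ℂ) (CRatFunc m)))).comp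
      (MvPolynomial.finSuccEquiv ℂ m).toAlgHom

lemma cratHom0_inj (m : ℕ) : Function.Injective (cratHom0 m) := by
  have h1 : Function.Injective (algebraMap (Polynomial (CRatFunc m)) (RatFunc (CRatFunc m))) :=
    RatFunc.algebraMap_injective _
  have h2 : Function.Injective (Polynomial.map (algebraMap (MvPolynomial (Fin m) ℂ) (CRatFunc m))) :=
    Polynomial.map_injective _ (IsFractionRing.injective _ _)
  exact (h1.comp h2).comp (MvPolynomial.finSuccEquiv ℂ m).injective

noncomputable def cratHom (m : ℕ) : CRatFunc (m + 1) →ₐ[ℂ] RatFunc (CRatFunc m) :=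
  IsFractionRing.liftAlgHom (g := cratHom0 m) (cratHom0_inj m)

lemma cratHom_apply (m : ℕ) (q) : cratHom m (algebraMap _ _ q) =
    algebraMap (Polynomial (CRatFunc m)) (RatFunc (CRatFunc m))
      (Polynomial.map (algebraMap _ _) (MvPolynomial.finSuccEquiv ℂ m q)) := by
  unfold cratHom
  rw [IsFractionRing.liftAlgHom_apply, IsFractionRing.lift_algebraMap]
  rfl

lemma cratHom_surj (m : ℕ) : Function.Surjective (cratHom m) := by
  have hpoly : ∀ q : Polynomial (MvPolynomial (Fin m) ℂ), ∃ z, cratHom m z =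
      algebraMap (Polynomial (CRatFunc m)) (RatFunc (CRatFunc m))
      (Polynomial.map (algebraMap _ _) q) := by
    intro q
    exact ⟨algebraMap _ _ ((MvPolynomial.finSuccEquiv ℂ m).symm q), by rw [cratHom_apply]; simp⟩
  have hC : ∀ a : CRatFunc m, ∃ z, cratHom m z =
      algebraMap (Polynomial (CRatFunc m)) (RatFunc (CRatFunc m)) (Polynomial.C a) := by
    intro a
    obtain ⟨p, q, hq, rfl⟩ := IsFractionRing.div_surjective (A := MvPolynomial (Fin m) ℂ) a
    obtain ⟨z1, h1⟩ := hpoly (Polynomial.C p)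
    obtain ⟨z2, h2⟩ := hpoly (Polynomial.C q)
    refine ⟨z1 / z2, ?_⟩
    rw [map_div₀, h1, h2, Polynomial.map_C, Polynomial.map_C, RatFunc.algebraMap_C,
      RatFunc.algebraMap_C, RatFunc.algebraMap_C, map_div₀]
  obtain ⟨zX, hX⟩ := hpoly Polynomial.X
  rw [Polynomial.map_X] at hX
  have hall : ∀ q : Polynomial (CRatFunc m), ∃ z, cratHom m z =
      algebraMap (Polynomial (CRatFunc m)) (RatFunc (CRatFunc m)) q := by
    intro q
    induction q using Polynomial.induction_on' with
    | add p q hp hq =>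
      obtain ⟨a, ha⟩ := hp
      obtain ⟨b, hb⟩ := hq
      exact ⟨a + b, by rw [map_add, map_add, ha, hb]⟩
    | monomial n a =>
      obtain ⟨z, hz⟩ := hC a
      exact ⟨z * zX ^ n, by rw [map_mul, map_pow, hz, hX, ← map_pow, ← map_mul,
        Polynomial.C_mul_X_pow_eq_monomial]⟩
  intro f
  obtain ⟨p, q, hq, rfl⟩ := IsFractionRing.div_surjective (A := Polynomial (CRatFunc m)) f
  obtain ⟨z1, h1⟩ := hall p
  obtain ⟨z2, h2⟩ := hall q
  exact ⟨z1 / z2, by rw [map_div₀, h1, h2]⟩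

/-- `ℂ(t₀,…,tₘ)` is a rational function field over `ℂ(t₁,…,tₘ)`. -/
noncomputable def cratSucc (m : ℕ) : RatFunc (CRatFunc m) ≃ₐ[ℂ] CRatFunc (m + 1) :=
  (AlgEquiv.ofBijective (cratHom m) ⟨(cratHom m).injective, cratHom_surj m⟩).symm

lemma crat0_bij : Function.Bijective (algebraMap ℂ (CRatFunc 0)) := by
  refine ⟨(algebraMap ℂ (CRatFunc 0)).injective, ?_⟩
  have hp : ∀ p : MvPolynomial (Fin 0) ℂ, ∃ z, algebraMap ℂ (CRatFunc 0) z = algebraMap _ _ p := by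
    intro p
    obtain ⟨z, rfl⟩ := MvPolynomial.C_surjective (Fin 0) p
    exact ⟨z, by rw [IsScalarTower.algebraMap_apply ℂ (MvPolynomial (Fin 0) ℂ) (CRatFunc 0)]; rfl⟩
  intro f
  obtain ⟨p, q, hq, rfl⟩ := IsFractionRing.div_surjective (A := MvPolynomial (Fin 0) ℂ) f
  obtain ⟨z1, h1⟩ := hp p
  obtain ⟨z2, h2⟩ := hp q
  exact ⟨z1 / z2, by rw [map_div₀, h1, h2]⟩

lemma goodField_crat (m : ℕ) : GoodField (CRatFunc m) := by
  induction m with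
  | zero => exact goodField_complex.equiv (RingEquiv.ofBijective _ crat0_bij)
  | succ m ih => exact (ih.ratFunc two_ne_zero).equiv (cratSucc m).toRingEquiv

end Iso
section NonSplit

variable {k : Type} [Field k]

lemma exists_tau (σ : k →+* k) (g : k) (hg : g ≠ 0) :
    ∃ τ : RatFunc k →+* RatFunc k, (∀ a, τ (RatFunc.C a) = RatFunc.C (σ a)) ∧
      τ RatFunc.X = RatFunc.C g / RatFunc.X := by
  set t : RatFunc k := RatFunc.C g / RatFunc.X with ht
  have htr : Transcendental k t := by
    intro h
    apply RatFunc.transcendental_X (K := k)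
    have hgC : (RatFunc.C g : RatFunc k) ≠ 0 := (map_ne_zero _).2 hg
    have : (RatFunc.X : RatFunc k) = algebraMap k (RatFunc k) g * t⁻¹ := by
      rw [ht, RatFunc.algebraMap_eq_C]
      field_simp
    rw [this]
    exact (isAlgebraic_algebraMap g).mul h.inv
  let φ : Polynomial k →+* RatFunc k :=
    (Polynomial.aeval t).toRingHom.comp (Polynomial.mapRingHom σ)
  have hφ : Function.Injective φ :=
    (transcendental_iff_injective.1 htr).comp (Polynomial.map_injective σ σ.injective)
  refine ⟨RatFunc.liftRingHom φ (nonZeroDivisors_le_comap_nonZeroDivisors_of_injective _ hφ), ?_, ?_⟩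
  · intro a
    rw [← RatFunc.algebraMap_C, RatFunc.liftRingHom_algebraMap]
    simp [φ, RatFunc.algebraMap_eq_C]
  · rw [← RatFunc.algebraMap_X, RatFunc.liftRingHom_algebraMap]
    simp [φ]

lemma norm_lemma (σ : k →+* k) (hσ : ∀ a, σ (σ a) = a) (g g1 : k) (hg : g ≠ 0) (hσg : σ g = g)
    (hg1 : g1 ≠ 0) (τ : RatFunc k →+* RatFunc k) (hC : ∀ a, τ (RatFunc.C a) = RatFunc.C (σ a))
    (hX : τ RatFunc.X = RatFunc.C g / RatFunc.X) (h : RatFunc k)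
    (hh : h * τ h = RatFunc.C g1) :
    ∃ (c : k) (N e : ℕ), c ≠ 0 ∧ g ^ N = g1 * (c * σ c) * g ^ e := by
  set ι := algebraMap (Polynomial k) (RatFunc k) with hι
  have ιinj : Function.Injective ι := RatFunc.algebraMap_injective k
  have ιC : ∀ a, ι (Polynomial.C a) = RatFunc.C a := fun a => RatFunc.algebraMap_C a
  have ιX : ι Polynomial.X = RatFunc.X := RatFunc.algebraMap_X
  have X0 : (RatFunc.X : RatFunc k) ≠ 0 := RatFunc.X_ne_zero
  have gC : (RatFunc.C g : RatFunc k) ≠ 0 := (map_ne_zero _).2 hg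
  have hττ : ∀ p, τ (τ (ι p)) = ι p := by
    intro p
    have : (τ.comp τ).comp ι = ι := by
      apply Polynomial.ringHom_ext
      · intro a
        simp only [RingHom.comp_apply, ιC, hC, hσ]
      · simp only [RingHom.comp_apply, ιX, hX, map_div₀, hC, hσg]
        field_simp
    exact RingHom.congr_fun this p
  have tilde : ∀ (N : ℕ) (p : Polynomial k), p.natDegree ≤ N →
      ∃ q, ι q = RatFunc.X ^ N * τ (ι p) := by
    intro N p hp
    rw [Polynomial.as_sum_range_C_mul_X_pow' (p := p) (n := N + 1) (by omega)]
    refine ⟨∑ i ∈ Finset.range (N + 1), Polynomial.C (σ (p.coeff i) * g ^ i) *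
      Polynomial.X ^ (N - i), ?_⟩
    rw [map_sum, map_sum, map_sum, Finset.mul_sum]
    refine Finset.sum_congr rfl fun i hi => ?_
    have hi' : i ≤ N := by simpa [Nat.lt_succ_iff] using hi
    obtain ⟨j, rfl⟩ := Nat.exists_eq_add_of_le hi'
    simp only [map_mul, map_pow, ιC, ιX, hC, hX, Nat.add_sub_cancel_left, div_pow, pow_add]
    field_simp
  have h0 : h ≠ 0 := by
    rintro rfl
    rw [zero_mul] at hh
    exact (map_ne_zero (RatFunc.C (K := k))).2 hg1 hh.symm
  set A := h.num with hA
  set B := h.denom with hB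
  have hB0 : B ≠ 0 := RatFunc.denom_ne_zero h
  have hA0 : A ≠ 0 := RatFunc.num_ne_zero h0
  have hcop : IsCoprime A B := RatFunc.isCoprime_num_denom h
  have hAB : ι A / ι B = h := RatFunc.num_div_denom h
  have ιA0 : ι A ≠ 0 := (map_ne_zero_iff _ ιinj).2 hA0
  have ιB0 : ι B ≠ 0 := (map_ne_zero_iff _ ιinj).2 hB0
  have τB0 : τ (ι B) ≠ 0 := (map_ne_zero _).2 ιB0
  set N := max A.natDegree B.natDegree
  obtain ⟨A', hA'⟩ := tilde N A (le_max_left _ _)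
  obtain ⟨B', hB'⟩ := tilde N B (le_max_right _ _)
  have e1 : ι A * τ (ι A) = RatFunc.C g1 * (ι B * τ (ι B)) := by
    rw [← hh, ← hAB, map_div₀]
    field_simp
  have e2 : A * A' = Polynomial.C g1 * B * B' := by
    apply ιinj
    rw [map_mul, map_mul, map_mul, ιC, hA', hB']
    linear_combination (RatFunc.X ^ N) * e1
  have hdvd : A ∣ B' := by
    have h1 : A ∣ Polynomial.C g1 * B * B' := ⟨A', e2.symm⟩
    have hu : IsUnit (Polynomial.C g1) := Polynomial.isUnit_C.2 hg1.isUnit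
    rw [mul_assoc] at h1
    exact hcop.dvd_of_dvd_mul_left (hu.dvd_mul_left.1 h1)
  obtain ⟨Q, hQ⟩ := hdvd
  have e3 : A' = Polynomial.C g1 * B * Q := by
    apply mul_left_cancel₀ hA0
    rw [e2, hQ]; ring
  have e4 : RatFunc.C g ^ N = RatFunc.C g1 * (ι Q * τ (ι Q)) := by
    have s1 : τ (ι B') = τ (ι A) * τ (ι Q) := by rw [hQ, map_mul, map_mul]
    rw [hB', map_mul, map_pow, hX, hττ, div_pow] at s1
    have s2 : RatFunc.C g ^ N * ι B = ι A' * τ (ι Q) := by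
      rw [hA', mul_assoc, ← s1]
      field_simp
    rw [e3, map_mul, map_mul, ιC] at s2
    apply mul_right_cancel₀ ιB0
    rw [s2]; ring
  obtain ⟨Q', hQ'⟩ := tilde Q.natDegree Q le_rfl
  have e5 : Polynomial.C (g ^ N / g1) * Polynomial.X ^ Q.natDegree = Q * Q' := by
    apply ιinj
    have g1C : (RatFunc.C g1 : RatFunc k) ≠ 0 := (map_ne_zero _).2 hg1
    rw [map_mul, map_mul, map_pow, ιC, ιX, hQ', map_div₀, map_pow, e4]
    field_simp
  have hQd : Q ∣ Polynomial.X ^ Q.natDegree := by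
    have hu : IsUnit (Polynomial.C (g ^ N / g1)) :=
      Polynomial.isUnit_C.2 (div_ne_zero (pow_ne_zero _ hg) hg1).isUnit
    exact hu.dvd_mul_left.1 ⟨Q', e5⟩
  obtain ⟨e, -, he⟩ := (dvd_prime_pow Polynomial.prime_X _).1 hQd
  obtain ⟨w, hw⟩ := he.symm
  obtain ⟨c, hc, hcw⟩ := Polynomial.isUnit_iff.1 w.isUnit
  refine ⟨c, N, e, hc.ne_zero, ?_⟩
  apply (RatFunc.C (K := k)).injective
  rw [← hcw] at hw
  rw [map_pow, e4, ← hw]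
  simp only [map_mul, map_pow, ιC, ιX, hC, hX, div_pow]
  field_simp

end NonSplit

section Primes

noncomputable def sg0 : MvPolynomial (Fin 2) ℂ →ₐ[ℂ] MvPolynomial (Fin 2) ℂ :=
  aeval ![-X 0, X 1]

lemma sg0_sg0 : sg0.comp sg0 = AlgHom.id ℂ _ := by
  ext i : 1
  fin_cases i <;> simp [sg0]

noncomputable def sg : MvPolynomial (Fin 2) ℂ ≃ₐ[ℂ] MvPolynomial (Fin 2) ℂ :=
  AlgEquiv.ofAlgHom sg0 sg0 sg0_sg0 sg0_sg0

lemma sg_X0 : sg (X 0) = -X 0 := by simp [sg, sg0]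
lemma sg_X1 : sg (X 1) = X 1 := by simp [sg, sg0]

lemma not_dvd_of_eval (a b : MvPolynomial (Fin 2) ℂ) (z : Fin 2 → ℂ) (ha : eval z a = 0)
    (hb : eval z b ≠ 0) : ¬ a ∣ b := by
  rintro ⟨c, rfl⟩
  rw [map_mul, ha, zero_mul] at hb
  exact hb rfl

lemma prime_pi1 : Prime (X 1 + C Complex.I * X 0 ^ 2 : MvPolynomial (Fin 2) ℂ) := by
  have h := irreducible_mul_X_add (1 : MvPolynomial (Fin 2) ℂ) (C Complex.I * X 0 ^ 2) 1
    one_ne_zero (by simp) (fun h => by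
      have := vars_mul _ _ h
      have h2 := vars_pow (X 0 : MvPolynomial (Fin 2) ℂ) 2
      simp only [vars_C, Finset.empty_union] at this
      have := h2 this
      simp [vars_X] at this) isRelPrime_one_left
  rw [one_mul] at h
  exact h.prime

lemma prime_pi2 : Prime (C Complex.I * X 0 ^ 2 * X 1 + 1 : MvPolynomial (Fin 2) ℂ) := by
  have h := irreducible_mul_X_add (C Complex.I * X 0 ^ 2 : MvPolynomial (Fin 2) ℂ) 1 1
    (mul_ne_zero (by simp [Complex.I_ne_zero]) (pow_ne_zero _ (X_ne_zero _))) (fun h => by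
      have := vars_mul _ _ h
      have h2 := vars_pow (X 0 : MvPolynomial (Fin 2) ℂ) 2
      simp only [vars_C, Finset.empty_union] at this
      have := h2 this
      simp [vars_X] at this) (by simp) isRelPrime_one_right
  exact h.prime

noncomputable def G1 : MvPolynomial (Fin 2) ℂ := (X 0 ^ 2) ^ 2 + X 1 ^ 2
noncomputable def G2 : MvPolynomial (Fin 2) ℂ := 1 + (X 0 ^ 2) ^ 2 * X 1 ^ 2

lemma CI2 : (C Complex.I : MvPolynomial (Fin 2) ℂ) ^ 2 = -1 := by
  rw [← C_pow, Complex.I_sq, C_neg, C_1]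

lemma G1_eq : G1 = (X 1 + C Complex.I * X 0 ^ 2) * (X 1 - C Complex.I * X 0 ^ 2) := by
  unfold G1; linear_combination (X 0 ^ 4) * CI2

lemma G2_eq : G2 = (C Complex.I * X 0 ^ 2 * X 1 + 1) * (1 - C Complex.I * X 0 ^ 2 * X 1) := by
  unfold G2; linear_combination (X 0 ^ 4 * X 1 ^ 2) * CI2

lemma G1_ne : G1 ≠ 0 := fun h => by
  have := congrArg (eval ![1, 0]) h
  simp [G1] at this

lemma G2_ne : G2 ≠ 0 := fun h => by
  have := congrArg (eval ![0, 0]) h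
  simp [G2] at this

lemma mult_eq_one {π a b : MvPolynomial (Fin 2) ℂ} (hπ : Prime π) (ha : a = π * b) (hb : ¬ π ∣ b) :
    multiplicity π a = 1 := by
  have hb0 : b ≠ 0 := by rintro rfl; simp at hb
  rw [ha, multiplicity_mul hπ (.of_prime_left hπ (mul_ne_zero hπ.ne_zero hb0)),
    multiplicity_eq_zero.2 hb]
  simp

lemma no_norm (a b : MvPolynomial (Fin 2) ℂ) (ha : a ≠ 0) (hb : b ≠ 0) (N e : ℕ)
    (h : (G1 * G2) ^ N * (b * sg b) = G1 * (a * sg a) * (G1 * G2) ^ e) : False := by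
  have hsa : sg a ≠ 0 := (map_ne_zero_iff _ sg.injective).2 ha
  have hsb : sg b ≠ 0 := (map_ne_zero_iff _ sg.injective).2 hb
  have hm : ∀ {π p q : MvPolynomial (Fin 2) ℂ}, Prime π → p ≠ 0 → q ≠ 0 →
      multiplicity π (p * q) = multiplicity π p + multiplicity π q := by
    intro π p q hπ hp hq
    exact multiplicity_mul hπ (.of_prime_left hπ (mul_ne_zero hp hq))
  have hp : ∀ {π p : MvPolynomial (Fin 2) ℂ}, Prime π → p ≠ 0 → ∀ n,
      multiplicity π (p ^ n) = n * multiplicity π p := by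
    intro π p hπ hp n
    exact (FiniteMultiplicity.of_prime_left hπ hp).multiplicity_pow hπ
  have hs : ∀ {π p : MvPolynomial (Fin 2) ℂ}, sg π = π → multiplicity π (sg p) = multiplicity π p := by
    intro π p hπ
    conv_lhs => rw [← hπ]
    exact multiplicity_map_eq sg
  have hG := mul_ne_zero G1_ne G2_ne
  have main : ∀ {π : MvPolynomial (Fin 2) ℂ}, Prime π → sg π = π →
      N * (multiplicity π G1 + multiplicity π G2) + 2 * multiplicity π b =
        multiplicity π G1 + 2 * multiplicity π a + e * (multiplicity π G1 + multiplicity π G2) := by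
    intro π hπ hsπ
    have := congrArg (multiplicity π) h
    rw [hm hπ (pow_ne_zero _ hG) (mul_ne_zero hb hsb), hm hπ hb hsb, hp hπ hG,
      hm hπ G1_ne G2_ne, hm hπ (mul_ne_zero G1_ne (mul_ne_zero ha hsa)) (pow_ne_zero _ hG),
      hm hπ G1_ne (mul_ne_zero ha hsa), hm hπ ha hsa, hp hπ hG, hm hπ G1_ne G2_ne, hs hsπ,
      hs hsπ] at this
    linarith
  have sC : ∀ z : ℂ, sg (C z) = C z := fun z => sg.commutes z
  have I2 : Complex.I * Complex.I = -1 := Complex.I_mul_I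
  have m1 := main prime_pi1 (by simp [sg_X0, sg_X1, sC])
  have m2 := main prime_pi2 (by simp [sg_X0, sg_X1, sC])
  have a1 := mult_eq_one prime_pi1 G1_eq (not_dvd_of_eval _ _ ![2, -(4 * Complex.I)]
    (by simp; ring) (by
      simp
      intro h
      have := congrArg Complex.im h
      norm_num at this))
  have a2 : multiplicity (X 1 + C Complex.I * X 0 ^ 2 : MvPolynomial (Fin 2) ℂ) G2 = 0 :=
    multiplicity_eq_zero.2 (not_dvd_of_eval _ _ ![2, -(4 * Complex.I)] (by simp; ring) (by
      simp [G2, mul_pow]; norm_num))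
  have b2 := mult_eq_one prime_pi2 G2_eq (not_dvd_of_eval _ _ ![2, Complex.I / 4]
    (by simp; linear_combination I2) (by
      have : Complex.I * 2 ^ 2 * (Complex.I / 4) = -1 := by linear_combination I2
      simp [this]))
  have b1 : multiplicity (C Complex.I * X 0 ^ 2 * X 1 + 1 : MvPolynomial (Fin 2) ℂ) G1 = 0 :=
    multiplicity_eq_zero.2 (not_dvd_of_eval _ _ ![2, Complex.I / 4]
      (by simp; linear_combination I2) (by simp [G1, div_pow]; norm_num))
  rw [a1, a2] at m1
  rw [b1, b2] at m2
  omega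

end Primes
section Final

abbrev MM : Type := RatFunc (CRatFunc 2)

instance MM_dom : IsDomain MM := inferInstance

instance MM_nzd : NoZeroDivisors MM := IsDomain.to_noZeroDivisors MM

/-- The embedding of `ℂ[s,y]` in `MM`. -/
noncomputable def jj : MvPolynomial (Fin 2) ℂ →+* MM :=
  (RatFunc.C (K := CRatFunc 2)).comp (algebraMap (MvPolynomial (Fin 2) ℂ) (CRatFunc 2))

lemma jj_C (z : ℂ) : jj (C z) = algebraMap ℂ MM z := by
  rw [IsScalarTower.algebraMap_apply ℂ (CRatFunc 2) MM,
    IsScalarTower.algebraMap_apply ℂ (MvPolynomial (Fin 2) ℂ) (CRatFunc 2)]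
  rfl

lemma jj_inj : Function.Injective jj :=
  (RatFunc.C (K := CRatFunc 2)).injective.comp (IsFractionRing.injective _ _)

noncomputable def eS : MM := jj (X 0)
noncomputable def eY : MM := jj (X 1)
noncomputable def eG : MM := jj (G1 * G2)
noncomputable def eU : MM := (RatFunc.X + eG / RatFunc.X) / 2
noncomputable def eW : MM := (eG / RatFunc.X - RatFunc.X) / (2 * eS)

lemma eS_ne : eS ≠ 0 := (map_ne_zero_iff _ jj_inj).2 (X_ne_zero _)
lemma eS2_ne : eS ^ 2 ≠ 0 := by
  rw [pow_two]; exact mul_ne_zero eS_ne eS_ne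
lemma eY_ne : eY ≠ 0 := (map_ne_zero_iff _ jj_inj).2 (X_ne_zero _)
lemma eX_ne : (RatFunc.X : MM) ≠ 0 := RatFunc.X_ne_zero

lemma two_neM : (2 : MM) ≠ 0 := two_ne_zero

lemma jG1 : jj G1 = (eS ^ 2) ^ 2 + eY ^ 2 := by simp [G1, eS, eY]
lemma jG2 : jj G2 = 1 + (eS ^ 2) ^ 2 * eY ^ 2 := by simp [G2, eS, eY]

lemma eq_UW : eU ^ 2 - eS ^ 2 * eW ^ 2 =
    ((eS ^ 2) ^ 2 + eY ^ 2) * (1 + (eS ^ 2) ^ 2 * eY ^ 2) := by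
  rw [← jG1, ← jG2, ← map_mul]
  change _ = eG
  unfold eU eW
  have := eS_ne
  have := eX_ne
  have := two_neM
  field_simp
  ring

lemma eq_P : (RatFunc.X : MM) = eU - eS * eW := by
  unfold eU eW
  have := eS_ne
  have := eX_ne
  have := two_neM
  field_simp
  ring

lemma gen_mem (S : Subfield MM) (hc : ∀ z : ℂ, algebraMap ℂ MM z ∈ S) (h0 : eS ∈ S) (h1 : eY ∈ S)
    (hp : (RatFunc.X : MM) ∈ S) (z : MM) : z ∈ S := by
  have a1 : ∀ p, jj p ∈ S := by
    intro p
    induction p using MvPolynomial.induction_on with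
    | C a => rw [jj_C]; exact hc a
    | add p q hp hq => rw [map_add]; exact S.add_mem hp hq
    | mul_X p i hp =>
      rw [map_mul]
      refine S.mul_mem hp ?_
      fin_cases i
      · exact h0
      · exact h1
  have a2 : ∀ a, RatFunc.C a ∈ S := by
    intro a
    obtain ⟨p, q, hq, rfl⟩ := IsFractionRing.div_surjective (A := MvPolynomial (Fin 2) ℂ) a
    rw [map_div₀]
    exact S.div_mem (a1 p) (a1 q)
  have a3 : ∀ q : Polynomial (CRatFunc 2), algebraMap _ MM q ∈ S := by
    intro q
    induction q using Polynomial.induction_on' with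
    | add p q hp hq => rw [map_add]; exact S.add_mem hp hq
    | monomial n a =>
      rw [← Polynomial.C_mul_X_pow_eq_monomial, map_mul, map_pow, RatFunc.algebraMap_C,
        RatFunc.algebraMap_X]
      exact S.mul_mem (a2 a) (S.pow_mem hp n)
  rw [← RatFunc.num_div_denom z]
  exact S.div_mem (a3 _) (a3 _)

noncomputable def KK : IntermediateField ℂ MM :=
  IntermediateField.adjoin ℂ {eS ^ 2, eY, eU, eW}

lemma mem_x : eS ^ 2 ∈ KK := IntermediateField.subset_adjoin _ _ (by simp)
lemma mem_y : eY ∈ KK := IntermediateField.subset_adjoin _ _ (by simp)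
lemma mem_u : eU ∈ KK := IntermediateField.subset_adjoin _ _ (by simp)
lemma mem_w : eW ∈ KK := IntermediateField.subset_adjoin _ _ (by simp)

lemma KK_fg : ∃ s : Finset KK, IntermediateField.adjoin ℂ (s : Set KK) = ⊤ := by
  have h : KK.FG := IntermediateField.fg_adjoin_of_finite (by simp)
  have := IntermediateField.essFiniteType_iff.2 h
  exact IntermediateField.fg_top ℂ KK

lemma KK_alg : Algebra.IsAlgebraic KK MM := by
  have hk : ∀ z ∈ KK, z ∈ algebraicClosure KK MM := fun z hz =>
    (algebraicClosure KK MM).algebraMap_mem ⟨z, hz⟩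
  have hs : eS ∈ algebraicClosure KK MM := by
    rw [mem_algebraicClosure_iff]
    refine IsAlgebraic.of_pow (n := 2) two_pos ?_
    exact mem_algebraicClosure_iff.1 (hk _ mem_x)
  refine ⟨fun z => mem_algebraicClosure_iff.1 ?_⟩
  refine gen_mem (algebraicClosure KK MM).toSubfield (fun z => hk _ (KK.algebraMap_mem z)) hs
    (hk _ mem_y) ?_ z
  change _ ∈ algebraicClosure KK MM
  rw [eq_P]
  exact (algebraicClosure KK MM).sub_mem (hk _ mem_u)
    ((algebraicClosure KK MM).mul_mem hs (hk _ mem_w))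

lemma trdeg_MM : Algebra.trdeg ℂ MM = 3 := by
  rw [(cratSucc 2).trdeg_eq]
  have h1 : IsTranscendenceBasis ℂ (X : Fin 3 → MvPolynomial (Fin 3) ℂ) :=
    IsTranscendenceBasis.mvPolynomial _ _
  have : Algebra.IsAlgebraic (MvPolynomial (Fin 3) ℂ) (CRatFunc 3) :=
    IsLocalization.isAlgebraic _ (nonZeroDivisors (MvPolynomial (Fin 3) ℂ))
  have h2 := h1.algebraMap_comp (A := CRatFunc 3)
  rw [← h2.cardinalMk_eq_trdeg]
  simp

lemma KK_tr : ∃ x : Fin 3 → KK, IsTranscendenceBasis ℂ x := by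
  have := KK_alg
  have h := trdeg_add_eq ℂ KK (A := MM)
  rw [trdeg_eq_zero (R := KK) (A := MM), add_zero, trdeg_MM] at h
  obtain ⟨ι, x, hx⟩ := exists_isTranscendenceBasis' ℂ KK
  have hι := hx.cardinalMk_eq_trdeg
  rw [h] at hι
  have : Cardinal.mk (Fin 3) = Cardinal.mk ι := by rw [hι]; simp
  obtain ⟨e⟩ := Cardinal.eq.1 this
  exact ⟨x ∘ e, hx.comp_equiv e⟩

noncomputable def sgF : CRatFunc 2 ≃+* CRatFunc 2 :=
  IsFractionRing.ringEquivOfRingEquiv sg.toRingEquiv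

lemma sgF_apply (p : MvPolynomial (Fin 2) ℂ) : sgF (algebraMap _ _ p) = algebraMap _ _ (sg p) :=
  IsFractionRing.ringEquivOfRingEquiv_algebraMap _ _

lemma sg_sg (p) : sg (sg p) = p := DFunLike.congr_fun sg0_sg0 p

lemma sgF_sgF (a) : sgF (sgF a) = a := by
  obtain ⟨p, q, hq, rfl⟩ := IsFractionRing.div_surjective (A := MvPolynomial (Fin 2) ℂ) a
  simp only [map_div₀, sgF_apply, sg_sg]

lemma sg_G1 : sg G1 = G1 := by simp [G1, sg_X0, sg_X1]
lemma sg_G2 : sg G2 = G2 := by simp [G2, sg_X0, sg_X1]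

lemma nonsplit (c d : MM) (hc : c ∈ KK) (hd : d ∈ KK)
    (h : (eS ^ 2) ^ 2 + eY ^ 2 = c ^ 2 - eS ^ 2 * d ^ 2) : False := by
  have ainj : Function.Injective (algebraMap (MvPolynomial (Fin 2) ℂ) (CRatFunc 2)) :=
    IsFractionRing.injective _ _
  set g : CRatFunc 2 := algebraMap _ _ (G1 * G2) with hgdef
  have hg : g ≠ 0 := (map_ne_zero_iff _ ainj).2 (mul_ne_zero G1_ne G2_ne)
  have hg1 : algebraMap _ (CRatFunc 2) G1 ≠ 0 := (map_ne_zero_iff _ ainj).2 G1_ne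
  have hσg : (sgF : CRatFunc 2 →+* CRatFunc 2) g = g := by
    change sgF g = g
    rw [hgdef, sgF_apply, map_mul, sg_G1, sg_G2]
  obtain ⟨τ, hC, hX⟩ := exists_tau (sgF : CRatFunc 2 →+* CRatFunc 2) g hg
  have τj : ∀ p, τ (jj p) = jj (sg p) := by
    intro p
    change τ (RatFunc.C _) = RatFunc.C _
    rw [hC]
    exact congrArg _ (sgF_apply p)
  have τs : τ eS = -eS := by unfold eS; rw [τj, sg_X0, map_neg]
  have τy : τ eY = eY := by unfold eY; rw [τj, sg_X1]
  have τg : τ eG = eG := by unfold eG; rw [τj, map_mul, sg_G1, sg_G2]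
  have hXg : τ RatFunc.X = eG / RatFunc.X := hX
  have hs0 := eS_ne
  have hX0 := eX_ne
  have h20 := two_neM
  have hG0 : eG ≠ 0 := (map_ne_zero_iff _ jj_inj).2 (mul_ne_zero G1_ne G2_ne)
  have τ2 : τ 2 = 2 := map_ofNat τ 2
  have τu : τ eU = eU := by
    unfold eU
    rw [map_div₀, map_add, map_div₀, hXg, τg, τ2]
    field_simp
    ring
  have τw : τ eW = eW := by
    unfold eW
    rw [map_div₀, map_sub, map_div₀, map_mul, hXg, τg, τs, τ2]
    field_simp
    ring
  have fixed : ∀ z ∈ KK, τ z = z := by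
    intro z hz
    unfold KK at hz
    induction hz using IntermediateField.adjoin_induction with
    | mem x hx =>
      simp only [Set.mem_insert_iff, Set.mem_singleton_iff] at hx
      rcases hx with rfl | rfl | rfl | rfl
      · rw [map_pow, τs]; ring
      · exact τy
      · exact τu
      · exact τw
    | algebraMap x => rw [← jj_C, τj]; exact congrArg jj (sg.commutes x)
    | add x y _ _ hx hy => rw [map_add, hx, hy]
    | inv x _ hx => rw [map_inv₀, hx]
    | mul x y _ _ hx hy => rw [map_mul, hx, hy]
  obtain ⟨e, N, n, he, heq⟩ := norm_lemma (sgF : CRatFunc 2 →+* CRatFunc 2) sgF_sgF g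
    (algebraMap _ _ G1) hg hσg hg1 τ hC hX (c - eS * d) (by
      change _ = jj G1
      rw [map_sub, map_mul, fixed c hc, fixed d hd, τs, jG1, h]
      ring)
  obtain ⟨a, b, hb, rfl⟩ := IsFractionRing.div_surjective (A := MvPolynomial (Fin 2) ℂ) e
  have hb0 : b ≠ 0 := nonZeroDivisors.ne_zero hb
  have ha0 : a ≠ 0 := by rintro rfl; simp at he
  have hb1 : algebraMap _ (CRatFunc 2) b ≠ 0 := (map_ne_zero_iff _ ainj).2 hb0
  have hb2 : algebraMap _ (CRatFunc 2) (sg b) ≠ 0 :=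
    (map_ne_zero_iff _ ainj).2 ((map_ne_zero_iff _ sg.injective).2 hb0)
  refine no_norm a b ha0 hb0 N n (ainj ?_)
  have heq' : g ^ N = algebraMap _ _ G1 * (algebraMap _ _ a / algebraMap _ _ b *
    (algebraMap _ _ (sg a) / algebraMap _ _ (sg b))) * g ^ n := by
    rw [heq]
    change _ * (_ * sgF _) * _ = _
    rw [map_div₀, sgF_apply, sgF_apply]
  simp only [map_mul, map_pow] at heq' ⊢
  rw [← map_mul, ← hgdef, heq']
  field_simp

lemma KK_not : ¬ IsPurelyTranscendental KK := by
  rintro ⟨m, ⟨e⟩⟩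
  have hgood : GoodField KK := (goodField_crat m).equiv e.symm.toRingEquiv
  let x : KK := ⟨eS ^ 2, mem_x⟩
  let y : KK := ⟨eY, mem_y⟩
  let u : KK := ⟨eU, mem_u⟩
  let w : KK := ⟨eW, mem_w⟩
  obtain ⟨η, hη⟩ := IsAlgClosed.exists_pow_nat_eq Complex.I (n := 2) two_pos
  have hs2 : eS ^ 2 ≠ 0 := eS2_ne
  have hx0 : x ≠ 0 := fun h => hs2 (congrArg Subtype.val h)
  have hy0 : y ≠ 0 := fun h => eY_ne (congrArg Subtype.val h)
  have hg1 : x ^ 2 + y ^ 2 ≠ 0 := fun h => (map_ne_zero_iff _ jj_inj).2 G1_ne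
    (jG1.trans (congrArg Subtype.val h))
  have hg2 : 1 + x ^ 2 * y ^ 2 ≠ 0 := fun h => (map_ne_zero_iff _ jj_inj).2 G2_ne
    (jG2.trans (congrArg Subtype.val h))
  have he : u ^ 2 - x * w ^ 2 = (x ^ 2 + y ^ 2) * (1 + x ^ 2 * y ^ 2) := Subtype.ext eq_UW
  have hur : UrAll (x ^ 2 + y ^ 2) x := by
    intro Γ _ v
    exact example_urV v (i := algebraMap ℂ KK Complex.I) (η := algebraMap ℂ KK η)
      (by rw [← map_pow, Complex.I_sq, map_neg, map_one]) (by rw [← map_pow, hη])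
      hx0 hy0 hg1 hg2 he
  obtain ⟨c, d, hcd⟩ := hgood _ _ hg1 hx0 hur
  exact nonsplit c d c.2 d.2 (congrArg Subtype.val hcd)

end Final

/-- **Negative answer to the Lüroth problem in dimension 3.** There is a field `K`, finitely
generated and of transcendence degree 3 over `ℂ`, which embeds as a `ℂ`-algebra into
`ℂ(t₁,t₂,t₃)` (i.e. is unirational over `ℂ`) but is not purely transcendental over `ℂ`. -/
theorem luroth_problem_negative_dim3 :
    ∃ (K : Type) (_ : Field K) (_ : Algebra ℂ K),
      (∃ s : Finset K, IntermediateField.adjoin ℂ (s : Set K) = ⊤) ∧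
      (∃ x : Fin 3 → K, IsTranscendenceBasis ℂ x) ∧
      (∃ f : K →ₐ[ℂ] CRatFunc 3, Function.Injective f) ∧
      ¬ IsPurelyTranscendental K := by
  exact ⟨KK, inferInstance, inferInstance, KK_fg, KK_tr,
    ⟨(cratSucc 2).toAlgHom.comp KK.val, (cratSucc 2).injective.comp Subtype.val_injective⟩, KK_not⟩
end

section
/- There exists a field K, finitely generated over ℂ and of transcendence degree 3 over ℂ, such that K is unirational over ℂ but K is not stably rational over ℂ: for every n ≥ 0, the rational function field K(u₁,…,uₙ) is not purely transcendental over ℂ. (Field-theoretic form of the Artin–Mumford theorem.) -/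
namespace AM
open scoped WithZero

section sym
variable {L : Type} [Field L] (v : Valuation L ℤᵐ⁰)

noncomputable def ord (a : Lˣ) : ℤ := WithZero.log (v (a : L))

lemma v_ne (a : Lˣ) : v (a : L) ≠ 0 := (Valuation.ne_zero_iff v).2 a.ne_zero

lemma ord_mul (a b : Lˣ) : ord v (a * b) = ord v a + ord v b := by
  simp [ord, WithZero.log_mul (v_ne v a) (v_ne v b)]

lemma ord_sq (a : Lˣ) : ord v (a ^ 2) = 2 * ord v a := by
  rw [pow_two, ord_mul]; ring

lemma ord_eq_zero {a : Lˣ} (h : v (a : L) = 1) : ord v a = 0 := by simp [ord, h]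

lemma v_of_one_unit {z : L} (h : v (z - 1) < 1) : v z = 1 := by
  have := v.map_one_add_of_lt h
  simpa using this

def HH : Subgroup Lˣ where
  carrier := {z | ∃ d : L, v ((z : L) * d ^ 2 - 1) < 1}
  one_mem' := ⟨1, by simp⟩
  mul_mem' := by
    rintro a b ⟨d, hd⟩ ⟨e, he⟩
    refine ⟨d * e, ?_⟩
    have h1 := v_of_one_unit v hd
    have : ((a * b : Lˣ) : L) * (d * e) ^ 2 - 1
      = (a * d ^ 2) * (b * e ^ 2 - 1) + (a * d ^ 2 - 1) := by push_cast; ring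
    rw [this]
    refine v.map_add_lt ?_ hd
    rw [v.map_mul, h1, one_mul]; exact he
  inv_mem' := by
    rintro a ⟨d, hd⟩
    have h1 := v_of_one_unit v hd
    have hd0 : d ≠ 0 := by rintro rfl; simp at h1
    refine ⟨d⁻¹, ?_⟩
    have : ((a⁻¹ : Lˣ) : L) * d⁻¹ ^ 2 - 1 = - ((a * d ^ 2 - 1) * (a * d ^ 2)⁻¹) := by
      have := a.ne_zero
      push_cast; field_simp; ring
    rw [this, v.map_neg, v.map_mul, map_inv₀, h1, inv_one, mul_one]; exact hd

lemma sq_mem (a : Lˣ) : a ^ 2 ∈ HH v := ⟨((a⁻¹ : Lˣ) : L), by simp⟩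

lemma one_unit_mem {a : Lˣ} (h : v ((a : L) - 1) < 1) : a ∈ HH v := ⟨1, by simpa using h⟩

lemma even_mem (a : Lˣ) {n : ℤ} (h : Even n) : a ^ n ∈ HH v := by
  obtain ⟨k, rfl⟩ := h
  have : a ^ (k + k) = (a ^ k) ^ 2 := by rw [zpow_add, pow_two]
  rw [this]; exact sq_mem v _

def Triv (a b : Lˣ) : Prop := a ^ ord v b * b ^ ord v a ∈ HH v

variable {v}

lemma Triv.symm {a b : Lˣ} (h : Triv v a b) : Triv v b a := by
  unfold Triv at *; rwa [mul_comm]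

lemma Triv.mul {a b c : Lˣ} (h : Triv v a b) (h' : Triv v a c) : Triv v a (b * c) := by
  unfold Triv at *
  have := (HH v).mul_mem h h'
  rw [ord_mul, zpow_add, mul_zpow]
  convert this using 1
  exact mul_mul_mul_comm _ _ _ _

lemma Triv.of_mul {a b c : Lˣ} (h : Triv v a b) (h' : Triv v a (b * c)) : Triv v a c := by
  unfold Triv at *
  rw [ord_mul, zpow_add, mul_zpow, mul_mul_mul_comm] at h'
  exact ((HH v).mul_mem_cancel_left h).1 h'

variable (v)
lemma triv_sq (a d : Lˣ) : Triv v a (d ^ 2) := by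
  unfold Triv
  refine (HH v).mul_mem (even_mem v _ ?_) ?_
  · rw [ord_sq]; simp
  · exact (HH v).zpow_mem (sq_mem v d) _

lemma triv_one_unit (a : Lˣ) {b : Lˣ} (h : v ((b : L) - 1) < 1) : Triv v a b := by
  unfold Triv
  rw [ord_eq_zero v (v_of_one_unit v h), zpow_zero, one_mul]
  exact (HH v).zpow_mem (one_unit_mem v h) _

lemma triv_neg (i : L) (hi : i ^ 2 = -1) (a : Lˣ) : Triv v a (-a) := by
  have hi0 : i ≠ 0 := by rintro rfl; simp at hi
  have h1 : ord v (-a) = ord v a := by simp [ord]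
  unfold Triv
  rw [h1, ← mul_zpow]
  apply (HH v).zpow_mem
  have : a * -a = (Units.mk0 i hi0 * a) ^ 2 := by
    ext; push_cast; rw [Units.val_mk0, mul_pow, hi]; ring
  rw [this]; exact sq_mem v _

lemma triv_sq_one_unit (a : Lˣ) {b d : Lˣ} (h : v ((b : L) * ((d : L) ^ 2)⁻¹ - 1) < 1) :
    Triv v a b := by
  have : b = d ^ 2 * (b * (d ^ 2)⁻¹) := by rw [mul_comm, mul_assoc]; simp
  rw [this]
  refine (triv_sq v a d).mul (triv_one_unit v a ?_)
  push_cast at *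
  exact h

lemma triv_norm (i : L) (hi : i ^ 2 = -1) (a b : Lˣ) (x y : L) (h : (b : L) = x ^ 2 - a * y ^ 2) :
    Triv v a b := by
  have hb := b.ne_zero
  have ha := a.ne_zero
  by_cases hx : x = 0
  · have hy : y ≠ 0 := by rintro rfl; simp [hx] at h
    have : b = -a * (Units.mk0 y hy) ^ 2 := by ext; push_cast; rw [h, hx]; simp
    rw [this]
    exact (triv_neg v i hi a).mul (triv_sq v _ _)
  by_cases hy : y = 0
  · have : b = (Units.mk0 x hx) ^ 2 := by ext; push_cast; rw [h, hy]; simp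
    rw [this]
    exact (triv_sq v _ _)
  let x' := Units.mk0 x hx
  let y' := Units.mk0 y hy
  rcases lt_trichotomy (v (a * y ^ 2)) (v (x ^ 2)) with hl | hl | hl
  · apply triv_sq_one_unit v a (d := x')
    have : (b : L) * ((x' : L) ^ 2)⁻¹ - 1 = - (a * y ^ 2 / x ^ 2) := by
      simp only [x', Units.val_mk0]; rw [h]; field_simp; ring
    rw [this, v.map_neg, v.map_div]
    exact (div_lt_one₀ (by rw [zero_lt_iff]; simp [hx])).2 hl
  · let a' := a * (y' * x'⁻¹) ^ 2
    let b' := b * (x'⁻¹) ^ 2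
    have e : (a' : L) + b' = 1 := by
      simp only [a', b', x', y']; push_cast; simp only [Units.val_mk0]; rw [h]; field_simp; ring
    have hva : v (a' : L) = 1 := by
      simp only [a', x', y']; push_cast; simp only [Units.val_mk0]
      have : (a : L) * (y * x⁻¹) ^ 2 = (a * y ^ 2) / x ^ 2 := by field_simp
      rw [this, v.map_div, hl, div_self]; simp [hx]
    have key : Triv v a' b' := by
      have hb' : (b' : L) = 1 - a' := by rw [← e]; ring
      have hle : v (b' : L) ≤ 1 := by
        rw [hb']; exact v.map_sub_le (by simp) hva.le
      rcases hle.lt_or_eq with hlt | heq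
      · refine (triv_one_unit v b' ?_).symm
        have : (a' : L) - 1 = - b' := by rw [← e]; ring
        rw [this, v.map_neg]; exact hlt
      · unfold Triv; rw [ord_eq_zero v hva, ord_eq_zero v heq]; simp
    have k1 : Triv v a' b := by
      have : b = b' * x' ^ 2 := by simp [b']
      rw [this]; exact key.mul (triv_sq v _ _)
    have k2 : a = a' * (x' * y'⁻¹) ^ 2 := by
      simp only [a', mul_assoc, ← mul_pow]; simp
    rw [k2]
    exact (k1.symm.mul (triv_sq v _ _)).symm
  · have hb2 : b = (-a) * (b * (-a)⁻¹) := by rw [mul_comm, mul_assoc]; simp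
    rw [hb2]
    refine (triv_neg v i hi a).mul ?_
    apply triv_sq_one_unit v a (d := y')
    have : ((b * (-a)⁻¹ : Lˣ) : L) * ((y' : L) ^ 2)⁻¹ - 1 = - (x ^ 2 / (a * y ^ 2)) := by
      simp only [y', Units.val_mk0]; push_cast; rw [h]
      have : -(a : L) ≠ 0 := by simp
      field_simp; ring
    rw [this, v.map_neg, v.map_div]
    exact (div_lt_one₀ (by rw [zero_lt_iff]; simp [hy])).2 hl

/-- local computation for the Artin--Mumford class -/
lemma triv_AM (j : L) (hj : j ^ 4 = -1) (x y g1 g2 : Lˣ)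
    (h1 : (g1 : L) = (y : L) ^ 2 - x ^ 2) (h2 : (g2 : L) = 1 - (x : L) ^ 2 * y ^ 2)
    (X Y : L) (h : (g1 : L) * g2 = X ^ 2 - x * Y ^ 2) : Triv v x g1 := by
  have hi : (j ^ 2) ^ 2 = -1 := by rw [← pow_mul]; exact hj
  have hN : Triv v x (g2 * g1) := triv_norm v (j ^ 2) hi x _ X Y (by push_cast; rw [← h]; ring)
  have hx0 := x.ne_zero
  have hy0 := y.ne_zero
  have hj0 : j ≠ 0 := by rintro rfl; simp at hj
  have hvx0 := v_ne v x
  have hvy0 := v_ne v y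
  have sqlt : ∀ {z : L}, v z < 1 → v (- z ^ 2) < 1 := by
    intro z hz; rw [v.map_neg, map_pow]; exact pow_lt_one₀ zero_le hz two_ne_zero
  rcases lt_or_ge (v (x : L)) (v (y : L)) with hxy | hxy
  · -- g1 = y^2 * (1 - (x/y)^2)
    apply triv_sq_one_unit v x (d := y)
    have : (g1 : L) * ((y : L) ^ 2)⁻¹ - 1 = - (x / y) ^ 2 := by rw [h1]; field_simp; ring
    rw [this]; apply sqlt; rw [v.map_div]; exact (div_lt_one₀ (zero_lt_iff.2 hvy0)).2 hxy
  rcases lt_or_ge (v ((x : L) * y)) 1 with hp | hp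
  · -- g2 is a one-unit
    apply Triv.of_mul (b := g2) _ hN
    apply triv_one_unit
    rw [h2]
    have : 1 - (x : L) ^ 2 * y ^ 2 - 1 = - (x * y) ^ 2 := by ring
    rw [this]; exact sqlt hp
  rcases hxy.lt_or_eq with hyx | hxy
  · apply triv_sq_one_unit v x (d := Units.mk0 (j ^ 2) (pow_ne_zero 2 hj0) * x)
    have : (g1 : L) * (((Units.mk0 (j ^ 2) (pow_ne_zero 2 hj0) * x : Lˣ) : L) ^ 2)⁻¹ - 1
        = - (y / x) ^ 2 := by
      push_cast; rw [h1, Units.val_mk0, mul_pow, hi]; field_simp; ring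
    rw [this]; apply sqlt; rw [v.map_div]; exact (div_lt_one₀ (zero_lt_iff.2 hvx0)).2 hyx
  rcases hp.lt_or_eq with hp | hp
  · apply Triv.of_mul (b := g2) _ hN
    apply triv_sq_one_unit v x (d := Units.mk0 (j ^ 2) (pow_ne_zero 2 hj0) * x * y)
    have : (g2 : L) * (((Units.mk0 (j ^ 2) (pow_ne_zero 2 hj0) * x * y : Lˣ) : L) ^ 2)⁻¹ - 1
        = - (((x : L) * (y : L))⁻¹) ^ 2 := by
      push_cast; rw [h2, Units.val_mk0, mul_assoc, mul_pow, hi]; field_simp; ring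
    rw [this]; apply sqlt; rw [map_inv₀]; exact inv_lt_one_of_one_lt₀ hp
  -- now v x = v y = 1
  have hvx : v (x : L) = 1 := by
    rw [v.map_mul, hxy, ← pow_two] at hp
    exact (pow_eq_one_iff_of_nonneg zero_le two_ne_zero).1 hp.symm
  have hvy : v (y : L) = 1 := by rw [hxy, hvx]
  have unitcase : ∀ g : Lˣ, v (g : L) = 1 → Triv v x g := by
    intro g hg; unfold Triv
    rw [ord_eq_zero v hvx, ord_eq_zero v hg]; simp
  have l1 : v (g1 : L) ≤ 1 := by
    rw [h1]; apply v.map_sub_le <;> simp [hvx, hvy]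
  have l2 : v (g2 : L) ≤ 1 := by
    rw [h2]; apply v.map_sub_le <;> simp [hvx, hvy]
  rcases l1.lt_or_eq with l1 | l1
  swap
  · exact unitcase _ l1
  rcases l2.lt_or_eq with l2 | l2
  swap
  · exact Triv.of_mul (unitcase _ l2) hN
  -- x^4 is a one-unit
  have hx4 : v ((x : L) ^ 4 - 1) < 1 := by
    have : (x : L) ^ 4 - 1 = - (x ^ 2 * g1 + g2) := by rw [h1, h2]; ring
    rw [this, v.map_neg]
    apply v.map_add_lt _ l2
    rw [v.map_mul, map_pow, hvx]; simpa using l1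
  have hvj : v j = 1 := by
    have := congrArg v hj
    rw [map_pow, v.map_neg, v.map_one] at this
    exact (pow_eq_one_iff_of_nonneg zero_le (by norm_num)).1 this
  have hx : x ∈ HH v := by
    have fac : (x : L) ^ 4 - 1 = (x - 1) * (x * j ^ 4 - 1) * -((x * j ^ 2 - 1) * (x * j ^ 6 - 1)) := by
      have e6 : j ^ 6 = - j ^ 2 := by
        have : j ^ 6 = j ^ 4 * j ^ 2 := by ring
        rw [this, hj]; ring
      have e2 : (j ^ 2) * j ^ 2 = -1 := by rw [← hj]; ring
      rw [hj, e6]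
      linear_combination (-1 : L) * (x - 1) * (x * (-1 : L) - 1) * x ^ 2 * e2
    have test : ∀ n : ℕ, v ((x : L) * j ^ (2 * n) - 1) < 1 → x ∈ HH v := by
      intro n hn
      exact ⟨j ^ n, by rwa [← pow_mul, mul_comm n 2]⟩
    have le : ∀ n : ℕ, 1 ≤ v ((x : L) * j ^ (2 * n) - 1) ∨ x ∈ HH v := by
      intro n
      rcases lt_or_ge (v ((x : L) * j ^ (2 * n) - 1)) 1 with h | h
      · exact Or.inr (test n h)
      · exact Or.inl h
    rcases le 0 with a0 | a0
    swap
    · exact a0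
    rcases le 1 with a1 | a1
    swap
    · exact a1
    rcases le 2 with a2 | a2
    swap
    · exact a2
    rcases le 3 with a3 | a3
    swap
    · exact a3
    exfalso
    rw [fac, v.map_mul, v.map_mul, v.map_neg, v.map_mul] at hx4
    norm_num at a0 a1 a2 a3
    exact absurd hx4 (not_lt.2 (one_le_mul (one_le_mul a0 a2) (one_le_mul a1 a3)))
  unfold Triv
  rw [ord_eq_zero v hvx, zpow_zero, mul_one]
  exact (HH v).zpow_mem hx _

end sym
end AM


namespace AM
open scoped WithZero
open Polynomial

section gauss
variable {F : Type} [Field F] (v : Valuation F ℤᵐ⁰)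

noncomputable def gv (P : F[X]) : ℤᵐ⁰ := P.support.sup (fun i => v (P.coeff i))

lemma le_gv (P : F[X]) (i : ℕ) : v (P.coeff i) ≤ gv v P := by
  by_cases h : i ∈ P.support
  · exact Finset.le_sup (f := fun i => v (P.coeff i)) h
  · rw [notMem_support_iff.1 h]; simp

lemma gv_le {P : F[X]} {A : ℤᵐ⁰} (h : ∀ i, v (P.coeff i) ≤ A) : gv v P ≤ A :=
  Finset.sup_le fun i _ => h i

lemma gv_pos {P : F[X]} (h : P ≠ 0) : gv v P ≠ 0 := by
  intro h0
  have := le_gv v P P.natDegree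
  rw [h0] at this
  have := le_antisymm this zero_le
  rw [v.zero_iff] at this
  exact h (leadingCoeff_eq_zero.1 this)

lemma gv_max {P : F[X]} (h : P ≠ 0) :
    ∃ i, v (P.coeff i) = gv v P ∧ ∀ k, i < k → v (P.coeff k) < gv v P := by
  classical
  have hne : P.support.Nonempty := by simpa using h
  obtain ⟨i, hi, hi'⟩ := Finset.exists_mem_eq_sup P.support hne (fun i => v (P.coeff i))
  let S := P.support.filter (fun i => v (P.coeff i) = gv v P)
  have hS : S.Nonempty := ⟨i, Finset.mem_filter.2 ⟨hi, hi'.symm⟩⟩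
  refine ⟨S.max' hS, (Finset.mem_filter.1 (S.max'_mem hS)).2, fun k hk => ?_⟩
  refine lt_of_le_of_ne (le_gv v P k) fun heq => ?_
  have : k ∈ S := by
    refine Finset.mem_filter.2 ⟨?_, heq⟩
    rw [mem_support_iff]
    intro h0
    rw [h0, v.map_zero] at heq
    exact gv_pos v h heq.symm
  exact absurd (S.le_max' k this) (not_le.2 hk)

lemma coeff_lt (P Q : F[X]) (hP : P ≠ 0) (hQ : Q ≠ 0) (i j : ℕ)
    (hi : ∀ k, i < k → v (P.coeff k) < gv v P) (hj : ∀ k, j < k → v (Q.coeff k) < gv v Q) :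
    v ((P * Q).coeff (i + j) - P.coeff i * Q.coeff j) < gv v P * gv v Q := by
  have hA := gv_pos v hP
  have hB := gv_pos v hQ
  have hmem : (i, j) ∈ Finset.HasAntidiagonal.antidiagonal (i + j) := by simp
  rw [coeff_mul, ← Finset.add_sum_erase _ _ hmem]
  simp only [add_sub_cancel_left]
  apply v.map_sum_lt (mul_ne_zero hA hB)
  rintro ⟨k, l⟩ hkl
  simp only [Finset.mem_erase, ne_eq, Prod.mk.injEq, Finset.HasAntidiagonal.mem_antidiagonal] at hkl
  rw [v.map_mul]
  rcases lt_or_ge i k with h | h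
  · rw [mul_comm, mul_comm (gv v P)]
    exact mul_lt_mul_of_le_of_lt_of_nonneg_of_pos (le_gv v Q l) (hi k h) zero_le (zero_lt_iff.2 hB)
  · have : j < l := by omega
    exact mul_lt_mul_of_le_of_lt_of_nonneg_of_pos (le_gv v P k) (hj l this) zero_le
      (zero_lt_iff.2 hA)

lemma gv_mul (P Q : F[X]) : gv v (P * Q) = gv v P * gv v Q := by
  by_cases hP : P = 0
  · simp [hP, gv]
  by_cases hQ : Q = 0
  · simp [hQ, gv]
  apply le_antisymm
  · apply gv_le
    intro n
    rw [coeff_mul]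
    apply v.map_sum_le
    intro p _
    rw [v.map_mul]
    exact mul_le_mul' (le_gv v P _) (le_gv v Q _)
  · obtain ⟨i, hi, hi'⟩ := gv_max v hP
    obtain ⟨j, hj, hj'⟩ := gv_max v hQ
    have h := coeff_lt v P Q hP hQ i j hi' hj'
    have h2 : v (P.coeff i * Q.coeff j) = gv v P * gv v Q := by rw [v.map_mul, hi, hj]
    rw [← h2] at h
    have := v.map_eq_of_sub_lt h
    rw [← h2, ← this]
    exact le_gv v _ _

noncomputable def gaussVal : Valuation F[X] ℤᵐ⁰ where
  toFun := gv v
  map_zero' := by simp [gv]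
  map_one' := by
    apply le_antisymm
    · apply gv_le
      intro i
      rw [coeff_one]; split_ifs <;> simp
    · have := le_gv v (1 : F[X]) 0
      simpa using this
  map_mul' := gv_mul v
  map_add_le_max' := by
    intro P Q
    apply gv_le
    intro i
    rw [coeff_add]
    exact (v.map_add _ _).trans (max_le_max (le_gv v P i) (le_gv v Q i))

lemma gv_C (c : F) : gv v (C c) = v c := by
  apply le_antisymm
  · apply gv_le
    intro i
    rw [coeff_C]; split_ifs <;> simp
  · have := le_gv v (C c) 0
    simpa using this

variable (L : Type) [Field L] [Algebra F[X] L] [IsFractionRing F[X] L]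

lemma gaussVal_supp : nonZeroDivisors F[X] ≤ (gaussVal v).supp.primeCompl := by
  intro P hP hP'
  exact gv_pos v (nonZeroDivisors.ne_zero hP) hP'

noncomputable def gaussL : Valuation L ℤᵐ⁰ :=
  (gaussVal v).extendToLocalization (gaussVal_supp v) L

lemma gaussL_apply (P : F[X]) : gaussL v L (algebraMap F[X] L P) = gv v P :=
  Valuation.extendToLocalization_apply_map_apply _ _ _ _

lemma gauss_HH (c : Fˣ) (c' : Lˣ) (hc : (c' : L) = algebraMap F[X] L (C (c : F)))
    (h : c' ∈ HH (gaussL v L)) : c ∈ HH v := by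
  obtain ⟨d, hd⟩ := h
  have hcd := v_of_one_unit _ hd
  have hd0 : d ≠ 0 := by rintro rfl; simp at hcd
  obtain ⟨f, g, hg, rfl⟩ := IsFractionRing.div_surjective (A := F[X]) d
  have hg0 : g ≠ 0 := nonZeroDivisors.ne_zero hg
  have hf0 : f ≠ 0 := by rintro rfl; simp at hd0
  have hgL : algebraMap F[X] L g ≠ 0 := by simpa using hg0
  have hgp := gv_pos v hg0
  have hfp := gv_pos v hf0
  have e1 : v (c : F) * (gv v f * gv v f) = gv v g * gv v g := by
    rw [hc, map_mul, gaussL_apply, gv_C, map_pow, map_div₀, gaussL_apply, gaussL_apply] at hcd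
    field_simp at hcd
    rw [← pow_two, ← pow_two]; exact hcd
  have e2 : gv v (C (c : F) * (f * f) - g * g) < gv v g * gv v g := by
    have : algebraMap F[X] L (C (c : F) * (f * f) - g * g)
      = ((c' : L) * (algebraMap F[X] L f / algebraMap F[X] L g) ^ 2 - 1) *
        algebraMap F[X] L (g * g) := by
      rw [hc]; simp only [map_sub, map_mul]; field_simp
    rw [← gaussL_apply v L, this, map_mul, gaussL_apply, gv_mul]
    conv_rhs => rw [← one_mul (gv v g * gv v g)]
    rw [mul_comm, mul_comm (1 : ℤᵐ⁰)]
    exact mul_lt_mul_of_le_of_lt_of_nonneg_of_pos le_rfl hd zero_le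
      (zero_lt_iff.2 (mul_ne_zero hgp hgp))
  obtain ⟨i, hi, hi'⟩ := gv_max v hf0
  obtain ⟨j, hj, hj'⟩ := gv_max v hg0
  let n := max i j
  have ff := coeff_lt v f f hf0 hf0 n n (fun k hk => hi' k (lt_of_le_of_lt (le_max_left _ _) hk))
    (fun k hk => hi' k (lt_of_le_of_lt (le_max_left _ _) hk))
  have gg := coeff_lt v g g hg0 hg0 n n (fun k hk => hj' k (lt_of_le_of_lt (le_max_right _ _) hk))
    (fun k hk => hj' k (lt_of_le_of_lt (le_max_right _ _) hk))
  have key : v ((c : F) * (f.coeff n * f.coeff n) - g.coeff n * g.coeff n)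
      < gv v g * gv v g := by
    have h1 := (le_gv v (C (c : F) * (f * f) - g * g) (n + n)).trans_lt e2
    rw [coeff_sub, coeff_C_mul] at h1
    have : (c : F) * (f.coeff n * f.coeff n) - g.coeff n * g.coeff n
      = ((c : F) * (f * f).coeff (n + n) - (g * g).coeff (n + n))
        + (((g * g).coeff (n + n) - g.coeff n * g.coeff n)
        - (c : F) * ((f * f).coeff (n + n) - f.coeff n * f.coeff n)) := by ring
    rw [this]
    refine v.map_add_lt h1 (v.map_sub_lt gg ?_)
    rw [v.map_mul, ← e1]
    exact mul_lt_mul_of_le_of_lt_of_nonneg_of_pos le_rfl ff zero_le (zero_lt_iff.2 (v_ne v c))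
  have hgn : v (g.coeff n * g.coeff n) = gv v g * gv v g := by
    rcases max_choice i j with h | h
    · have hf : v ((c : F) * (f.coeff n * f.coeff n)) = gv v g * gv v g := by
        rw [← e1, v.map_mul, v.map_mul, ← hi]; simp only [n, h]
      rw [← hf] at key ⊢
      rw [v.map_sub_swap] at key
      exact v.map_eq_of_sub_lt key
    · rw [v.map_mul, ← hj]; simp only [n, h]
  have hg1 : g.coeff n ≠ 0 := by
    intro h0
    rw [h0] at hgn
    simp at hgn
    exact hgp hgn
  refine ⟨f.coeff n / g.coeff n, ?_⟩
  have : (c : F) * (f.coeff n / g.coeff n) ^ 2 - 1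
    = ((c : F) * (f.coeff n * f.coeff n) - g.coeff n * g.coeff n) / (g.coeff n * g.coeff n) := by
    field_simp
  rw [this, v.map_div, hgn]
  exact (div_lt_one₀ (zero_lt_iff.2 (mul_ne_zero hgp hgp))).2 key

lemma gauss_Triv (a b : Fˣ) (a' b' : Lˣ) (ha : (a' : L) = algebraMap F[X] L (C (a : F)))
    (hb : (b' : L) = algebraMap F[X] L (C (b : F)))
    (h : Triv (gaussL v L) a' b') : Triv v a b := by
  unfold Triv at *
  have oa : ord (gaussL v L) a' = ord v a := by
    simp only [ord]; rw [ha, gaussL_apply, gv_C]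
  have ob : ord (gaussL v L) b' = ord v b := by
    simp only [ord]; rw [hb, gaussL_apply, gv_C]
  rw [oa, ob] at h
  refine gauss_HH v L _ _ ?_ h
  have e : ∀ z : F, algebraMap F[X] L (C z) = ((algebraMap F[X] L).comp C) z := fun _ => rfl
  push_cast
  rw [ha, hb, e, e, e, map_mul, map_zpow₀, map_zpow₀]

end gauss
end AM


namespace AM
open scoped WithZero
open Polynomial

def Split (L : Type) [Field L] (a b : L) : Prop :=
  ∃ x y z : L, (x ≠ 0 ∨ y ≠ 0 ∨ z ≠ 0) ∧ a * x ^ 2 + b * y ^ 2 = z ^ 2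

def Good (L : Type) [Field L] : Prop :=
  ∀ a b : Lˣ, (∀ v : Valuation L ℤᵐ⁰, Triv v a b) → Split L (a : L) (b : L)

section split
variable {L : Type} [Field L]

lemma Split.symm {a b : L} (h : Split L a b) : Split L b a := by
  obtain ⟨x, y, z, h, e⟩ := h
  exact ⟨y, x, z, by tauto, by rw [← e]; ring⟩

lemma Split.mul_sq {a b d : L} (hd : d ≠ 0) (h : Split L a b) : Split L a (b * d ^ 2) := by
  obtain ⟨x, y, z, h, e⟩ := h
  refine ⟨x, y / d, z, ?_, ?_⟩
  · simpa [hd] using h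
  · rw [← e]; field_simp

lemma Split.of_sq {a b : L} (c : L) (h : a = c ^ 2) : Split L a b :=
  ⟨1, 0, c, by simp, by rw [h]; ring⟩

lemma Split.descent {a b b' c : L} (hb' : b' ≠ 0) (h : c ^ 2 - a = b * b') (hs : Split L a b') :
    Split L a b := by
  obtain ⟨x, y, z, hn, e⟩ := hs
  by_cases hy : y = 0
  · refine ⟨x, 0, z, ?_, by rw [← e, hy]; ring⟩
    simpa [hy] using hn
  · refine ⟨c * x + z, b' * y, c * z + a * x, Or.inr (Or.inl (mul_ne_zero hb' hy)), ?_⟩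
    linear_combination (-(b' * y ^ 2)) * h + (c ^ 2 - a) * e
end split

section step
variable {F : Type} [Field F] {L : Type} [Field L] [Algebra F[X] L] [IsFractionRing F[X] L]

/-- residue at a simple prime factor is a square -/
lemma sq_mod_prime (a b : F[X]) (a' b' : Lˣ) (ha : (a' : L) = algebraMap F[X] L a)
    (hb : (b' : L) = algebraMap F[X] L b) (hT : ∀ v : Valuation L ℤᵐ⁰, Triv v a' b')
    (p b1 : F[X]) (hp : Prime p) (hpb : b = p * b1) (hb1 : ¬ p ∣ b1) : ∃ c, p ∣ c ^ 2 - a := by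
  by_cases hpa : p ∣ a
  · exact ⟨0, by simpa using hpa⟩
  let P : IsDedekindDomain.HeightOneSpectrum F[X] :=
    ⟨Ideal.span {p}, (Ideal.span_singleton_prime hp.ne_zero).2 hp, by simpa using hp.ne_zero⟩
  let v : Valuation L ℤᵐ⁰ := P.valuation L
  have hlt : ∀ f : F[X], v (algebraMap F[X] L f) < 1 ↔ p ∣ f := by
    intro f
    rw [IsDedekindDomain.HeightOneSpectrum.valuation_lt_one_iff_mem]
    exact Ideal.mem_span_singleton
  have heq : ∀ f : F[X], ¬ p ∣ f → v (algebraMap F[X] L f) = 1 := by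
    intro f hf
    exact le_antisymm (P.valuation_le_one f) (not_lt.1 (fun h => hf ((hlt f).1 h)))
  have hvp : v (algebraMap F[X] L p) = WithZero.exp (-1 : ℤ) := by
    rw [IsDedekindDomain.HeightOneSpectrum.valuation_of_algebraMap]
    exact P.intValuation_singleton hp.ne_zero rfl
  have ob : ord v b' = -1 := by
    simp only [ord]; rw [hb, hpb, map_mul, map_mul, heq b1 hb1, hvp]; simp
  have oa : ord v a' = 0 := ord_eq_zero v (by rw [ha]; exact heq a hpa)
  have h := hT v
  unfold Triv at h
  rw [oa, ob, zpow_zero, mul_one, zpow_neg_one, Subgroup.inv_mem_iff] at h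
  obtain ⟨d, hd⟩ := h
  have hcd := v_of_one_unit _ hd
  have hd0 : d ≠ 0 := by rintro rfl; simp at hcd
  obtain ⟨f, g, hfg, rfl⟩ := IsFractionRing.exists_reduced_fraction (A := F[X]) d
  set g' : F[X] := (g : F[X]) with hg'
  have hg0 : g' ≠ 0 := nonZeroDivisors.ne_zero g.2
  have hgL : algebraMap F[X] L g' ≠ 0 := by simpa using hg0
  rw [IsFractionRing.mk'_eq_div, ← hg'] at hd hcd hd0
  have e : v (algebraMap F[X] L f) ^ 2 = v (algebraMap F[X] L g') ^ 2 := by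
    rw [map_mul, ha, heq a hpa, one_mul, map_pow, map_div₀] at hcd
    have : v (algebraMap F[X] L g') ≠ 0 := (Valuation.ne_zero_iff v).2 hgL
    field_simp at hcd
    exact hcd
  have hpf : ¬ p ∣ f := by
    intro h
    have : p ∣ g' := by
      rw [← hlt]
      by_contra hh
      have h1 : v (algebraMap F[X] L g') = 1 := le_antisymm (P.valuation_le_one g') (not_lt.1 hh)
      rw [h1, one_pow] at e
      have := (pow_eq_one_iff_of_nonneg zero_le two_ne_zero).1 e
      exact absurd ((hlt f).2 h) (by rw [this]; exact lt_irrefl _)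
    exact hp.not_isUnit (hfg h this)
  -- p ∣ a f^2 - g^2
  have hdiv : p ∣ a * f ^ 2 - g' ^ 2 := by
    rw [← hlt]
    have : algebraMap F[X] L (a * f ^ 2 - g' ^ 2)
      = ((a' : L) * (algebraMap F[X] L f / algebraMap F[X] L g') ^ 2 - 1) *
        algebraMap F[X] L (g' ^ 2) := by
      rw [ha]; simp only [map_sub, map_mul, map_pow]; field_simp
    rw [this, map_mul]
    refine mul_lt_one_of_lt_of_le hd ?_
    exact P.valuation_le_one _
  obtain ⟨s, t, hst⟩ : IsCoprime p f := (hp.irreducible.coprime_iff_not_dvd).2 hpf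
  refine ⟨t * g', ?_⟩
  have : (t * g') ^ 2 - a = - t ^ 2 * (a * f ^ 2 - g' ^ 2) + a * ((t * f) ^ 2 - 1) := by ring
  rw [this]
  apply dvd_add (Dvd.dvd.mul_left hdiv _)
  apply Dvd.dvd.mul_left
  have : (t * f) ^ 2 - 1 = p * (- s * (t * f + 1)) := by
    have : t * f = 1 - s * p := by rw [← hst]; ring
    rw [this]; ring
  rw [this]; exact dvd_mul_right _ _

lemma sq_mod_mul (a p q : F[X]) (h : IsCoprime p q) (hp : ∃ c, p ∣ c ^ 2 - a)
    (hq : ∃ c, q ∣ c ^ 2 - a) : ∃ c, p * q ∣ c ^ 2 - a := by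
  obtain ⟨c, hc⟩ := hp
  obtain ⟨d, hd⟩ := hq
  have h' := h
  obtain ⟨s, t, hst⟩ := h'
  refine ⟨c * (t * q) + d * (s * p), h.mul_dvd ?_ ?_⟩
  · have : (c * (t * q) + d * (s * p)) ^ 2 - a = (c ^ 2 - a)
      + p * (s * (d - c) * (c + (c * (t * q) + d * (s * p)))) := by
      have : t * q = 1 - s * p := by rw [← hst]; ring
      rw [this]; ring
    rw [this]; exact dvd_add hc (dvd_mul_right _ _)
  · have : (c * (t * q) + d * (s * p)) ^ 2 - a = (d ^ 2 - a)
      + q * (t * (c - d) * (d + (c * (t * q) + d * (s * p)))) := by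
      have : s * p = 1 - t * q := by rw [← hst]; ring
      rw [this]; ring
    rw [this]; exact dvd_add hd (dvd_mul_right _ _)

lemma sq_mod (a b : F[X]) (hb0 : b ≠ 0) (hsq : Squarefree b) (h : ∀ p b1, Prime p → b = p * b1 → ¬ p ∣ b1 →
    ∃ c, p ∣ c ^ 2 - a) : ∃ c, b ∣ c ^ 2 - a := by
  have key : ∀ d : F[X], d ≠ 0 → d ∣ b → ∃ c, d ∣ c ^ 2 - a := by
    intro d
    induction d using UniqueFactorizationMonoid.induction_on_prime with
    | h₁ => intro h; exact absurd rfl h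
    | h₂ u hu => intro _ _; exact ⟨0, hu.dvd⟩
    | h₃ d p hd0 hp ih =>
      intro _ hdb
      have hcop : ∀ e, p * e ∣ b → ¬ p ∣ e := by
        intro e he hpe
        exact hp.not_isUnit (hsq p ((mul_dvd_mul_left p hpe).trans he))
      refine sq_mod_mul a p d ((hp.irreducible.coprime_iff_not_dvd).2 (hcop d hdb)) ?_
        (ih hd0 ((dvd_mul_left _ _).trans hdb))
      obtain ⟨b1, hb1⟩ := (dvd_mul_right p d).trans hdb
      exact h p b1 hp hb1 (hcop b1 (by rw [hb1]))
  exact key b hb0 dvd_rfl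

lemma good_inner (i : F) (hi : i ^ 2 = -1) (hF : Good F) (n : ℕ) :
    ∀ (a b : F[X]) (a' b' : Lˣ), (a' : L) = algebraMap F[X] L a → (b' : L) = algebraMap F[X] L b →
      a.natDegree + b.natDegree < n → (∀ v : Valuation L ℤᵐ⁰, Triv v a' b') →
      Split L (a' : L) (b' : L) := by
  induction n with
  | zero => intro a b a' b' _ _ h; omega
  | succ n ih =>
    have main : ∀ (a b : F[X]) (a' b' : Lˣ), (a' : L) = algebraMap F[X] L a →
      (b' : L) = algebraMap F[X] L b →
      a.natDegree + b.natDegree < n + 1 → (∀ v : Valuation L ℤᵐ⁰, Triv v a' b') →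
      a.natDegree ≤ b.natDegree → Split L (a' : L) (b' : L) := by
      intro a b a' b' ha hb hdeg hT hle
      have ha0 : a ≠ 0 := by rintro rfl; simp at ha
      have hb0 : b ≠ 0 := by rintro rfl; simp at hb
      by_cases hdb : b.natDegree = 0
      · have hda : a.natDegree = 0 := by omega
        obtain ⟨α, rfl⟩ := natDegree_eq_zero.1 hda
        obtain ⟨β, rfl⟩ := natDegree_eq_zero.1 hdb
        have hα : α ≠ 0 := by rintro rfl; simp at ha0
        have hβ : β ≠ 0 := by rintro rfl; simp at hb0
        obtain ⟨x, y, z, hn, e⟩ := hF (Units.mk0 α hα) (Units.mk0 β hβ)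
          (fun v => gauss_Triv v L _ _ a' b' ha hb (hT _))
        let φ := (algebraMap F[X] L).comp C
        refine ⟨φ x, φ y, φ z, ?_, ?_⟩
        · simpa only [ne_eq, map_eq_zero] using hn
        · rw [ha, hb]
          have := congrArg φ e
          simpa [φ] using this
      by_cases hsq : Squarefree b
      · obtain ⟨c, hc⟩ := sq_mod a b hb0 hsq (fun p b1 hp h1 h2 =>
          sq_mod_prime a b a' b' ha hb hT p b1 hp h1 h2)
        -- reduce c mod b
        have hc' : b ∣ (c % b) ^ 2 - a := by
          have : (c % b) ^ 2 - a = (c ^ 2 - a) - b * ((c / b) * (c + c % b)) := by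
            have := EuclideanDomain.div_add_mod c b
            have h2 : c % b = c - b * (c / b) := by linear_combination this
            rw [h2]; ring
          rw [this]; exact dvd_sub hc (dvd_mul_right _ _)
        obtain ⟨b1, hb1⟩ := hc'
        have hcdeg : (c % b).natDegree < b.natDegree := natDegree_mod_lt c hdb
        set c1 := c % b
        by_cases hb10 : b1 = 0
        · apply Split.of_sq (algebraMap F[X] L c1)
          rw [ha, ← map_pow]
          congr 1
          rw [hb10, mul_zero] at hb1
          exact (sub_eq_zero.1 hb1).symm
        have hb1L : algebraMap F[X] L b1 ≠ 0 := by simpa using hb10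
        have hd1 : b1.natDegree < b.natDegree := by
          have h1 : (b * b1).natDegree = b.natDegree + b1.natDegree := natDegree_mul hb0 hb10
          rw [← hb1] at h1
          have h2 := natDegree_sub_le (c1 ^ 2) a
          rw [natDegree_pow] at h2
          have : max (2 * c1.natDegree) a.natDegree < 2 * b.natDegree := by
            apply max_lt <;> omega
          omega
        have hL : (algebraMap F[X] L c1) ^ 2 - a' = b' * (Units.mk0 _ hb1L : Lˣ) := by
          rw [ha, hb, Units.val_mk0, ← map_mul, ← hb1]; simp
        refine Split.descent (c := algebraMap F[X] L c1) hb1L hL ?_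
        refine ih a b1 a' (Units.mk0 _ hb1L) ha rfl (by omega) ?_
        intro v
        have hiL : (algebraMap F[X] L (C i)) ^ 2 = -1 := by
          rw [← map_pow, ← C_pow, hi]; simp
        refine Triv.of_mul (hT v) (triv_norm v _ hiL a' _ (algebraMap F[X] L c1) 1 ?_)
        push_cast
        rw [← hL]; ring
      · rw [Squarefree] at hsq
        push Not at hsq
        obtain ⟨d, ⟨b1, hb1⟩, hd⟩ := hsq
        have hd0 : d ≠ 0 := by rintro rfl; simp at hb1; exact hb0 hb1
        have hb10 : b1 ≠ 0 := by rintro rfl; simp at hb1; exact hb0 hb1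
        have hb1L : algebraMap F[X] L b1 ≠ 0 := by simpa using hb10
        have hdL : algebraMap F[X] L d ≠ 0 := by simpa using hd0
        have hdd : 0 < d.natDegree := by
          rw [Nat.pos_iff_ne_zero]; intro h0
          obtain ⟨δ, rfl⟩ := natDegree_eq_zero.1 h0
          apply hd
          rw [isUnit_C]
          exact isUnit_iff_ne_zero.2 (by rintro rfl; simp at hd0)
        have hdeg' : b.natDegree = d.natDegree + d.natDegree + b1.natDegree := by
          rw [hb1, natDegree_mul (mul_ne_zero hd0 hd0) hb10, natDegree_mul hd0 hd0]
        have e : b' = (Units.mk0 _ hdL) ^ 2 * (Units.mk0 _ hb1L) := by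
          ext; push_cast; simp only [Units.val_mk0]; rw [hb, hb1]; simp only [map_mul]; ring
        have := ih a b1 a' (Units.mk0 _ hb1L) ha rfl (by omega) (fun v => by
          have := hT v
          rw [e] at this
          exact Triv.of_mul (triv_sq v _ _) this)
        have := this.mul_sq hdL
        convert this using 1
        rw [e]; push_cast; simp only [Units.val_mk0]; ring
    intro a b a' b' ha hb hdeg hT
    rcases le_total a.natDegree b.natDegree with h | h
    · exact main a b a' b' ha hb hdeg hT h
    · exact (main b a b' a' hb ha (by omega) (fun v => (hT v).symm) h).symm

theorem good_step (i : F) (hi : i ^ 2 = -1) (hF : Good F) : Good L := by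
  have clear : ∀ a : Lˣ, ∃ (f : F[X]) (f' d : Lˣ), (f' : L) = algebraMap F[X] L f ∧ a = f' * d ^ 2 := by
    intro a
    obtain ⟨f, g, hg, h⟩ := IsFractionRing.div_surjective (A := F[X]) (a : L)
    have hgL : algebraMap F[X] L g ≠ 0 := by simpa using nonZeroDivisors.ne_zero hg
    refine ⟨f * g, a * (Units.mk0 _ hgL) ^ 2, (Units.mk0 _ hgL)⁻¹, ?_, ?_⟩
    · rw [map_mul]; push_cast; rw [← h, Units.val_mk0]; field_simp
    · rw [mul_assoc, ← mul_pow]; simp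
  intro a b hT
  obtain ⟨f, f', d, hf, rfl⟩ := clear a
  obtain ⟨g, g', e, hg, rfl⟩ := clear b
  have := good_inner i hi hF _ f g f' g' hf hg (Nat.lt_succ_self _) (fun v => by
    have h1 := hT v
    rw [mul_comm g'] at h1
    have h2 := (Triv.of_mul (triv_sq v _ _) h1).symm
    rw [mul_comm f'] at h2
    exact (Triv.of_mul (triv_sq v _ _) h2).symm)
  have := ((this.mul_sq e.ne_zero).symm.mul_sq d.ne_zero).symm
  simpa using this

end step

lemma Split.map {L L' : Type} [Field L] [Field L'] (φ : L →+* L') {a b : L} (h : Split L a b) :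
    Split L' (φ a) (φ b) := by
  obtain ⟨x, y, z, hn, e⟩ := h
  refine ⟨φ x, φ y, φ z, by simpa only [ne_eq, map_eq_zero] using hn, ?_⟩
  rw [← map_pow, ← map_pow, ← map_pow, ← map_mul, ← map_mul, ← map_add, e]

/-- anisotropy goes up to rational function fields -/
lemma split_down {F : Type} [Field F] {L : Type} [Field L] [Algebra F[X] L] [IsFractionRing F[X] L]
    (a b : F) (h : Split L (algebraMap F[X] L (C a)) (algebraMap F[X] L (C b))) : Split F a b := by
  obtain ⟨x, y, z, hn, e⟩ := h
  obtain ⟨f1, g1, hg1, rfl⟩ := IsFractionRing.div_surjective (A := F[X]) x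
  obtain ⟨f2, g2, hg2, rfl⟩ := IsFractionRing.div_surjective (A := F[X]) y
  obtain ⟨f3, g3, hg3, rfl⟩ := IsFractionRing.div_surjective (A := F[X]) z
  have h1 : g1 ≠ 0 := nonZeroDivisors.ne_zero hg1
  have h2 : g2 ≠ 0 := nonZeroDivisors.ne_zero hg2
  have h3 : g3 ≠ 0 := nonZeroDivisors.ne_zero hg3
  have h1' : algebraMap F[X] L g1 ≠ 0 := by simpa using h1
  have h2' : algebraMap F[X] L g2 ≠ 0 := by simpa using h2
  have h3' : algebraMap F[X] L g3 ≠ 0 := by simpa using h3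
  have e' : C a * (f1 * g2 * g3) ^ 2 + C b * (f2 * g1 * g3) ^ 2 = (f3 * g1 * g2) ^ 2 := by
    apply IsFractionRing.injective F[X] L
    simp only [map_add, map_mul, map_pow]
    field_simp at e
    linear_combination e
  have hn' : f1 * g2 * g3 ≠ 0 ∨ f2 * g1 * g3 ≠ 0 ∨ f3 * g1 * g2 ≠ 0 := by
    simpa [h1, h2, h3] using hn
  generalize f1 * g2 * g3 = p at *
  generalize f2 * g1 * g3 = q at *
  generalize f3 * g1 * g2 = r at *
  let n := max p.natDegree (max q.natDegree r.natDegree)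
  have hp : p.natDegree ≤ n := le_max_left _ _
  have hq : q.natDegree ≤ n := (le_max_left _ _).trans (le_max_right _ _)
  have hr : r.natDegree ≤ n := (le_max_right _ _).trans (le_max_right _ _)
  refine ⟨p.coeff n, q.coeff n, r.coeff n, ?_, ?_⟩
  · by_contra hcon
    push Not at hcon
    obtain ⟨c1, c2, c3⟩ := hcon
    have aux : ∀ s : F[X], s.coeff n = 0 → s.natDegree = n → s = 0 := by
      intro s hs hd
      rw [← hd] at hs
      exact leadingCoeff_eq_zero.1 hs
    have hn0 : n = 0 := by
      by_contra hnn
      have : p.natDegree = n ∨ q.natDegree = n ∨ r.natDegree = n := by omega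
      rcases this with h | h | h
      · have h0 := aux p c1 h
        rw [h0] at h; simp at h; omega
      · have h0 := aux q c2 h
        rw [h0] at h; simp at h; omega
      · have h0 := aux r c3 h
        rw [h0] at h; simp at h; omega
    have z1 := aux p c1 (by omega)
    have z2 := aux q c2 (by omega)
    have z3 := aux r c3 (by omega)
    tauto
  · have := congrArg (fun s : F[X] => s.coeff (2 * n)) e'
    simp only [coeff_add, coeff_C_mul] at this
    rwa [coeff_pow_of_natDegree_le hp, coeff_pow_of_natDegree_le hq,
      coeff_pow_of_natDegree_le hr] at this
end AM


namespace AM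
open scoped WithZero
open Polynomial

abbrev RK (K : Type) [Field K] (n : ℕ) : Type := FractionRing (MvPolynomial (Fin n) K)

lemma frac_equiv {A L : Type} [CommRing A] [IsDomain A] [Field L] (ψ : A →+* L)
    (hψ : Function.Injective ψ) (hs : ∀ z : L, ∃ x y, z = ψ x / ψ y) :
    ∃ e : FractionRing A ≃+* L, ∀ a, e (algebraMap A _ a) = ψ a := by
  let _ : Algebra A L := ψ.toAlgebra
  have : FaithfulSMul A L := (faithfulSMul_iff_algebraMap_injective _ _).2 hψ
  have : IsFractionRing A L := IsFractionRing.of_field _ _ hs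
  exact ⟨(FractionRing.algEquiv A L).toRingEquiv, fun a => (FractionRing.algEquiv A L).commutes a⟩

lemma tower (K : Type) [Field K] (n : ℕ) :
    ∃ e : RK K (n + 1) ≃+* FractionRing (RK K n)[X],
      ∀ c : K, e (algebraMap K _ c) = algebraMap (RK K n)[X] _ (Polynomial.C (algebraMap K (RK K n) c)) := by
  let φ : MvPolynomial (Fin (n + 1)) K →+* (RK K n)[X] :=
    (mapRingHom (algebraMap (MvPolynomial (Fin n) K) (RK K n))).comp
      ((MvPolynomial.finSuccEquiv K n).toRingEquiv.toRingHom)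
  let ψ : MvPolynomial (Fin (n + 1)) K →+* FractionRing (RK K n)[X] :=
    (algebraMap (RK K n)[X] (FractionRing (RK K n)[X])).comp φ
  have hψφ : ∀ z, ψ z = algebraMap (RK K n)[X] (FractionRing (RK K n)[X]) (φ z) := fun z => rfl
  have hφ : Function.Injective φ := by
    intro a b hab
    exact Function.Injective.comp (Polynomial.map_injective (algebraMap (MvPolynomial (Fin n) K) (RK K n)) (IsFractionRing.injective _ _))
      (MvPolynomial.finSuccEquiv K n).injective hab
  have hψ : Function.Injective ψ :=
    (IsFractionRing.injective (RK K n)[X] _).comp hφ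
  have hF : ∀ f : (RK K n)[X], ∃ P Q : MvPolynomial (Fin (n + 1)) K,
      Q ≠ 0 ∧ φ P = φ Q * f := by
    intro f
    obtain ⟨q, hq, h⟩ := IsLocalization.integerNormalization_spec (nonZeroDivisors (MvPolynomial (Fin n) K)) f
    refine ⟨(MvPolynomial.finSuccEquiv K n).symm (IsLocalization.integerNormalization (nonZeroDivisors (MvPolynomial (Fin n) K)) f), (MvPolynomial.finSuccEquiv K n).symm (Polynomial.C q), ?_, ?_⟩
    · have := nonZeroDivisors.ne_zero hq
      simpa using this
    · change Polynomial.map _ (MvPolynomial.finSuccEquiv K n _) = Polynomial.map _ (MvPolynomial.finSuccEquiv K n _) * _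
      rw [AlgEquiv.apply_symm_apply, AlgEquiv.apply_symm_apply, h, Polynomial.map_C, ← Polynomial.smul_eq_C_mul, algebraMap_smul]
  obtain ⟨e, he⟩ := frac_equiv ψ hψ (by
    intro z
    obtain ⟨f, g, hg, rfl⟩ := IsFractionRing.div_surjective (A := (RK K n)[X]) z
    obtain ⟨P, Q, hQ, h⟩ := hF f
    obtain ⟨P', Q', hQ', h'⟩ := hF g
    have hg0 := nonZeroDivisors.ne_zero hg
    have hP' : P' ≠ 0 := by
      rintro rfl
      rw [map_zero] at h'
      rcases mul_eq_zero.1 h'.symm with h | h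
      · exact hQ' ((map_eq_zero_iff φ hφ).1 h)
      · exact hg0 h
    refine ⟨P * Q', Q * P', ?_⟩
    have i := IsFractionRing.injective (RK K n)[X] (FractionRing (RK K n)[X])
    rw [div_eq_div_iff]
    · rw [hψφ, hψφ, ← map_mul, ← map_mul, map_mul φ, map_mul φ, h, h']
      congr 1; ring
    · exact fun h => hg0 ((map_eq_zero_iff _ i).1 h)
    · exact fun h => (mul_ne_zero hQ hP') ((map_eq_zero_iff ψ hψ).1 h))
  refine ⟨e, ?_⟩
  intro c
  rw [IsScalarTower.algebraMap_apply K (MvPolynomial (Fin (n + 1)) K), he, hψφ]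
  congr 1
  change Polynomial.map _ (MvPolynomial.finSuccEquiv K n (MvPolynomial.C c)) = _
  rw [MvPolynomial.finSuccEquiv_apply, MvPolynomial.eval₂Hom_C]
  simp [IsScalarTower.algebraMap_apply K (MvPolynomial (Fin n) K) (RK K n)]

lemma tower' (K : Type) [Field K] (n : ℕ) :
    ∃ (i : Algebra (RK K n)[X] (RK K (n + 1))), IsFractionRing (RK K n)[X] (RK K (n + 1)) ∧
      ∀ c : K, algebraMap (RK K n)[X] (RK K (n + 1)) (Polynomial.C (algebraMap K (RK K n) c)) =
        algebraMap K _ c := by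
  obtain ⟨e, he⟩ := tower K n
  letI i : Algebra (RK K n)[X] (RK K (n + 1)) :=
    (e.symm.toRingHom.comp (algebraMap (RK K n)[X] (FractionRing (RK K n)[X]))).toAlgebra
  refine ⟨i, ?_, ?_⟩
  · let e' : FractionRing (RK K n)[X] ≃ₐ[(RK K n)[X]] RK K (n + 1) :=
      { e.symm with commutes' := fun r => rfl }
    exact IsLocalization.isLocalization_of_algEquiv _ e'
  · intro c
    change e.symm _ = _
    rw [← he, RingEquiv.symm_apply_apply]

lemma fr_zero_surj (K : Type) [Field K] : Function.Surjective (algebraMap K (RK K 0)) := by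
  intro z
  obtain ⟨f, g, hg, rfl⟩ := IsFractionRing.div_surjective (A := MvPolynomial (Fin 0) K) z
  obtain ⟨f, rfl⟩ := (MvPolynomial.isEmptyAlgEquiv K (Fin 0)).symm.surjective f
  obtain ⟨g, rfl⟩ := (MvPolynomial.isEmptyAlgEquiv K (Fin 0)).symm.surjective g
  refine ⟨f / g, ?_⟩
  rw [map_div₀]
  simp only [IsScalarTower.algebraMap_apply K (MvPolynomial (Fin 0) K) (RK K 0)]
  rfl

theorem good_C (m : ℕ) : Good (RK ℂ m) := by
  induction m with
  | zero =>
    intro a b _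
    obtain ⟨c, hc⟩ := fr_zero_surj ℂ a
    obtain ⟨d, hd⟩ := IsAlgClosed.exists_pow_nat_eq c (n := 2) (by norm_num)
    exact Split.of_sq (algebraMap ℂ _ d) (by rw [← hc, ← hd, map_pow])
  | succ n ih =>
    obtain ⟨i, h, _⟩ := tower' ℂ n
    exact good_step (F := RK ℂ n) (algebraMap ℂ _ Complex.I) (by rw [← map_pow]; simp) ih

theorem split_RK (K : Type) [Field K] (a b : K) (n : ℕ)
    (h : Split (RK K n) (algebraMap K _ a) (algebraMap K _ b)) : Split K a b := by
  induction n with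
  | zero =>
    let e : K ≃+* RK K 0 := RingEquiv.ofBijective (algebraMap K (RK K 0))
      ⟨(algebraMap K (RK K 0)).injective, fr_zero_surj K⟩
    have := h.map e.symm.toRingHom
    have h1 : ∀ x, e.symm.toRingHom (algebraMap K _ x) = x := fun x => e.symm_apply_apply x
    rwa [h1, h1] at this
  | succ n ih =>
    obtain ⟨i, hi, hc⟩ := tower' K n
    apply ih
    rw [← hc, ← hc] at h
    exact split_down _ _ h
end AM


namespace AM
open Polynomial

section til
variable {E : Type} [Field E] (τ : E →+* E) (c : E)

noncomputable def til (P : E[X]) : E[X] := reverse ((P.map τ).comp (Polynomial.C c * Polynomial.X))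

variable {c}

lemma til_deg0 (hc : c ≠ 0) (P : E[X]) :
    ((P.map τ).comp (Polynomial.C c * Polynomial.X)).natDegree = P.natDegree := by
  rw [natDegree_comp, natDegree_C_mul_X _ hc, mul_one, natDegree_map]

lemma til_coeff0 (hc : c ≠ 0) (P : E[X]) :
    (til τ c P).coeff 0 = τ P.leadingCoeff * c ^ P.natDegree := by
  rw [til, coeff_zero_reverse, leadingCoeff, til_deg0 τ hc, comp_C_mul_X_coeff, coeff_map, leadingCoeff]

lemma til_ne (hc : c ≠ 0) (P : E[X]) (hP : P ≠ 0) : til τ c P ≠ 0 := by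
  intro h
  have := til_coeff0 τ hc P
  rw [h, coeff_zero] at this
  exact (mul_ne_zero ((map_ne_zero τ).2 (leadingCoeff_ne_zero.2 hP)) (pow_ne_zero _ hc)) this.symm

lemma til_natDegree (hc : c ≠ 0) (P : E[X]) (hP : P.coeff 0 ≠ 0) :
    (til τ c P).natDegree = P.natDegree := by
  rw [til, reverse_natDegree, til_deg0 τ hc, natTrailingDegree_eq_zero.2 (Or.inr ?_), Nat.sub_zero]
  rw [comp_C_mul_X_coeff, coeff_map]
  simpa using hP

lemma til_lead (P : E[X]) (hP : P.coeff 0 ≠ 0) :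
    (til τ c P).leadingCoeff = τ (P.coeff 0) := by
  rw [til, reverse_leadingCoeff, trailingCoeff_eq_coeff_zero] <;>
  · rw [comp_C_mul_X_coeff, coeff_map]
    simp [hP]

variable {M : Type} [Field M] [Algebra E[X] M]

lemma til_eval (hc : c ≠ 0) (P : E[X]) (hT : algebraMap E[X] M X ≠ 0) :
    eval₂ ((algebraMap E[X] M).comp (Polynomial.C.comp τ))
      (algebraMap E[X] M (Polynomial.C c) * (algebraMap E[X] M X)⁻¹) P * (algebraMap E[X] M X) ^ P.natDegree
    = algebraMap E[X] M (til τ c P) := by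
  set T := algebraMap E[X] M X with hTd
  let _ : Invertible (T⁻¹) := ⟨T, mul_inv_cancel₀ hT, inv_mul_cancel₀ hT⟩
  have h := eval₂_reverse_mul_pow ((algebraMap E[X] M).comp Polynomial.C) (T⁻¹)
    ((P.map τ).comp (Polynomial.C c * Polynomial.X))
  rw [til_deg0 τ hc] at h
  have h1 : eval₂ ((algebraMap E[X] M).comp Polynomial.C) (⅟(T⁻¹)) (til τ c P) = algebraMap E[X] M (til τ c P) := by
    change eval₂ ((algebraMap E[X] M).comp Polynomial.C) T (til τ c P) = _
    rw [hTd, ← hom_eval₂, eval₂_C_X]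
  change eval₂ _ _ (til τ c P) * _ = _ at h
  rw [h1, eval₂_comp, eval₂_map] at h
  simp only [eval₂_mul, eval₂_C, eval₂_X] at h
  have h2 : eval₂ ((algebraMap E[X] M).comp (Polynomial.C.comp τ)) (algebraMap E[X] M (Polynomial.C c) * T⁻¹) P = algebraMap E[X] M (til τ c P) * T⁻¹ ^ P.natDegree := h.symm
  rw [h2, mul_assoc, ← mul_pow, inv_mul_cancel₀ hT, one_pow, mul_one]

lemma norm_lemma [IsFractionRing E[X] M] (hc : c ≠ 0) (hτ : ∀ a, τ (τ a) = a) (σ : M →+* M)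
    (hσC : ∀ a, σ (algebraMap E[X] M (Polynomial.C a)) = algebraMap E[X] M (Polynomial.C (τ a)))
    (hσT : σ (algebraMap E[X] M X) = algebraMap E[X] M (Polynomial.C c) * (algebraMap E[X] M X)⁻¹)
    (b : E) (hb : b ≠ 0) (h : M) (hh : h * σ h = algebraMap E[X] M (Polynomial.C b)) :
    ∃ (m p q : ℕ) (ε : E), ε ≠ 0 ∧ c ^ (m + p) = b * c ^ q * (ε * τ ε) := by
  have inj := IsFractionRing.injective E[X] M
  have hT : algebraMap E[X] M X ≠ 0 := (map_ne_zero_iff _ inj).2 X_ne_zero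
  have hσ : ∀ P, σ (algebraMap E[X] M P) * (algebraMap E[X] M X) ^ P.natDegree =
      algebraMap E[X] M (til τ c P) := by
    intro P
    rw [← til_eval τ hc P hT]
    congr 1
    have : σ.comp (algebraMap E[X] M) = eval₂RingHom ((algebraMap E[X] M).comp (Polynomial.C.comp τ))
      (algebraMap E[X] M (Polynomial.C c) * (algebraMap E[X] M X)⁻¹) := by
      apply Polynomial.ringHom_ext
      · intro a; simpa using hσC a
      · simpa using hσT
    exact congrArg (fun f => f P) this
  have hh0 : h ≠ 0 := by
    rintro rfl
    rw [zero_mul] at hh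
    exact hb (C_eq_zero.1 ((map_eq_zero_iff _ inj).1 hh.symm))
  obtain ⟨f, ⟨g, hg⟩, hfg, hmk⟩ := IsFractionRing.exists_reduced_fraction E[X] h
  rw [IsFractionRing.mk'_eq_div] at hmk
  replace hg := nonZeroDivisors.ne_zero hg
  simp only at hfg hmk
  have hf : f ≠ 0 := by
    rintro rfl
    rw [map_zero, zero_div] at hmk
    exact hh0 hmk.symm
  obtain ⟨P, hP, hXP⟩ := exists_eq_pow_rootMultiplicity_mul_and_not_dvd f hf 0
  obtain ⟨Q, hQ, hXQ⟩ := exists_eq_pow_rootMultiplicity_mul_and_not_dvd g hg 0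
  rw [Polynomial.C_0, sub_zero] at hP hQ hXP hXQ
  rw [X_dvd_iff] at hXP hXQ
  set p := f.rootMultiplicity 0
  set q := g.rootMultiplicity 0
  clear_value p q
  have hP0 : P ≠ 0 := by rintro rfl; simp at hXP
  have hQ0 : Q ≠ 0 := by rintro rfl; simp at hXQ
  have hPQ : IsCoprime P Q := by
    rw [hP, hQ] at hfg
    exact hfg.of_mul_left_right.of_mul_right_right.isCoprime
  set A := algebraMap E[X] M with hA
  have hσP := hσ P
  have hσQ := hσ Q
  have hAg : A g ≠ 0 := (map_ne_zero_iff _ inj).2 hg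
  have hσg : σ (A g) ≠ 0 := (map_ne_zero σ).2 hAg
  have e1 : A f * σ (A f) = A (Polynomial.C b) * (A g * σ (A g)) := by
    rw [← hh, ← hmk, map_div₀]; field_simp
  have e2 : A (Polynomial.C c) ^ p * A P * A (til τ c P) * A X ^ Q.natDegree =
      A (Polynomial.C b) * A (Polynomial.C c) ^ q * A Q * A (til τ c Q) * A X ^ P.natDegree := by
    have k : ∀ n : ℕ, A X ^ n * (A (Polynomial.C c) * (A X)⁻¹) ^ n = A (Polynomial.C c) ^ n := by
      intro n; rw [← mul_pow]; congr 1; field_simp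
    rw [hP, hQ] at e1
    simp only [map_mul, map_pow, hσT] at e1
    rw [← hσP, ← hσQ, ← k p, ← k q]
    linear_combination (A X ^ P.natDegree * A X ^ Q.natDegree) * e1
  have e3 : Polynomial.C (c ^ p) * P * til τ c P * X ^ Q.natDegree =
      Polynomial.C (b * c ^ q) * Q * til τ c Q * X ^ P.natDegree := by
    apply inj
    simpa [hA] using e2
  have hcp : c ^ p ≠ 0 := pow_ne_zero _ hc
  have hbc : b * c ^ q ≠ 0 := mul_ne_zero hb (pow_ne_zero _ hc)
  have tP := til_ne τ hc P hP0
  have tQ := til_ne τ hc Q hQ0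
  have dP := til_natDegree τ hc P hXP
  have dQ := til_natDegree τ hc Q hXQ
  have hdeg : P.natDegree = Q.natDegree := by
    have := congrArg natDegree e3
    rw [natDegree_mul_X_pow, natDegree_mul_X_pow, mul_assoc, mul_assoc, natDegree_C_mul hcp,
      natDegree_C_mul hbc, natDegree_mul hP0 tP, natDegree_mul hQ0 tQ, dP, dQ] at this
    · omega
    · simp only [ne_eq, mul_eq_zero, not_or, C_eq_zero]; exact ⟨⟨not_or.1 (fun h => hbc (mul_eq_zero.2 h)), hQ0⟩, tQ⟩
    · simp only [ne_eq, mul_eq_zero, not_or, C_eq_zero]; exact ⟨⟨hcp, hP0⟩, tP⟩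
  rw [hdeg] at e3
  have e4 := mul_right_cancel₀ (pow_ne_zero _ X_ne_zero) e3
  have hdvd : P ∣ til τ c Q := by
    have h1 : P ∣ Q * til τ c Q := by
      have : P ∣ Polynomial.C (b * c ^ q) * (Q * til τ c Q) := ⟨Polynomial.C (c ^ p) * til τ c P, by rw [← mul_assoc, ← e4]; ring⟩
      exact ((isUnit_C.2 hbc.isUnit).dvd_mul_left).1 this
    exact hPQ.dvd_of_dvd_mul_left h1
  obtain ⟨R, hR⟩ := hdvd
  have hR0 : R ≠ 0 := by rintro rfl; rw [mul_zero] at hR; exact tQ hR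
  have hRd : R.natDegree = 0 := by
    have := congrArg natDegree hR
    rw [natDegree_mul hP0 hR0, dQ] at this
    omega
  obtain ⟨ε, rfl⟩ := natDegree_eq_zero.1 hRd
  have hε : ε ≠ 0 := by rintro rfl; simp at hR0
  have l1 : τ (Q.coeff 0) = P.leadingCoeff * ε := by
    rw [← til_lead (c := c) τ Q hXQ, hR, leadingCoeff_mul, leadingCoeff_C]
  have e5 : Polynomial.C (c ^ p) * til τ c P = Polynomial.C (b * c ^ q * ε) * Q := by
    apply mul_left_cancel₀ hP0
    rw [hR] at e4
    rw [Polynomial.C_mul (a := b * c ^ q)]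
    linear_combination e4
  have l2 := congrArg (fun f => coeff f 0) e5
  simp only [coeff_C_mul, til_coeff0 τ hc] at l2
  have l3 : Q.coeff 0 = τ P.leadingCoeff * τ ε := by
    rw [← hτ (Q.coeff 0), l1, map_mul]
  rw [l3] at l2
  refine ⟨P.natDegree, p, q, ε, hε, ?_⟩
  have : τ P.leadingCoeff ≠ 0 := (map_ne_zero τ).2 (leadingCoeff_ne_zero.2 hP0)
  apply mul_left_cancel₀ this
  rw [pow_add]
  linear_combination l2

lemma norm_lemma2 [IsFractionRing E[X] M] (g1 g2 : E) (h1 : g1 ≠ 0) (h2 : g2 ≠ 0) (hcg : c = g1 * g2)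
    (hg1 : τ g1 = g1) (hg2 : τ g2 = g2) (hτ : ∀ a, τ (τ a) = a) (σ : M →+* M)
    (hσC : ∀ a, σ (algebraMap E[X] M (Polynomial.C a)) = algebraMap E[X] M (Polynomial.C (τ a)))
    (hσT : σ (algebraMap E[X] M X) = algebraMap E[X] M (Polynomial.C c) * (algebraMap E[X] M X)⁻¹)
    (h : M) (hh : h * σ h = algebraMap E[X] M (Polynomial.C g1)) :
    ∃ ε : E, ε * τ ε = g1 ∨ ε * τ ε = g2 := by
  have hc : c ≠ 0 := by rw [hcg]; exact mul_ne_zero h1 h2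
  obtain ⟨m, p, q, ε, hε, e⟩ := norm_lemma τ hc hτ σ hσC hσT g1 h1 h hh
  have hτε : τ ε ≠ 0 := (map_ne_zero τ).2 hε
  have hτc : τ c = c := by rw [hcg, map_mul, hg1, hg2]
  rcases Nat.even_or_odd' (m + p) with ⟨a, ha | ha⟩ <;> rcases Nat.even_or_odd' q with ⟨d, hd | hd⟩ <;>
    rw [ha, hd] at e
  · refine ⟨c ^ a / (c ^ d * ε), Or.inl ?_⟩
    simp only [map_div₀, map_mul, map_pow, hτc]
    field_simp
    linear_combination e
  · refine ⟨c ^ a / (c ^ d * ε * g1), Or.inr ?_⟩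
    simp only [map_div₀, map_mul, map_pow, hτc, hg1]
    field_simp
    rw [pow_succ] at e
    linear_combination e + g1 * c ^ (2 * d) * ε * τ ε * hcg
  · refine ⟨c ^ d * ε / c ^ a, Or.inr ?_⟩
    simp only [map_div₀, map_mul, map_pow, hτc, hg1]
    field_simp
    rw [pow_succ, hcg] at e
    rw [hcg]
    apply mul_left_cancel₀ h1
    linear_combination - e
  · refine ⟨c ^ a / (c ^ d * ε), Or.inl ?_⟩
    simp only [map_div₀, map_mul, map_pow, hτc]
    field_simp
    apply mul_left_cancel₀ hc
    linear_combination e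
end til

lemma not_norm {k E : Type} [Field k] [Field E] [Algebra k[X] E] [IsFractionRing k[X] E]
    (τ0 : k →+* k) (τ : E →+* E) (hτC : ∀ a, τ (algebraMap k[X] E (Polynomial.C a)) =
      algebraMap k[X] E (Polynomial.C (τ0 a))) (hτX : τ (algebraMap k[X] E X) = algebraMap k[X] E X)
    (r : k) (hr : τ0 r = r) (P R : k[X]) (hPR : P = (X - Polynomial.C r) * R) (hR : R.eval r ≠ 0)
    (ε : E) (h : ε * τ ε = algebraMap k[X] E P) : False := by
  have inj := IsFractionRing.injective k[X] E
  have hR0 : R ≠ 0 := by rintro rfl; simp at hR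
  have hP0 : P ≠ 0 := by rw [hPR]; exact mul_ne_zero (X_sub_C_ne_zero r) hR0
  have hτ : ∀ f, τ (algebraMap k[X] E f) = algebraMap k[X] E (f.map τ0) := by
    intro f
    have : τ.comp (algebraMap k[X] E) = (algebraMap k[X] E).comp (mapRingHom τ0) := by
      apply Polynomial.ringHom_ext
      · intro a; simpa using hτC a
      · simpa using hτX
    exact congrArg (fun g => g f) this
  obtain ⟨f, g, hg, rfl⟩ := IsFractionRing.div_surjective (A := k[X]) ε
  replace hg := nonZeroDivisors.ne_zero hg
  have hAg : algebraMap k[X] E g ≠ 0 := (map_ne_zero_iff _ inj).2 hg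
  have hAg' : τ (algebraMap k[X] E g) ≠ 0 := (map_ne_zero τ).2 hAg
  rw [map_div₀] at h
  have e : f * f.map τ0 = P * (g * g.map τ0) := by
    apply inj
    rw [map_mul, map_mul, map_mul, ← hτ, ← hτ, ← h]
    field_simp
  have hg' : g.map τ0 ≠ 0 := (Polynomial.map_ne_zero_iff τ0.injective).2 hg
  have hf : f ≠ 0 := by
    rintro rfl
    rw [zero_mul] at e
    exact mul_ne_zero hP0 (mul_ne_zero hg hg') e.symm
  have hf' : f.map τ0 ≠ 0 := (Polynomial.map_ne_zero_iff τ0.injective).2 hf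
  have key : ∀ f : k[X], (f.map τ0).rootMultiplicity r = f.rootMultiplicity r := by
    intro f
    have := eq_rootMultiplicity_map (p := f) τ0.injective r
    rw [hr] at this
    exact this.symm
  have e2 := congrArg (rootMultiplicity r) e
  rw [rootMultiplicity_mul (mul_ne_zero hf hf'), key,
    rootMultiplicity_mul (mul_ne_zero hP0 (mul_ne_zero hg hg')),
    rootMultiplicity_mul (mul_ne_zero hg hg'), key, hPR,
    rootMultiplicity_mul (by rw [← hPR]; exact hP0), rootMultiplicity_X_sub_C_self,
    rootMultiplicity_eq_zero (p := R) (x := r) hR] at e2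
  omega
end AM


namespace AM
open Polynomial

section lift
variable {F L : Type} [Field F] [Field L] [Algebra F[X] L] [IsFractionRing F[X] L]

lemma exists_lift {R : Type} [Field R] (σ0 : F →+* R) (t : R) (h : ∀ P : F[X], P ≠ 0 → eval₂ σ0 t P ≠ 0) :
    ∃ σ : L →+* R, (∀ a, σ (algebraMap F[X] L (Polynomial.C a)) = σ0 a) ∧ σ (algebraMap F[X] L X) = t := by
  have hi : Function.Injective (eval₂RingHom σ0 t) := by
    rw [injective_iff_map_eq_zero]
    intro P hP
    by_contra h0
    exact h P h0 hP
  refine ⟨IsFractionRing.lift hi, ?_, ?_⟩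
  · intro a; rw [IsFractionRing.lift_algebraMap]; simp
  · rw [IsFractionRing.lift_algebraMap]; simp

lemma hom_ext {R : Type} [Field R] (f g : L →+* R)
    (hC : ∀ a, f (algebraMap F[X] L (Polynomial.C a)) = g (algebraMap F[X] L (Polynomial.C a)))
    (hX : f (algebraMap F[X] L X) = g (algebraMap F[X] L X)) (z : L) : f z = g z := by
  have h : f.comp (algebraMap F[X] L) = g.comp (algebraMap F[X] L) :=
    Polynomial.ringHom_ext hC hX
  obtain ⟨a, b, -, rfl⟩ := IsFractionRing.div_surjective (A := F[X]) z
  have h' : ∀ a, f (algebraMap F[X] L a) = g (algebraMap F[X] L a) := fun a => congrArg (fun φ => φ a) h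
  rw [map_div₀, map_div₀, h', h']

lemma sub_gen (S : Subfield L) (hC : ∀ a, algebraMap F[X] L (Polynomial.C a) ∈ S)
    (hX : algebraMap F[X] L X ∈ S) (z : L) : z ∈ S := by
  have h' : ∀ a, algebraMap F[X] L a ∈ S := by
    intro a
    induction a using Polynomial.induction_on' with
    | add p q hp hq => rw [map_add]; exact S.add_mem hp hq
    | monomial n a =>
      rw [← C_mul_X_pow_eq_monomial, map_mul, map_pow]
      exact S.mul_mem (hC a) (S.pow_mem hX n)
  obtain ⟨a, b, -, rfl⟩ := IsFractionRing.div_surjective (A := F[X]) z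
  exact S.div_mem (h' a) (h' b)
end lift

theorem core (F k E M : Type) [Field F] [Field k] [Field E] [Field M]
    [Algebra F[X] k] [IsFractionRing F[X] k] [Algebra k[X] E] [IsFractionRing k[X] E]
    [Algebra E[X] M] [IsFractionRing E[X] M] [Algebra ℂ M] (h2 : (2 : k) ≠ 0)
    (φ : ℂ →+* F) (hφ : Function.Surjective φ)
    (hA : ∀ z : ℂ, algebraMap ℂ M z = algebraMap E[X] M (Polynomial.C (algebraMap k[X] E
      (Polynomial.C (algebraMap F[X] k (Polynomial.C (φ z))))))) :
    ∃ S : Finset M, Algebra.IsAlgebraic (IntermediateField.adjoin ℂ (S : Set M)) M ∧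
      ∃ x y g1 g2 X Y : IntermediateField.adjoin ℂ (S : Set M), x ≠ 0 ∧ y ≠ 0 ∧ g1 ≠ 0 ∧ g2 ≠ 0 ∧
        g1 = y ^ 2 - x ^ 2 ∧ g2 = 1 - x ^ 2 * y ^ 2 ∧ g1 * g2 = X ^ 2 - x * Y ^ 2 ∧
        ¬ Split (IntermediateField.adjoin ℂ (S : Set M)) x g1 := by
  classical
  -- the automorphisms
  have i1 := IsFractionRing.injective F[X] k
  have i2 := IsFractionRing.injective k[X] E
  have i3 := IsFractionRing.injective E[X] M
  let s0 : k := algebraMap F[X] k X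
  have hs0 : s0 ≠ 0 := (map_ne_zero_iff _ i1).2 X_ne_zero
  obtain ⟨τ0, hτ0C, hτ0X⟩ := exists_lift (F := F) (L := k) ((algebraMap F[X] k).comp Polynomial.C) (-s0) (by
    intro P hP
    have : eval₂ ((algebraMap F[X] k).comp Polynomial.C) (-s0) P = algebraMap F[X] k (P.comp (-X)) := by
      rw [Polynomial.comp, hom_eval₂, map_neg]
    rw [this]
    refine (map_ne_zero_iff _ i1).2 (fun h => hP ?_)
    simpa using congrArg (fun q => q.comp (-X)) h)
  change τ0 s0 = -s0 at hτ0X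
  have hτ0τ0 : ∀ a, τ0 (τ0 a) = a := by
    intro a
    refine hom_ext (F := F) (τ0.comp τ0) (RingHom.id k) ?_ ?_ a
    · intro a
      simp only [RingHom.comp_apply, RingHom.id_apply]
      rw [hτ0C, RingHom.comp_apply, hτ0C, RingHom.comp_apply]
    · change τ0 (τ0 s0) = s0
      rw [hτ0X, map_neg, hτ0X, neg_neg]
  let s1 : E := algebraMap k[X] E (Polynomial.C s0)
  let y1 : E := algebraMap k[X] E X
  have hs1 : s1 ≠ 0 := (map_ne_zero_iff _ i2).2 (C_ne_zero.2 hs0)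
  have hy1 : y1 ≠ 0 := (map_ne_zero_iff _ i2).2 X_ne_zero
  obtain ⟨τ, hτC, hτX⟩ := exists_lift (F := k) (L := E)
    (((algebraMap k[X] E).comp Polynomial.C).comp τ0) y1 (by
    intro P hP
    have : eval₂ (((algebraMap k[X] E).comp Polynomial.C).comp τ0) y1 P = algebraMap k[X] E (P.map τ0) := by
      rw [← eval₂_map, ← hom_eval₂, eval₂_C_X]
    rw [this]
    exact (map_ne_zero_iff _ i2).2 ((Polynomial.map_ne_zero_iff τ0.injective).2 hP))
  change τ y1 = y1 at hτX
  have hττ : ∀ a, τ (τ a) = a := by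
    intro a
    refine hom_ext (F := k) (τ.comp τ) (RingHom.id E) ?_ ?_ a
    · intro a
      simp only [RingHom.comp_apply, RingHom.id_apply]
      rw [hτC, RingHom.comp_apply, RingHom.comp_apply, hτC, RingHom.comp_apply, RingHom.comp_apply, hτ0τ0]
    · change τ (τ y1) = y1
      rw [hτX, hτX]
  have hτs : τ s1 = -s1 := by
    change τ (algebraMap k[X] E (Polynomial.C s0)) = _
    rw [hτC, RingHom.comp_apply, hτ0X]; simp [s1]
  let P1 : k[X] := X ^ 2 - Polynomial.C (s0 ^ 4)
  let P2 : k[X] := 1 - Polynomial.C (s0 ^ 4) * X ^ 2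
  have hP1 : P1 = (X - Polynomial.C (s0 ^ 2)) * (X + Polynomial.C (s0 ^ 2)) := by
    simp only [P1, map_pow]; ring
  have hP2 : P2 = (X - Polynomial.C ((s0 ^ 2)⁻¹)) * (- Polynomial.C (s0 ^ 4) * (X + Polynomial.C ((s0 ^ 2)⁻¹))) := by
    have : Polynomial.C (s0 ^ 2) * Polynomial.C ((s0 ^ 2)⁻¹) = 1 := by
      rw [← Polynomial.C_mul, mul_inv_cancel₀ (pow_ne_zero _ hs0), Polynomial.C_1]
    have h4 : Polynomial.C (s0 ^ 4) = Polynomial.C (s0 ^ 2) ^ 2 := by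
      rw [← Polynomial.C_pow, ← pow_mul]
    simp only [P2, h4]
    linear_combination (-1 - Polynomial.C (s0 ^ 2) * Polynomial.C ((s0 ^ 2)⁻¹)) * this
  have hR1 : (X + Polynomial.C (s0 ^ 2)).eval (s0 ^ 2) ≠ 0 := by
    rw [eval_add, eval_X, eval_C, ← two_mul]
    exact mul_ne_zero h2 (pow_ne_zero _ hs0)
  have hR2 : (- Polynomial.C (s0 ^ 4) * (X + Polynomial.C ((s0 ^ 2)⁻¹))).eval ((s0 ^ 2)⁻¹) ≠ 0 := by
    rw [eval_mul, eval_neg, eval_C, eval_add, eval_X, eval_C, ← two_mul]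
    exact mul_ne_zero (neg_ne_zero.2 (pow_ne_zero _ hs0)) (mul_ne_zero h2 (inv_ne_zero (pow_ne_zero _ hs0)))
  have hP10 : P1 ≠ 0 := by
    rw [hP1]; refine mul_ne_zero (X_sub_C_ne_zero _) ?_
    intro h; rw [h] at hR1; simp at hR1
  have hP20 : P2 ≠ 0 := by
    rw [hP2]; refine mul_ne_zero (X_sub_C_ne_zero _) ?_
    intro h; rw [h] at hR2; simp at hR2
  let g1 : E := algebraMap k[X] E P1
  let g2 : E := algebraMap k[X] E P2
  have hg10 : g1 ≠ 0 := (map_ne_zero_iff _ i2).2 hP10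
  have hg20 : g2 ≠ 0 := (map_ne_zero_iff _ i2).2 hP20
  have hg1 : g1 = y1 ^ 2 - s1 ^ 4 := by simp [g1, P1, y1, s1]
  have hg2 : g2 = 1 - s1 ^ 4 * y1 ^ 2 := by simp [g2, P2, y1, s1]
  have hτg1 : τ g1 = g1 := by
    rw [hg1]; simp only [map_sub, map_pow, hτs, hτX]; ring
  have hτg2 : τ g2 = g2 := by
    rw [hg2]; simp only [map_sub, map_mul, map_one, map_pow, hτs, hτX]; ring
  have hc : g1 * g2 ≠ 0 := mul_ne_zero hg10 hg20
  let T : M := algebraMap E[X] M X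
  have hT : T ≠ 0 := (map_ne_zero_iff _ i3).2 X_ne_zero
  let j : E →+* M := (algebraMap E[X] M).comp Polynomial.C
  obtain ⟨σ, hσC, hσX⟩ := exists_lift (F := E) (L := M)
    ((algebraMap E[X] M).comp (Polynomial.C.comp τ))
    (algebraMap E[X] M (Polynomial.C (g1 * g2)) * (algebraMap E[X] M X)⁻¹) (by
    intro P hP h
    have := til_eval (M := M) τ hc P hT
    rw [h, zero_mul] at this
    exact til_ne τ hc P hP ((map_eq_zero_iff _ i3).1 this.symm))
  have hσj : ∀ a, σ (j a) = j (τ a) := hσC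
  have hσT : σ T = j (g1 * g2) * T⁻¹ := hσX
  let s := j s1
  let y := j y1
  have hs : s ≠ 0 := (map_ne_zero j).2 hs1
  have hy : y ≠ 0 := (map_ne_zero j).2 hy1
  have h2M : (2 : M) ≠ 0 := by
    have h3 : (algebraMap E[X] M).comp (Polynomial.C.comp ((algebraMap k[X] E).comp Polynomial.C)) (2 : k) ≠ 0 :=
      (_root_.map_ne_zero _).2 h2
    rwa [map_ofNat] at h3
  let c : M := j (g1 * g2)
  have hcM : c ≠ 0 := (map_ne_zero j).2 hc
  have hσc : σ c = c := by
    change σ (j _) = j _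
    rw [hσj, map_mul τ, hτg1, hτg2]
  have hσs : σ s = -s := by
    change σ (j _) = - j _
    rw [hσj, hτs, map_neg]
  have hσy : σ y = y := by
    change σ (j _) = j _
    rw [hσj, hτX]
  change σ T = c * T⁻¹ at hσT
  let Xc : M := (T + c * T⁻¹) / 2
  let Yc : M := (T - c * T⁻¹) / (2 * s)
  have hXY : c = Xc ^ 2 - s ^ 2 * Yc ^ 2 := by
    simp only [Xc, Yc]; field_simp; ring
  have hTX : T = Xc + s * Yc := by
    simp only [Xc, Yc]; field_simp; ring
  have hσXc : σ Xc = Xc := by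
    simp only [Xc, map_div₀, map_add, map_mul, map_inv₀, hσT, hσc, map_ofNat]
    field_simp; ring
  have hσYc : σ Yc = Yc := by
    simp only [Yc, map_div₀, map_sub, map_mul, map_inv₀, hσT, hσc, hσs, map_ofNat]
    field_simp; ring
  let S : Finset M := {s ^ 2, y, Xc, Yc}
  have hσℂ : ∀ z : ℂ, σ (algebraMap ℂ M z) = algebraMap ℂ M z := by
    intro z
    rw [hA]
    change σ (j _) = j _
    rw [hσj]
    congr 1
    rw [hτC, RingHom.comp_apply, hτ0C]; rfl
  have hfix : ∀ z ∈ IntermediateField.adjoin ℂ (S : Set M), σ z = z := by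
    intro z hz
    induction hz using IntermediateField.adjoin_induction with
    | mem z hz =>
      simp only [S, Finset.coe_insert, Finset.coe_singleton, Set.mem_insert_iff, Set.mem_singleton_iff] at hz
      rcases hz with rfl | rfl | rfl | rfl
      · rw [map_pow, hσs, neg_sq]
      · exact hσy
      · exact hσXc
      · exact hσYc
    | algebraMap z => exact hσℂ z
    | add a b _ _ ha hb => rw [map_add, ha, hb]
    | inv a _ ha => rw [map_inv₀, ha]
    | mul a b _ _ ha hb => rw [map_mul, ha, hb]
  have hsub := IntermediateField.subset_adjoin ℂ (S : Set M)
  have mx : s ^ 2 ∈ IntermediateField.adjoin ℂ (S : Set M) := hsub (by simp [S])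
  have my : y ∈ IntermediateField.adjoin ℂ (S : Set M) := hsub (by simp [S])
  have mX : Xc ∈ IntermediateField.adjoin ℂ (S : Set M) := hsub (by simp [S])
  have mY : Yc ∈ IntermediateField.adjoin ℂ (S : Set M) := hsub (by simp [S])
  refine ⟨S, ?_, ?_⟩
  · generalize IntermediateField.adjoin ℂ (S : Set M) = K at *
    let B : Subfield M := (algebraicClosure K M).toSubfield
    have hB : ∀ z ∈ K, z ∈ B := fun z hz =>
      (algebraicClosure K M).algebraMap_mem ⟨z, hz⟩
    have hBs : s ∈ B := by
      have h : IsAlgebraic K (s ^ 2) := isAlgebraic_algebraMap (⟨s ^ 2, mx⟩ : K)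
      exact mem_algebraicClosure_iff.2 (h.of_pow (by norm_num))
    have hBT : T ∈ B := by
      rw [hTX]; exact B.add_mem (hB _ mX) (B.mul_mem hBs (hB _ mY))
    have hBall : ∀ z, z ∈ B := by
      refine sub_gen (F := E) B (fun a => ?_) hBT
      change a ∈ B.comap j
      refine sub_gen (F := k) (B.comap j) (fun a => ?_) (hB _ my) a
      change a ∈ (B.comap j).comap ((algebraMap k[X] E).comp Polynomial.C)
      refine sub_gen (F := F) _ (fun a => ?_) hBs a
      obtain ⟨z, rfl⟩ := hφ a
      have := hB _ (K.algebraMap_mem z)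
      rw [hA] at this
      exact this
    exact ⟨fun z => mem_algebraicClosure_iff.1 (hBall z)⟩
  · have mx2 := mx
    let K := IntermediateField.adjoin ℂ (S : Set M)
    let xK : K := ⟨s ^ 2, mx⟩
    let yK : K := ⟨y, my⟩
    let XK : K := ⟨Xc, mX⟩
    let YK : K := ⟨Yc, mY⟩
    have e1 : ((yK ^ 2 - xK ^ 2 : K) : M) = j g1 := by
      rw [hg1]
      change y ^ 2 - (s ^ 2) ^ 2 = _
      simp only [map_sub, map_pow, s, y]
      ring
    have e2 : ((1 - xK ^ 2 * yK ^ 2 : K) : M) = j g2 := by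
      rw [hg2]
      change 1 - (s ^ 2) ^ 2 * y ^ 2 = _
      simp only [map_sub, map_mul, map_one, map_pow, s, y]
      ring
    refine ⟨xK, yK, yK ^ 2 - xK ^ 2, 1 - xK ^ 2 * yK ^ 2, XK, YK, ?_, ?_, ?_, ?_, rfl, rfl, ?_, ?_⟩
    · exact fun h => pow_ne_zero 2 hs (congrArg (fun a : K => (a : M)) h)
    · exact fun h => hy (congrArg (fun a : K => (a : M)) h)
    · intro h; rw [h] at e1; exact (map_ne_zero j).2 hg10 e1.symm
    · intro h; rw [h] at e2; exact (map_ne_zero j).2 hg20 e2.symm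
    · apply Subtype.ext
      rw [IntermediateField.coe_mul, e1, e2, ← map_mul]
      exact hXY
    · rintro ⟨p, q, r, hne, e⟩
      have eM := congrArg (fun a : K => (a : M)) e
      simp only [IntermediateField.coe_add, IntermediateField.coe_mul, IntermediateField.coe_pow, e1] at eM
      change s ^ 2 * (p : M) ^ 2 + _ = _ at eM
      have fp := hfix p p.2
      have fq := hfix q q.2
      have fr := hfix r r.2
      by_cases hq : (q : M) = 0
      · have hq' : q = 0 := Subtype.ext hq
        rw [hq] at eM
        have h3 : (s * p) ^ 2 = (r : M) ^ 2 := by linear_combination eM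
        have h4 : (r : M) = 0 ∧ s * p = 0 := by
          rcases sq_eq_sq_iff_eq_or_eq_neg.1 h3 with h | h
          · have h5 := congrArg σ h
            rw [map_mul, hσs, fp, fr] at h5
            have : (2 : M) * r = 0 := by linear_combination -h - h5
            have hr := (mul_eq_zero.1 this).resolve_left h2M
            exact ⟨hr, by rw [h, hr]⟩
          · have h5 := congrArg σ h
            rw [map_mul, hσs, fp, map_neg, fr] at h5
            have : (2 : M) * r = 0 := by linear_combination h + h5
            have hr := (mul_eq_zero.1 this).resolve_left h2M
            exact ⟨hr, by rw [h, hr, neg_zero]⟩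
        have hp' : p = 0 := Subtype.ext ((mul_eq_zero.1 h4.2).resolve_left hs)
        have hr' : r = 0 := Subtype.ext h4.1
        rcases hne with h | h | h
        · exact h hp'
        · exact h hq'
        · exact h hr'
      · obtain ⟨ε, hε⟩ := norm_lemma2 (M := M) τ g1 g2 hg10 hg20 rfl hτg1 hτg2 hττ σ hσC hσX
          ((r + s * p) / q) (by
            rw [map_div₀, map_add, map_mul, hσs, fp, fq, fr]
            change _ = j g1
            field_simp
            linear_combination -eM)
        rcases hε with hε | hε
        · exact not_norm τ0 τ hτC hτX (s0 ^ 2) (by rw [map_pow, hτ0X, neg_sq]) P1 _ hP1 hR1 ε hε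
        · exact not_norm τ0 τ hτC hτX ((s0 ^ 2)⁻¹) (by rw [map_inv₀, map_pow, hτ0X, neg_sq]) P2 _ hP2 hR2 ε hε
end AM

namespace AM
theorem trdeg_sub (M : Type) [Field M] [Algebra ℂ M] (n : ℕ) (hM : Algebra.trdeg ℂ M = n)
    (K : IntermediateField ℂ M) [Algebra.IsAlgebraic K M] :
    ∃ x : Fin n → K, IsTranscendenceBasis ℂ x := by
  have h1 := trdeg_add_eq ℂ K (A := M)
  rw [trdeg_eq_zero (R := K) (A := M), add_zero, hM] at h1
  obtain ⟨ι, x, hx⟩ := exists_isTranscendenceBasis' ℂ K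
  have h2 := hx.cardinalMk_eq_trdeg
  rw [h1, ← Cardinal.mk_fin] at h2
  obtain ⟨e⟩ := Cardinal.eq.1 h2
  exact ⟨x ∘ e.symm, (isTranscendenceBasis_equiv e.symm).2 hx⟩

theorem trdeg_RK (n : ℕ) : Algebra.trdeg ℂ (RK ℂ n) = n := by
  have h1 := trdeg_add_eq ℂ (MvPolynomial (Fin n) ℂ) (A := RK ℂ n)
  have : Algebra.IsAlgebraic (MvPolynomial (Fin n) ℂ) (RK ℂ n) :=
    IsLocalization.isAlgebraic _ (nonZeroDivisors _)
  rw [trdeg_eq_zero (R := MvPolynomial (Fin n) ℂ) (A := RK ℂ n), add_zero, MvPolynomial.trdeg_of_isDomain] at h1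
  rw [← h1]; simp

theorem fg_adjoin (M : Type) [Field M] [Algebra ℂ M] (S : Finset M) :
    ∃ s : Finset (IntermediateField.adjoin ℂ (S : Set M)),
      IntermediateField.adjoin ℂ (s : Set (IntermediateField.adjoin ℂ (S : Set M))) = ⊤ := by
  classical
  have hsub := IntermediateField.subset_adjoin ℂ (S : Set M)
  refine ⟨S.attach.image (fun z => ⟨z.1, hsub z.2⟩), ?_⟩
  apply IntermediateField.map_injective (IntermediateField.adjoin ℂ (S : Set M)).val
  rw [IntermediateField.adjoin_map, ← AlgHom.fieldRange_eq_map, IntermediateField.fieldRange_val]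
  congr 1
  ext z
  simp only [Set.mem_image, Finset.coe_image, Finset.mem_coe, Finset.mem_attach, true_and]
  constructor
  · rintro ⟨_, ⟨w, rfl⟩, rfl⟩
    exact w.2
  · intro hz
    exact ⟨⟨z, hsub hz⟩, ⟨⟨z, hz⟩, rfl⟩, rfl⟩

theorem final :
    ∃ (K : IntermediateField ℂ (RK ℂ 3)),
      (∃ s : Finset K, IntermediateField.adjoin ℂ (s : Set K) = ⊤) ∧
      (∃ x : Fin 3 → K, IsTranscendenceBasis ℂ x) ∧
      ∀ n m : ℕ, ¬ Nonempty (RK K n ≃ₐ[ℂ] RK ℂ m) := by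
  obtain ⟨a1, f1, c1⟩ := tower' ℂ 0
  obtain ⟨a2, f2, c2⟩ := tower' ℂ 1
  obtain ⟨a3, f3, c3⟩ := tower' ℂ 2
  obtain ⟨S, hS, x, y, g1, g2, X, Y, hx, hy, hg1, hg2, e1, e2, e, hns⟩ :=
    core (RK ℂ 0) (RK ℂ 1) (RK ℂ 2) (RK ℂ 3)
      (by rw [← map_ofNat (algebraMap ℂ (RK ℂ 1)) 2]
          exact (map_ne_zero _).2 (by norm_num)) (algebraMap ℂ (RK ℂ 0)) (fr_zero_surj ℂ)
      (by intro z; rw [c1, c2, c3])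
  refine ⟨IntermediateField.adjoin ℂ (S : Set (RK ℂ 3)), fg_adjoin _ S, trdeg_sub _ 3 (trdeg_RK 3) _, ?_⟩
  rintro n m ⟨ψ⟩
  apply hns
  apply split_RK _ _ _ n
  generalize IntermediateField.adjoin ℂ (S : Set (RK ℂ 3)) = K at *
  let ι : K →+* RK ℂ m := ψ.toRingEquiv.toRingHom.comp (algebraMap K (RK K n))
  obtain ⟨z, hz⟩ := IsAlgClosed.exists_pow_nat_eq (-1 : ℂ) (n := 4) (by norm_num)
  have key : Split (RK ℂ m) (ι x) (ι g1) := by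
    refine good_C m (Units.mk0 (ι x) ((map_ne_zero ι).2 hx)) (Units.mk0 (ι g1) ((map_ne_zero ι).2 hg1)) (fun v => ?_)
    refine triv_AM v (algebraMap ℂ _ z) (by rw [← map_pow, hz]; simp) _
      (Units.mk0 (ι y) ((map_ne_zero ι).2 hy)) _ (Units.mk0 (ι g2) ((map_ne_zero ι).2 hg2)) ?_ ?_ (ι X) (ι Y) ?_
    · simp only [Units.val_mk0]; rw [e1]; simp
    · simp only [Units.val_mk0]; rw [e2]; simp
    · simp only [Units.val_mk0]; rw [← map_mul, e]; simp
  have := key.map ψ.symm.toRingEquiv.toRingHom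
  have hi : ∀ w, ψ.symm.toRingEquiv.toRingHom (ι w) = algebraMap K (RK K n) w :=
    fun w => ψ.symm_apply_apply _
  rwa [hi, hi] at this
end AM

open MvPolynomial

/-- **Artin–Mumford theorem, field-theoretic form.** There is a field `K`, finitely generated
and of transcendence degree 3 over `ℂ`, which is unirational over `ℂ` but not stably rational
over `ℂ`: for every `n ≥ 0`, `K(u₁,…,uₙ)` is not purely transcendental over `ℂ`. -/
theorem artin_mumford_not_stably_rational :
    ∃ (K : Type) (_ : Field K) (_ : Algebra ℂ K),
      (∃ s : Finset K, IntermediateField.adjoin ℂ (s : Set K) = ⊤) ∧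
      (∃ x : Fin 3 → K, IsTranscendenceBasis ℂ x) ∧
      IsUnirational K ∧
      ∀ n : ℕ, ¬ IsPurelyTranscendental (FractionRing (MvPolynomial (Fin n) K)) := by
  obtain ⟨K, h1, h2, h3⟩ := AM.final
  refine ⟨K, inferInstance, inferInstance, h1, h2, ⟨3, K.val, K.val.injective⟩, ?_⟩
  rintro n ⟨m, h⟩
  exact h3 n m h
end

section
/- Let K be a subfield of the rational function field ℂ(t₁,…,t_N) containing ℂ, and suppose K has transcendence degree n over ℂ. Then there exists a ℂ-algebra embedding of K into ℂ(t₁,…,tₙ). (In the definition of unirationality of an n-dimensional variety one may take the source projective space to have dimension n.) -/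
open MvPolynomial

lemma ratFunc_basis (m : ℕ) :
    IsTranscendenceBasis ℂ (algebraMap (MvPolynomial (Fin m) ℂ) (CRatFunc m) ∘ X) :=
  have : Algebra.IsAlgebraic (MvPolynomial (Fin m) ℂ) (CRatFunc m) :=
    IsLocalization.isAlgebraic _ (nonZeroDivisors (MvPolynomial (Fin m) ℂ))
  (IsTranscendenceBasis.mvPolynomial (Fin m) ℂ).algebraMap_comp

lemma exists_local {A L D : Type*} [CommRing A] [IsDomain A] [IsIntegrallyClosed A] [Algebra ℂ A]
    [Field L] [Algebra A L] [IsFractionRing A L] [Algebra ℂ L] [IsScalarTower ℂ A L]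
    [Field D] [Algebra ℂ D] (φ : A →ₐ[ℂ] D) :
    ∃ (O : Subalgebra ℂ L) (ψ : O →ₐ[ℂ] D),
      (∀ a, ∃ h : algebraMap A L a ∈ O, ψ ⟨_, h⟩ = φ a) ∧
      (∀ y (h : y ∈ O), ψ ⟨y, h⟩ ≠ 0 → y⁻¹ ∈ O) ∧ (∀ y : L, IsIntegral O y → y ∈ O) := by
  have hP : (RingHom.ker φ).IsPrime := RingHom.ker_isPrime φ
  let M : Submonoid A := (RingHom.ker φ).primeCompl
  have hM : M ≤ nonZeroDivisors A := (RingHom.ker φ).primeCompl_le_nonZeroDivisors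
  let O : Subalgebra A L := Localization.subalgebra.ofField L M hM
  have hloc : IsLocalization M O := Localization.subalgebra.isLocalization_ofField L M hM
  have hu : ∀ y : M, IsUnit (φ y) := fun y => by
    have := y.2
    exact isUnit_iff_ne_zero.mpr (fun h => this h)
  have hO : IsIntegrallyClosed O := isIntegrallyClosed_of_isLocalization O M hM
  let ψ : O →ₐ[ℂ] D := IsLocalization.liftAlgHom (M := M) (f := φ) hu
  have hψ : ∀ a : A, ψ (algebraMap A O a) = φ a := fun a => by
    simp [ψ]
  refine ⟨O.restrictScalars ℂ, ψ, ?_, ?_, ?_⟩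
  · intro a
    exact ⟨O.algebraMap_mem a, hψ a⟩
  · intro y0 hy0 hy
    let y : O := ⟨y0, hy0⟩
    have hy : ψ y ≠ 0 := hy
    change (y : L)⁻¹ ∈ O
    obtain ⟨a, s, has⟩ := IsLocalization.exists_mk'_eq (S := O) M y
    have h1 : (y : O) * algebraMap A O s = algebraMap A O a := by
      rw [← has]; exact IsLocalization.mk'_spec _ _ _
    have h2 : φ a ≠ 0 := by
      rw [← hψ, ← h1, map_mul, hψ]
      exact mul_ne_zero hy (hu s).ne_zero
    have h3 : IsUnit (y : O) := by
      have : IsUnit (algebraMap A O a) := IsLocalization.map_units O (⟨a, h2⟩ : M)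
      rw [← h1] at this
      exact isUnit_of_mul_isUnit_left this
    obtain ⟨z, hz⟩ := h3.exists_right_inv
    have h4 : ((y : O) : L) * (z : L) = 1 := congrArg (Subtype.val) hz
    have : (y : L)⁻¹ = z := inv_eq_of_mul_eq_one_right h4
    rw [this]; exact z.2
  · intro y hy
    have hy' : IsIntegral O y := hy
    obtain ⟨z, rfl⟩ := IsIntegrallyClosed.isIntegral_iff.mp hy'
    exact z.2

lemma exists_set (N n : ℕ) (K : IntermediateField ℂ (CRatFunc N))
    (x : Fin n → K) (hx : IsTranscendenceBasis ℂ x) :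
    ∃ S : Finset (Fin N), Fintype.card {j // j ∉ S} = n ∧
      Algebra.IsAlgebraic (Algebra.adjoin ℂ
        ((fun j => algebraMap (MvPolynomial (Fin N) ℂ) (CRatFunc N) (X j)) '' (S : Set (Fin N)) ∪
          Set.range (fun i => (x i : CRatFunc N)))) (CRatFunc N) := by
  classical
  let t : Fin N → CRatFunc N := algebraMap (MvPolynomial (Fin N) ℂ) (CRatFunc N) ∘ X
  have ht : IsTranscendenceBasis ℂ t := ratFunc_basis N
  have hinj : Function.Injective t := ht.1.injective
  have halg : Algebra.IsAlgebraic (Algebra.adjoin K (Set.range t)) (CRatFunc N) := by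
    rw [ht.isAlgebraic_iff]
    intro i
    exact isAlgebraic_algebraMap
      (⟨t i, Algebra.subset_adjoin ⟨i, rfl⟩⟩ : Algebra.adjoin K (Set.range t))
  obtain ⟨T, hTs, hT⟩ := exists_isTranscendenceBasis_subset (R := K) (Set.range t)
  have hsum := hx.sumElim_comp hT
  let S : Finset (Fin N) := Finset.univ.filter (fun j => t j ∈ T)
  have hST : t '' (S : Set (Fin N)) = T := by
    ext y
    constructor
    · rintro ⟨j, hj, rfl⟩
      simpa [S] using hj
    · intro hy
      obtain ⟨j, rfl⟩ := hTs hy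
      exact ⟨j, by simpa [S] using hy, rfl⟩
  refine ⟨S, ?_, ?_⟩
  · have hc := hsum.lift_cardinalMk_eq ht
    have hTc : Cardinal.mk T = S.card := by
      rw [← hST, Cardinal.mk_image_eq hinj]; simp
    simp only [Cardinal.mk_sum, Cardinal.mk_fin, hTc] at hc
    have hc' : S.card + n = N := by
      have : ((S.card + n : ℕ) : Cardinal.{0}) = (N : ℕ) := by simpa using hc
      exact_mod_cast this
    have := Fintype.card_subtype_compl (fun j => j ∈ S)
    simp only [Fintype.card_fin, Fintype.card_coe] at this
    omega
  · have := hsum.isAlgebraic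
    rw [Set.Sum.elim_range, Subtype.range_coe, ← hST] at this
    exact this

lemma mem_local {L D : Type*} [Field L] [Algebra ℂ L] [Field D] [Algebra ℂ D] {n : ℕ}
    (K : IntermediateField ℂ L) (x : Fin n → K) (hx : IsTranscendenceBasis ℂ x)
    (O : Subalgebra ℂ L) (ψ : O →ₐ[ℂ] D)
    (hinv : ∀ y (h : y ∈ O), ψ ⟨y, h⟩ ≠ 0 → y⁻¹ ∈ O) (hint : ∀ y : L, IsIntegral O y → y ∈ O)
    (hxO : ∀ i, (x i : L) ∈ O)
    (hxb : AlgebraicIndependent ℂ (fun i => ψ ⟨x i, hxO i⟩)) :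
    ∀ y : K, (y : L) ∈ O := by
  intro y
  have hKalg := hx.isAlgebraic
  obtain ⟨q, hq0, hq⟩ := (hKalg.isAlgebraic y).exists_integral_multiple
  have hFO : ∀ r ∈ Algebra.adjoin ℂ (Set.range x), (r : L) ∈ O := by
    have : Algebra.adjoin ℂ (Set.range x) ≤ O.comap K.val := by
      refine Algebra.adjoin_le ?_
      rintro _ ⟨i, rfl⟩
      exact hxO i
    exact this
  have hqO := hFO q q.2
  have hqψ : ψ ⟨_, hqO⟩ ≠ 0 := by
    obtain ⟨P, hP⟩ : ∃ P : MvPolynomial (Fin n) ℂ, aeval x P = (q : K) := by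
      have h : ∀ r ∈ Algebra.adjoin ℂ (Set.range x), ∃ P : MvPolynomial (Fin n) ℂ,
          aeval x P = r := by
        intro r hr
        rw [Algebra.adjoin_range_eq_range_aeval] at hr
        exact hr
      exact h q q.2
    have h1 : ψ ⟨_, hqO⟩ = aeval (fun i => ψ ⟨x i, hxO i⟩) P := by
      have h3 : K.val (aeval x P) = aeval (fun i => (x i : L)) P :=
        MvPolynomial.comp_aeval_apply x K.val P
      have h4 : O.val (aeval (fun i => (⟨x i, hxO i⟩ : O)) P) = aeval (fun i => (x i : L)) P :=
        MvPolynomial.comp_aeval_apply (fun i => (⟨x i, hxO i⟩ : O)) O.val P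
      have h5 : ψ (aeval (fun i => (⟨x i, hxO i⟩ : O)) P) = aeval (fun i => ψ ⟨x i, hxO i⟩) P :=
        MvPolynomial.comp_aeval_apply (fun i => (⟨x i, hxO i⟩ : O)) ψ P
      have h2 : (⟨_, hqO⟩ : O) = aeval (fun i => (⟨x i, hxO i⟩ : O)) P := by
        apply Subtype.val_injective
        rw [hP] at h3
        exact h3.trans h4.symm
      rw [h2, h5]
    rw [h1]
    intro h0
    have hP0 : P = 0 := (injective_iff_map_eq_zero _).mp hxb P h0
    apply hq0
    apply Subtype.ext
    rw [← hP, hP0, map_zero]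
    rfl
  have hqinv := hinv _ hqO hqψ
  have hqne : ((q : K) : L) ≠ 0 := fun h => hqψ (by
    have : (⟨_, hqO⟩ : O) = 0 := Subtype.ext h
    rw [this, map_zero])
  have hmem : ((q : K) : L) * y ∈ O := by
    apply hint
    let g : Algebra.adjoin ℂ (Set.range x) →+* O :=
      ((K.val.comp (Subalgebra.val _)).codRestrict O (fun r => hFO r r.2)).toRingHom
    obtain ⟨P, hPm, hP⟩ := hq
    refine ⟨P.map g, hPm.map g, ?_⟩
    rw [Polynomial.eval₂_map]
    have h6 := Polynomial.hom_eval₂ P (algebraMap (Algebra.adjoin ℂ (Set.range x)) K)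
        K.val.toRingHom (q • y)
    rw [hP, map_zero] at h6
    exact h6.symm
  have := O.mul_mem hqinv hmem
  rwa [inv_mul_cancel_left₀ hqne] at this

/-- If `K` is a subfield of `ℂ(t₁,…,t_N)` containing `ℂ`, of transcendence degree `n` over
`ℂ`, then `K` embeds as a `ℂ`-algebra into `ℂ(t₁,…,tₙ)`. -/
theorem unirational_embeds_in_dimension (N n : ℕ) (K : IntermediateField ℂ (CRatFunc N))
    (x : Fin n → K) (hx : IsTranscendenceBasis ℂ x) :
    ∃ f : K →ₐ[ℂ] CRatFunc n, Function.Injective f := by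
  classical
  obtain ⟨S, hS, halg⟩ := exists_set N n K x hx
  set E := Algebra.adjoin ℂ
        ((fun j => algebraMap (MvPolynomial (Fin N) ℂ) (CRatFunc N) (X j)) '' (S : Set (Fin N)) ∪
          Set.range (fun i => (x i : CRatFunc N))) with hE
  let e : {j // j ∉ S} ≃ Fin n := Fintype.equivFinOfCardEq hS
  -- polynomial relations
  have hp : ∀ i : Fin n, ∃ p : Polynomial E, p ≠ 0 ∧
      Polynomial.aeval (algebraMap (MvPolynomial (Fin N) ℂ) (CRatFunc N) (X (e.symm i).1)) p = 0 :=
    fun i => halg.isAlgebraic _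
  choose p hp0 hp1 using hp
  have hq : ∀ i : Fin n, ∃ u v : MvPolynomial (Fin N) ℂ, u ≠ 0 ∧ v ≠ 0 ∧
      ((p i).leadingCoeff : CRatFunc N) * algebraMap _ _ v = algebraMap _ _ u := by
    intro i
    obtain ⟨u, v, hv, huv⟩ := IsFractionRing.div_surjective (A := MvPolynomial (Fin N) ℂ)
      ((p i).leadingCoeff : CRatFunc N)
    have hv0 : v ≠ 0 := nonZeroDivisors.ne_zero hv
    have hv1 : algebraMap (MvPolynomial (Fin N) ℂ) (CRatFunc N) v ≠ 0 := by simpa using hv0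
    refine ⟨u, v, ?_, hv0, ?_⟩
    · rintro rfl
      have : ((p i).leadingCoeff : CRatFunc N) = 0 := by rw [← huv]; simp
      exact hp0 i (Polynomial.leadingCoeff_eq_zero.mp (Subtype.ext this))
    · rw [← huv]; field_simp
  choose u v hu0 hv0 huv using hq
  have hb : ∀ i : Fin n, ∃ a b : MvPolynomial (Fin N) ℂ, b ≠ 0 ∧
      (x i : CRatFunc N) = algebraMap _ _ a * (algebraMap _ _ b)⁻¹ := by
    intro i
    obtain ⟨u, v, hv, huv⟩ := IsFractionRing.div_surjective (A := MvPolynomial (Fin N) ℂ)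
      (x i : CRatFunc N)
    exact ⟨u, v, nonZeroDivisors.ne_zero hv, by rw [← huv, div_eq_mul_inv]⟩
  choose a b hb0 hab using hb
  -- generic point
  have hh : (∏ i, u i * b i) ≠ 0 :=
    Finset.prod_ne_zero_iff.mpr fun i _ => mul_ne_zero (hu0 i) (hb0 i)
  obtain ⟨c, hc⟩ : ∃ c : Fin N → ℂ, eval c (∏ i, u i * b i) ≠ 0 := by
    by_contra hcon
    push Not at hcon
    exact hh (MvPolynomial.funext fun c => by rw [hcon c, map_zero])
  rw [map_prod, Finset.prod_ne_zero_iff] at hc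
  let φ₀ : MvPolynomial (Fin N) ℂ →ₐ[ℂ] MvPolynomial (Fin n) ℂ :=
    aeval (fun j => if h : j ∉ S then X (e ⟨j, h⟩) else C (c j))
  have hφ₀ : ∀ f, eval c f ≠ 0 → φ₀ f ≠ 0 := by
    intro f hf h0
    apply hf
    have : (aeval (fun i => c (e.symm i).1) : MvPolynomial (Fin n) ℂ →ₐ[ℂ] ℂ).comp φ₀
        = aeval c := by
      ext j
      by_cases h : j ∈ S <;> simp [φ₀, h]
    have h2 := DFunLike.congr_fun this f
    rw [AlgHom.comp_apply, h0, map_zero] at h2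
    rw [← MvPolynomial.coe_aeval_eq_eval]
    exact h2.symm
  let φ : MvPolynomial (Fin N) ℂ →ₐ[ℂ] CRatFunc n :=
    (IsScalarTower.toAlgHom ℂ (MvPolynomial (Fin n) ℂ) (CRatFunc n)).comp φ₀
  have hφ : ∀ f, eval c f ≠ 0 → φ f ≠ 0 := by
    intro f hf
    simpa [φ] using hφ₀ f hf
  have hφX : ∀ i, φ (X (e.symm i).1) = algebraMap (MvPolynomial (Fin n) ℂ) (CRatFunc n) (X i) := by
    intro i
    have := (e.symm i).2
    simp [φ, φ₀, this]
  have hφS : ∀ j ∈ S, φ (X j) = algebraMap ℂ (CRatFunc n) (c j) := by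
    intro j hj
    simp only [φ, φ₀, AlgHom.comp_apply, aeval_X, hj, not_true_eq_false, dite_false]
    exact (IsScalarTower.algebraMap_apply ℂ (MvPolynomial (Fin n) ℂ) (CRatFunc n) (c j)).symm
  have hub : ∀ i, φ (u i) ≠ 0 ∧ φ (b i) ≠ 0 := by
    intro i
    have := hc i (Finset.mem_univ i)
    rw [map_mul] at this
    exact ⟨hφ _ (left_ne_zero_of_mul this), hφ _ (right_ne_zero_of_mul this)⟩
  obtain ⟨O, ψ, hψ, hinv, hint⟩ := exists_local (L := CRatFunc N) φ
  have hxO : ∀ i, (x i : CRatFunc N) ∈ O := by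
    intro i
    rw [hab i]
    obtain ⟨h1, h2⟩ := hψ (b i)
    exact O.mul_mem (hψ (a i)).1 (hinv _ h1 (by rw [h2]; exact (hub i).2))
  let xb : Fin n → CRatFunc n := fun i => ψ ⟨x i, hxO i⟩
  let E' := Algebra.adjoin ℂ (Set.range xb)
  have hEO : E ≤ O := by
    rw [hE]
    refine Algebra.adjoin_le ?_
    rintro y (⟨j, hj, rfl⟩ | ⟨i, rfl⟩)
    · exact (hψ (X j)).1
    · exact hxO i
  let θ₀ : E →ₐ[ℂ] CRatFunc n := ψ.comp (Subalgebra.inclusion hEO)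
  have hθ₀ : ∀ y : E, θ₀ y ∈ E' := by
    rintro ⟨y, hy⟩
    have key : ∀ y (hy : y ∈ E), ∀ h : y ∈ O, ψ ⟨y, h⟩ ∈ E' := by
      intro y hy
      rw [hE] at hy
      induction hy using Algebra.adjoin_induction with
      | mem y hy =>
        intro h
        rcases hy with ⟨j, hj, rfl⟩ | ⟨i, rfl⟩
        · rw [(hψ (X j)).2, hφS j hj]
          exact E'.algebraMap_mem _
        · exact Algebra.subset_adjoin ⟨i, rfl⟩
      | algebraMap r =>
        intro h
        have : ψ ⟨_, h⟩ = algebraMap ℂ _ r := ψ.commutes r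
        rw [this]
        exact E'.algebraMap_mem _
      | add y z hy hz ihy ihz =>
        intro h
        have : ψ ⟨_, h⟩ = ψ ⟨y, hEO hy⟩ + ψ ⟨z, hEO hz⟩ := by rw [← map_add]; rfl
        rw [this]
        exact E'.add_mem (ihy _) (ihz _)
      | mul y z hy hz ihy ihz =>
        intro h
        have : ψ ⟨_, h⟩ = ψ ⟨y, hEO hy⟩ * ψ ⟨z, hEO hz⟩ := by rw [← map_mul]; rfl
        rw [this]
        exact E'.mul_mem (ihy _) (ihz _)
    exact key y hy _
  let θ : E →ₐ[ℂ] E' := θ₀.codRestrict E' hθ₀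
  have hlead : ∀ i, θ (p i).leadingCoeff ≠ 0 := by
    intro i h0
    have h1 : ψ ⟨_, hEO (p i).leadingCoeff.2⟩ = 0 := congrArg Subtype.val h0
    have h2 : (⟨_, hEO (p i).leadingCoeff.2⟩ : O) * ⟨_, (hψ (v i)).1⟩ = ⟨_, (hψ (u i)).1⟩ :=
      Subtype.ext (huv i)
    have h3 := congrArg ψ h2
    rw [map_mul, h1, zero_mul, (hψ (u i)).2] at h3
    exact (hub i).1 h3.symm
  have hXalg : ∀ i, IsAlgebraic E' (algebraMap (MvPolynomial (Fin n) ℂ) (CRatFunc n) (X i)) := by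
    intro i
    refine ⟨(p i).map θ.toRingHom, ?_, ?_⟩
    · intro h0
      have := congrArg (fun q => Polynomial.coeff q (p i).natDegree) h0
      simp only [Polynomial.coeff_map, Polynomial.coeff_zero] at this
      exact hlead i this
    · rw [Polynomial.aeval_def, Polynomial.eval₂_map]
      have h1 : (algebraMap E' (CRatFunc n)).comp θ.toRingHom =
          ψ.toRingHom.comp (Subalgebra.inclusion hEO).toRingHom := rfl
      obtain ⟨h2, h3⟩ := hψ (X (e.symm i).1)
      rw [h1, ← hφX, ← h3]
      have h4 := Polynomial.hom_eval₂ (p i) (Subalgebra.inclusion hEO).toRingHom ψ.toRingHom ⟨_, h2⟩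
      refine h4.symm.trans ?_
      have h5 : Polynomial.eval₂ (Subalgebra.inclusion hEO).toRingHom (⟨_, h2⟩ : O) (p i) = 0 := by
        apply Subtype.val_injective
        have h6 := Polynomial.hom_eval₂ (p i) (Subalgebra.inclusion hEO).toRingHom
          O.val.toRingHom ⟨_, h2⟩
        exact h6.trans (hp1 i)
      rw [h5, map_zero]
  have hxb : AlgebraicIndependent ℂ xb := by
    have h1 : Algebra.IsAlgebraic E' (CRatFunc n) := by
      rw [(ratFunc_basis n).isAlgebraic_iff]
      exact hXalg
    exact (Algebra.IsAlgebraic.isTranscendenceBasis_of_le_trdeg_of_finite ℂ xb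
      (ratFunc_basis n).cardinalMk_eq_trdeg.le).1
  have hKO : ∀ y : K, (y : CRatFunc N) ∈ O := mem_local K x hx O ψ hinv hint hxO hxb
  let f : K →ₐ[ℂ] CRatFunc n := ψ.comp (K.val.codRestrict O hKO)
  exact ⟨f, f.toRingHom.injective⟩
end
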